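/- Let n ≥ 2 and 1 ≤ j₀ < j₁ ≤ n. Let ψ¹, ψ² be smooth functions on ℝ compactly supported in sets not containing the origin, and let φ^j (j ∈ {1, …, n}∖{j₀, j₁}) be smooth compactly supported functions on ℝ; write g_k(η) = g(2^{−k}η). Define the symbol m(ξ) = ∑_{k ∈ ℤ} μ_n(ξ) ψ¹_k(ξ_{j₀}) ψ²_k(ξ_{j₁}) ∏_{j ∉ {j₀, j₁}} φ^j_k(ξ_j) on ℝⁿ. Then for all exponents with ∑_{j=0}^{n} 1/p_j = 1, p₀, p_{j₀}, p_{j₁} ∈ (1, ∞) and p_j ∈ (1, ∞] for j ∉ {0, j₀, j₁}, there is a constant c such that |Λ_m(F₀, …, F_n)| ≤ c ∏_{j=0}^{n} ‖F_j‖_{p_j} for all Schwartz functions F₀, …, F_n on ℝⁿ. -/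

import Mathlib

open MeasureTheory

/-- The symbol `μ_n` in dimension `n = m + 1`:
`μ_n(ξ) = ∫_{[0,1]^{n-1}} sgn(α₁ξ₁ + ⋯ + α_{n-1}ξ_{n-1} + ξ_n) dα`. -/
noncomputable def muSymbol (m : ℕ) (ξ : Fin (m + 1) → ℝ) : ℝ :=
  ∫ α in (Set.univ.pi fun _ : Fin m => Set.Icc (0:ℝ) 1),
    Real.sign ((∑ j : Fin m, α j * ξ j.castSucc) + ξ (Fin.last m))

/-- The Fourier transform `F̂(ξ) = ∫_{ℝⁿ} e^{-2πi x·ξ} F(x) dx` on `ℝⁿ`. -/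
noncomputable def fourierT (n : ℕ) (F : (Fin n → ℝ) → ℂ) (ξ : Fin n → ℝ) : ℂ :=
  ∫ x : Fin n → ℝ,
    Complex.exp (((-2 * Real.pi * ∑ j, x j * ξ j : ℝ) : ℂ) * Complex.I) * F x

/-- The multilinear form `Λ_m` associated to a symbol `m` on `ℝⁿ`:
`Λ_m(F₀,…,F_n) = ∫_{(ℝⁿ)ⁿ} F̂₀(-(τ₁+⋯+τ_n)) (∏_{j=1}^n F̂_j(τ_j)) m(τ₁₁,…,τ_{nn}) dτ`.
The functions are indexed by `ℕ`; only the indices `0,…,n` are used. -/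
noncomputable def formM (n : ℕ) (m : (Fin n → ℝ) → ℂ) (F : ℕ → (Fin n → ℝ) → ℂ) : ℂ :=
  ∫ τ : Fin n → Fin n → ℝ,
    fourierT n (F 0) (-(∑ j, τ j)) *
      (∏ j : Fin n, fourierT n (F (j.1 + 1)) (τ j)) *
      m (fun j => τ j j)

section
open MeasureTheory

namespace PP

/-- dyadic interval -/
def dyI (q : ℤ × ℤ) : Set ℝ := Set.Ico ((q.2:ℝ) * 2 ^ q.1) (((q.2:ℝ) + 1) * 2 ^ q.1)

lemma mem_dyI {q : ℤ × ℤ} {x : ℝ} : x ∈ dyI q ↔ ⌊x / 2 ^ q.1⌋ = q.2 := by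
  have h : (0:ℝ) < 2 ^ q.1 := by positivity
  rw [Int.floor_eq_iff, dyI, Set.mem_Ico, le_div_iff₀ h, div_lt_iff₀ h]

lemma dyI_nested {k k' : ℤ} (h : k ≤ k') {x y : ℝ} (hxy : ⌊x / 2 ^ k⌋ = ⌊y / 2 ^ k⌋) :
    ⌊x / 2 ^ k'⌋ = ⌊y / 2 ^ k'⌋ := by
  obtain ⟨j, rfl⟩ := Int.le.dest h
  have h2 : ∀ z : ℝ, z / 2 ^ (k + (j:ℤ)) = (z / 2 ^ k) / ((2 ^ j : ℕ) : ℝ) := by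
    intro z
    rw [zpow_add₀ (by norm_num), div_div]; simp
  rw [h2, h2, Int.floor_div_natCast, Int.floor_div_natCast, hxy]

lemma dyI_left_mem (q : ℤ × ℤ) : (q.2:ℝ) * 2 ^ q.1 ∈ dyI q := by
  have h : (0:ℝ) < 2 ^ q.1 := by positivity
  rw [dyI]; constructor <;> nlinarith

lemma measurableSet_dyI (q : ℤ × ℤ) : MeasurableSet (dyI q) := measurableSet_Ico

lemma volume_dyI (q : ℤ × ℤ) : volume (dyI q) = ENNReal.ofReal (2 ^ q.1) := by
  rw [dyI, Real.volume_Ico]; congr 1; ring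

lemma cz_cover (v : ℝ → ℝ) (hv : Continuous v) (h0 : ∀ x, 0 ≤ v x) (hi : Integrable v)
    {lam : ℝ} (hl : 0 < lam) :
    ∃ J : Set (ℤ × ℤ), (J.PairwiseDisjoint dyI) ∧
      (∀ q ∈ J, lam * 2 ^ q.1 < ∫ x in dyI q, v x) ∧
      (∀ q ∈ J, ∫ x in dyI q, v x ≤ 2 * lam * 2 ^ q.1) ∧
      (∀ x, x ∉ (⋃ q ∈ J, dyI q) → v x ≤ lam) := by
  set P : ℤ × ℤ → Prop := fun q => lam * 2 ^ q.1 < ∫ x in dyI q, v x with hP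
  set Q : ℝ → ℤ → Prop := fun x k => P (k, ⌊x / 2 ^ k⌋) with hQ
  have hmem : ∀ x k, x ∈ dyI (k, ⌊x / 2 ^ k⌋) := fun x k => mem_dyI.2 rfl
  have hbd : ∀ x, ∃ b, ∀ z, Q x z → z ≤ b := by
    intro x
    obtain ⟨n, hn⟩ := pow_unbounded_of_one_lt ((∫ x, v x) / lam) (one_lt_two (α := ℝ))
    refine ⟨n, fun z hz => ?_⟩
    by_contra hcon
    push Not at hcon
    have h1 : ∫ y in dyI (z, ⌊x / 2 ^ z⌋), v y ≤ ∫ y, v y :=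
      setIntegral_le_integral hi (Filter.Eventually.of_forall h0)
    have h2 : (2:ℝ) ^ (n:ℤ) ≤ 2 ^ z := zpow_le_zpow_right₀ (by norm_num) hcon.le
    rw [div_lt_iff₀ hl] at hn
    have h3 : lam * 2 ^ z < ∫ y in dyI (z, ⌊x / 2 ^ z⌋), v y := hz
    rw [zpow_natCast] at h2
    nlinarith
  refine ⟨{q | P q ∧ ∀ k' > q.1, ¬ Q ((q.2:ℝ) * 2 ^ q.1) k'}, ?_, ?_, ?_, ?_⟩
  · rintro ⟨k, m⟩ ⟨hq, hq'⟩ ⟨k', m'⟩ ⟨hr, hr'⟩ hne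
    rw [Function.onFun, Set.disjoint_left]
    intro x hx hx'
    apply hne
    rw [mem_dyI] at hx hx'
    have e1 := mem_dyI.1 (dyI_left_mem (k, m))
    have e2 := mem_dyI.1 (dyI_left_mem (k', m'))
    simp only at hx hx' e1 e2 hq hq' hr hr'
    rcases lt_trichotomy k k' with h | h | h
    · exfalso
      apply hq' k' h
      have := dyI_nested h.le (e1.trans hx.symm)
      simp only [hQ]
      rwa [this, hx']
    · subst h
      rw [← hx, ← hx']
    · exfalso
      apply hr' k h
      have := dyI_nested h.le (e2.trans hx'.symm)
      simp only [hQ]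
      rwa [this, hx]
  · intro q hq; exact hq.1
  · rintro ⟨k, m⟩ ⟨hq, hq'⟩
    have h1 := hq' (k+1) (by simp)
    simp only [hQ, hP, not_lt] at h1
    have h2 : dyI (k, m) ⊆ dyI (k+1, ⌊(m:ℝ) * 2 ^ k / 2 ^ (k+1)⌋) := by
      intro x hx
      rw [mem_dyI] at hx ⊢
      exact dyI_nested (by simp) (hx.trans (mem_dyI.1 (dyI_left_mem (k, m))).symm)
    have h3 : ∫ x in dyI (k, m), v x ≤
        ∫ x in dyI (k+1, ⌊(m:ℝ) * 2 ^ k / 2 ^ (k+1)⌋), v x :=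
      setIntegral_mono_set (μ := volume) hi.integrableOn
      (Filter.Eventually.of_forall h0) (Filter.Eventually.of_forall h2)
    have h4 : (2:ℝ) ^ (k+1) = 2 * 2 ^ k := by rw [zpow_add₀ (by norm_num)]; ring
    refine (h3.trans h1).trans (le_of_eq ?_)
    simp only
    rw [h4]; ring
  · intro x hx
    have hnQ : ∀ k, ¬ Q x k := by
      intro k hk
      obtain ⟨K, hK, hK'⟩ := Int.exists_greatest_of_bdd (hbd x) ⟨k, hk⟩
      apply hx
      simp only [Set.mem_iUnion]
      refine ⟨(K, ⌊x / 2 ^ K⌋), ⟨hK, fun k' hk' hQ' => ?_⟩, hmem x K⟩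
      have e := mem_dyI.1 (dyI_left_mem (K, ⌊x / 2 ^ K⌋))
      have e2 := dyI_nested (le_of_lt hk') e
      simp only [hQ] at hQ'
      rw [e2] at hQ'
      have := hK' k' hQ'
      simp only at hk'
      omega
    by_contra hcon
    push Not at hcon
    obtain ⟨δ, hδ, hball⟩ := Metric.mem_nhds_iff.1 ((isOpen_lt continuous_const hv).mem_nhds hcon)
    obtain ⟨n, hn⟩ := exists_pow_lt_of_lt_one hδ (show (1/2:ℝ) < 1 by norm_num)
    apply hnQ (-(n:ℤ))
    set q : ℤ × ℤ := (-(n:ℤ), ⌊x / 2 ^ (-(n:ℤ))⌋) with hqdef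
    have hpow : (2:ℝ) ^ (-(n:ℤ)) < δ := by
      rw [zpow_neg, zpow_natCast]; simpa using hn
    have hsub : ∀ y ∈ dyI q, lam < v y := by
      intro y hy
      apply hball
      have hx' := hmem x (-(n:ℤ))
      rw [Metric.mem_ball, Real.dist_eq, abs_lt]
      simp only [dyI, Set.mem_Ico, hqdef] at hy hx'
      constructor <;> nlinarith
    simp only [hQ, hP]
    have hvol : volume.real (dyI q) = 2 ^ q.1 := by
      rw [measureReal_def, volume_dyI, ENNReal.toReal_ofReal (by positivity)]
    have hconst : ∫ y in dyI q, lam = lam * 2 ^ q.1 := by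
      rw [setIntegral_const, hvol]; simp [mul_comm]
    have hfin : volume (dyI q) ≠ ⊤ := by rw [volume_dyI]; simp
    change lam * 2 ^ q.1 < ∫ y in dyI q, v y
    rw [← hconst, ← sub_pos, ← integral_sub hi.integrableOn (integrableOn_const hfin),
      setIntegral_pos_iff_support_of_nonneg_ae]
    · have : Function.support (fun y => v y - lam) ∩ dyI q = dyI q := by
        apply Set.inter_eq_right.2
        intro y hy
        simp only [Function.mem_support]
        exact (sub_pos.2 (hsub y hy)).ne'
      rw [this, volume_dyI]; simp; positivity
    · filter_upwards [ae_restrict_mem (measurableSet_dyI q)] with y hy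
      simp only [Pi.zero_apply]; linarith [hsub y hy]
    · exact hi.integrableOn.sub (integrableOn_const hfin)

end PP
end

section
open MeasureTheory
open scoped ENNReal
set_option linter.unusedSectionVars false

namespace PP

/-- tripled dyadic interval -/
def dyS (q : ℤ × ℤ) : Set ℝ := Set.Ico (((q.2:ℝ) - 1) * 2 ^ q.1) (((q.2:ℝ) + 2) * 2 ^ q.1)

lemma volume_dyS (q : ℤ × ℤ) : volume (dyS q) = 3 * volume (dyI q) := by
  rw [dyS, volume_dyI, Real.volume_Ico, show (3:ℝ≥0∞) = ENNReal.ofReal 3 by simp,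
    ← ENNReal.ofReal_mul (by norm_num)]
  congr 1; ring

section
variable {E E' : Type*} [NormedAddCommGroup E] [NormedSpace ℂ E] [CompleteSpace E]
  [NormedAddCommGroup E'] [NormedSpace ℂ E'] [CompleteSpace E']

/-- singular integral operator -/
noncomputable def czT (K : ℝ → E →L[ℂ] E') (f : ℝ → E) (x : ℝ) : E' := ∫ y, K (x - y) (f y)

lemma czT_integrable (K : ℝ → E →L[ℂ] E') (hK : Continuous K) {M : ℝ} (hM : ∀ x, ‖K x‖ ≤ M)
    {f : ℝ → E} (hf : Integrable f) {c : ℝ → ℝ} (hc : Measurable c) :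
    Integrable (fun y => K (c y) (f y)) := by
  have hKc : StronglyMeasurable (fun y => K (c y)) := hK.stronglyMeasurable.comp_measurable hc
  refine Integrable.mono' (hf.norm.const_mul M) ?_ ?_
  · exact (ContinuousLinearMap.apply ℂ E').flip.aestronglyMeasurable_comp₂
      hKc.aestronglyMeasurable hf.1
  · filter_upwards with y
    exact ((K (c y)).le_opNorm _).trans (by gcongr; exact hM _)

lemma czT_add (K : ℝ → E →L[ℂ] E') (hK : Continuous K) {M : ℝ} (hM : ∀ x, ‖K x‖ ≤ M)
    {f g : ℝ → E} (hf : Integrable f) (hg : Integrable g) (x : ℝ) :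
    czT K (fun y => f y + g y) x = czT K f x + czT K g x := by
  unfold czT
  rw [← integral_add (czT_integrable K hK hM hf (by fun_prop)) (czT_integrable K hK hM hg (by fun_prop))]
  simp

theorem cz_weak (K : ℝ → E →L[ℂ] E') (hK : Continuous K) {M : ℝ} (hM : ∀ x, ‖K x‖ ≤ M)
    {A D : ℝ≥0∞} {B : ℝ} (hB : 0 ≤ B)
    (hA : ∀ q : ℤ × ℤ, ∀ y ∈ dyI q,
      ∫⁻ x in (dyS q)ᶜ, ‖K (x - y) - K (x - (q.2:ℝ) * 2 ^ q.1)‖ₑ ≤ A)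
    {lam : ℝ} (hl : 0 < lam)
    (hG : ∀ g : ℝ → E, StronglyMeasurable g → Integrable g → (∀ x, ‖g x‖ ≤ 2 * lam) →
      volume {x | B * lam < ‖czT K g x‖} ≤ D / ENNReal.ofReal lam ^ 2 * ∫⁻ x, ‖g x‖ₑ ^ 2)
    (f : ℝ → E) (hfc : Continuous f) (hfi : Integrable f) :
    volume {x | (B + 1) * lam < ‖czT K f x‖} ≤
      (3 + 4 * A + 4 * D) * (2 / ENNReal.ofReal lam * ∫⁻ x in {x | lam / 2 < ‖f x‖}, ‖f x‖ₑ)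
        + D / ENNReal.ofReal lam ^ 2 * ∫⁻ x in {x | ‖f x‖ ≤ lam}, ‖f x‖ₑ ^ 2 := by
  classical
  obtain ⟨J, hJd, hJl, hJu, hJo⟩ := cz_cover (fun x => ‖f x‖) hfc.norm (fun x => norm_nonneg _)
    hfi.norm hl
  set Λ := ENNReal.ofReal lam with hΛ
  have hΛ0 : Λ ≠ 0 := by simp [hΛ, hl]
  have hΛt : Λ ≠ ⊤ := by simp [hΛ]
  set Ω : Set ℝ := ⋃ q ∈ J, dyI q with hΩ
  have hΩm : MeasurableSet Ω := MeasurableSet.biUnion J.to_countable fun q _ => measurableSet_dyI q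
  have hΩU : Ω = ⋃ q : J, dyI q.1 := by rw [hΩ, Set.biUnion_eq_iUnion]
  have hJd' : Pairwise (Function.onFun Disjoint fun q : J => dyI q.1) := by
    intro a b hab
    exact hJd a.2 b.2 (fun h => hab (Subtype.ext h))
  -- selection
  set σ : ℝ → Option (ℤ × ℤ) := fun y =>
    if h : ∃ q, q ∈ J ∧ y ∈ dyI q then some h.choose else none with hσ
  have hσs : ∀ y q, σ y = some q ↔ q ∈ J ∧ y ∈ dyI q := by
    intro y q
    simp only [hσ]
    split_ifs with h
    · have hs := h.choose_spec
      constructor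
      · intro e; simp only [Option.some.injEq] at e; rwa [← e]
      · intro hq
        by_contra hne
        have : h.choose ≠ q := fun e => hne (by rw [e])
        exact Set.disjoint_left.1 (hJd hs.1 hq.1 this) hs.2 hq.2
    · simp only [reduceCtorEq, false_iff]
      intro hq; exact h ⟨q, hq⟩
  have hσn : ∀ y, σ y = none ↔ y ∉ Ω := by
    intro y
    simp only [hσ, hΩ, Set.mem_iUnion]
    split_ifs with h
    · obtain ⟨q, hq⟩ := h
      simp only [reduceCtorEq, false_iff, not_not]; exact ⟨q, hq.1, hq.2⟩
    · simp only [true_iff]; rintro ⟨q, hq, hq'⟩; exact h ⟨q, hq, hq'⟩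
  let _ : MeasurableSpace (Option (ℤ × ℤ)) := ⊤
  have : DiscreteMeasurableSpace (Option (ℤ × ℤ)) := ⟨fun _ => trivial⟩
  have hσm : Measurable σ := by
    apply measurable_to_countable'
    rintro (_ | q)
    · have : σ ⁻¹' {none} = Ωᶜ := by ext y; simp [hσn]
      rw [this]; exact hΩm.compl
    · by_cases hq : q ∈ J
      · have : σ ⁻¹' {some q} = dyI q := by ext y; simp [hσs, hq]
        rw [this]; exact measurableSet_dyI q
      · have : σ ⁻¹' {some q} = ∅ := by ext y; simp [hσs, hq]
        rw [this]; exact MeasurableSet.empty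
  set a : Option (ℤ × ℤ) → E := fun o => o.elim 0
    (fun q => ((2:ℝ) ^ q.1)⁻¹ • ∫ x in dyI q, f x) with ha
  set c : Option (ℤ × ℤ) → ℝ := fun o => o.elim 0 (fun q => (q.2:ℝ) * 2 ^ q.1) with hc
  have haσ : StronglyMeasurable (fun y => a (σ y)) :=
    (StronglyMeasurable.of_discrete (f := a)).comp_measurable hσm
  have hcσ : Measurable (fun y => c (σ y)) := (measurable_of_countable c).comp hσm
  have hvr : ∀ q, volume.real (dyI q) = 2 ^ q.1 := fun q => by
    rw [measureReal_def, volume_dyI, ENNReal.toReal_ofReal (by positivity)]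
  have haq : ∀ q ∈ J, ‖a (some q)‖ ≤ 2 * lam := by
    intro q hq
    simp only [ha, Option.elim]
    rw [norm_smul, norm_inv, Real.norm_of_nonneg (by positivity : (0:ℝ) ≤ 2 ^ q.1),
      inv_mul_le_iff₀ (by positivity)]
    refine (norm_integral_le_integral_norm _).trans ((hJu q hq).trans (le_of_eq (by ring)))
  set g : ℝ → E := fun y => Ωᶜ.indicator f y + a (σ y) with hg
  have hgo : ∀ y, y ∉ Ω → g y = f y := by
    intro y hy
    simp only [hg]
    rw [(hσn y).2 hy, Set.indicator_of_mem (show y ∈ Ωᶜ from hy)]; simp [ha]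
  have hgi : ∀ q ∈ J, ∀ y ∈ dyI q, g y = a (some q) := by
    intro q hq y hy
    have : y ∈ Ω := Set.mem_biUnion hq hy
    simp only [hg]
    rw [(hσs y q).2 ⟨hq, hy⟩, Set.indicator_of_notMem (by simpa using this)]; simp
  have hgΩ : ∀ y ∈ Ω, ‖g y‖ ≤ 2 * lam := by
    intro y hy
    obtain ⟨q, hq, hyq⟩ := Set.mem_iUnion₂.1 hy
    rw [hgi q hq y hyq]; exact haq q hq
  have hgb : ∀ y, ‖g y‖ ≤ 2 * lam := by
    intro y
    by_cases hy : y ∈ Ω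
    · exact hgΩ y hy
    · rw [hgo y hy]; have := hJo y hy; linarith
  have hgm : StronglyMeasurable g :=
    (hfc.stronglyMeasurable.indicator hΩm.compl).add haσ
  -- measure of Ω
  have hfΩ1 : ∀ q ∈ J, Λ * volume (dyI q) ≤ ∫⁻ x in dyI q, ‖f x‖ₑ := by
    intro q hq
    rw [← ofReal_integral_norm_eq_lintegral_enorm hfi.integrableOn, volume_dyI, hΛ,
      ← ENNReal.ofReal_mul hl.le]
    exact ENNReal.ofReal_le_ofReal (hJl q hq).le
  have hfΩ2 : ∀ q ∈ J, ∫⁻ x in dyI q, ‖f x‖ₑ ≤ 2 * Λ * volume (dyI q) := by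
    intro q hq
    rw [← ofReal_integral_norm_eq_lintegral_enorm hfi.integrableOn, volume_dyI, hΛ,
      show (2:ℝ≥0∞) = ENNReal.ofReal 2 by simp, ← ENNReal.ofReal_mul (by norm_num),
      ← ENNReal.ofReal_mul (by positivity)]
    exact ENNReal.ofReal_le_ofReal (hJu q hq)
  have hΩv : volume Ω = ∑' q : J, volume (dyI q.1) := by
    rw [hΩU, measure_iUnion hJd' (fun q => measurableSet_dyI _)]
  have hset : ∀ h : ℝ → ℝ≥0∞, ∫⁻ x in Ω, h x = ∑' q : J, ∫⁻ x in dyI q.1, h x := by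
    intro h
    rw [hΩU, lintegral_iUnion (fun q => measurableSet_dyI _) hJd']
  have hΩ2 : ∫⁻ x in Ω, ‖f x‖ₑ ≤ 2 * Λ * volume Ω := by
    rw [hset, hΩv, ← ENNReal.tsum_mul_left]
    exact ENNReal.tsum_le_tsum fun q => hfΩ2 q.1 q.2
  have hΩ1 : Λ * volume Ω ≤ ∫⁻ x in Ω, ‖f x‖ₑ := by
    rw [hset, hΩv, ← ENNReal.tsum_mul_left]
    exact ENNReal.tsum_le_tsum fun q => hfΩ1 q.1 q.2
  have hΩfin : volume Ω ≠ ⊤ := by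
    intro h
    rw [h, ENNReal.mul_top hΛ0] at hΩ1
    have h3 : ∫⁻ x in Ω, ‖f x‖ₑ ≤ ∫⁻ x, ‖f x‖ₑ := setLIntegral_le_lintegral _ _
    exact (lt_of_le_of_lt h3 hfi.2).ne (top_le_iff.1 hΩ1)
  set V : Set ℝ := {x | lam / 2 < ‖f x‖} with hV
  have hVm : MeasurableSet V := measurableSet_lt measurable_const hfc.norm.measurable
  have hΩ3 : volume Ω ≤ 2 / Λ * ∫⁻ x in V, ‖f x‖ₑ := by
    have h1 : ∫⁻ x in Ω, ‖f x‖ₑ ≤ (∫⁻ x in V, ‖f x‖ₑ) + Λ / 2 * volume Ω := by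
      calc ∫⁻ x in Ω, ‖f x‖ₑ ≤ ∫⁻ x in Ω, (V.indicator (fun x => ‖f x‖ₑ) x + Λ / 2) := by
            apply lintegral_mono
            intro x
            by_cases hx : x ∈ V
            · simp [hx]
            · simp only [hx, not_false_eq_true, Set.indicator_of_notMem, zero_add]
              simp only [hV, Set.mem_ofPred_eq, not_lt] at hx
              rw [← ofReal_norm, hΛ, show (2:ℝ≥0∞) = ENNReal.ofReal 2 by simp,
                ← ENNReal.ofReal_div_of_pos (by norm_num)]
              exact ENNReal.ofReal_le_ofReal hx
        _ = (∫⁻ x in Ω, V.indicator (fun x => ‖f x‖ₑ) x) + Λ / 2 * volume Ω := by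
            rw [lintegral_add_right _ measurable_const]; simp
        _ ≤ _ := by
            refine add_le_add ?_ le_rfl
            rw [← lintegral_indicator hVm]
            exact setLIntegral_le_lintegral _ _
    have h2 : Λ * volume Ω ≤ (∫⁻ x in V, ‖f x‖ₑ) + Λ / 2 * volume Ω := hΩ1.trans h1
    have h3 : Λ / 2 * volume Ω ≤ ∫⁻ x in V, ‖f x‖ₑ := by
      have e : Λ * volume Ω = Λ / 2 * volume Ω + Λ / 2 * volume Ω := by
        rw [← add_mul, ENNReal.add_halves]
      rw [e] at h2
      exact (ENNReal.add_le_add_iff_right (ENNReal.mul_ne_top (ENNReal.div_ne_top hΛt (by simp)) hΩfin)).1 h2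
    calc volume Ω = 2 / Λ * (Λ / 2 * volume Ω) := by
          rw [← mul_assoc]
          have : (2:ℝ≥0∞) / Λ * (Λ / 2) = 1 := by
            calc (2:ℝ≥0∞) / Λ * (Λ / 2) = (2 * 2⁻¹) * (Λ * Λ⁻¹) := by
                  rw [ENNReal.div_eq_inv_mul, ENNReal.div_eq_inv_mul]; ring
              _ = 1 := by
                  rw [ENNReal.mul_inv_cancel hΛ0 hΛt, ENNReal.mul_inv_cancel (by simp) (by simp), one_mul]
          rw [this, one_mul]
      _ ≤ _ := by gcongr
  -- integrability of g, b
  have hgL1 : ∫⁻ x in Ω, ‖g x‖ₑ ≤ 2 * Λ * volume Ω := by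
    calc ∫⁻ x in Ω, ‖g x‖ₑ ≤ ∫⁻ x in Ω, 2 * Λ := by
          apply setLIntegral_mono measurable_const
          intro x hx
          rw [← ofReal_norm, hΛ, show (2:ℝ≥0∞) = ENNReal.ofReal 2 by simp,
            ← ENNReal.ofReal_mul (by norm_num)]
          exact ENNReal.ofReal_le_ofReal (hgb x)
      _ = _ := by simp
  have hgint : Integrable g := by
    refine ⟨hgm.aestronglyMeasurable, ?_⟩
    rw [HasFiniteIntegral, ← lintegral_add_compl _ hΩm]
    refine ENNReal.add_lt_top.2 ⟨lt_of_le_of_lt hgL1 ?_, ?_⟩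
    · exact ENNReal.mul_lt_top (ENNReal.mul_lt_top (by simp) hΛt.lt_top) hΩfin.lt_top
    · rw [setLIntegral_congr_fun (g := fun x => ‖f x‖ₑ) hΩm.compl (fun x hx => by
        simp only; rw [hgo x hx])]
      exact lt_of_le_of_lt (setLIntegral_le_lintegral _ _) hfi.2
  set b : ℝ → E := fun y => f y - g y with hb
  have hbint : Integrable b := hfi.sub hgint
  have hbo : ∀ y, y ∉ Ω → b y = 0 := fun y hy => by simp [hb, hgo y hy]
  have hbm : StronglyMeasurable b := hfc.stronglyMeasurable.sub hgm
  have hb1 : ∫⁻ x, ‖b x‖ₑ ≤ 4 * Λ * volume Ω := by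
    calc ∫⁻ x, ‖b x‖ₑ = ∫⁻ x in Ω, ‖b x‖ₑ := by
          rw [← lintegral_add_compl _ hΩm, setLIntegral_congr_fun (g := fun x => 0) hΩm.compl
            (fun x hx => by simp only; rw [hbo x hx]; simp)]
          simp
      _ ≤ ∫⁻ x in Ω, (‖f x‖ₑ + ‖g x‖ₑ) := lintegral_mono fun x => enorm_sub_le
      _ = (∫⁻ x in Ω, ‖f x‖ₑ) + ∫⁻ x in Ω, ‖g x‖ₑ :=
          lintegral_add_left hfc.enorm.measurable _
      _ ≤ 2 * Λ * volume Ω + 2 * Λ * volume Ω := add_le_add hΩ2 hgL1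
      _ = _ := by ring
  have hbq : ∀ q ∈ J, ∫ y in dyI q, b y = 0 := by
    intro q hq
    simp only [hb]
    rw [integral_sub hfi.integrableOn hgint.integrableOn,
      setIntegral_congr_fun (g := fun _ => a (some q)) (measurableSet_dyI q) (hgi q hq),
      setIntegral_const, hvr]
    simp only [ha, Option.elim]
    rw [smul_smul, mul_inv_cancel₀ (by positivity), one_smul, sub_self]
  -- bad part
  set Ωs : Set ℝ := ⋃ q : J, dyS q.1 with hΩs
  have hΩsm : MeasurableSet Ωs := MeasurableSet.iUnion fun q => measurableSet_Ico
  have hΩsv : volume Ωs ≤ 3 * volume Ω := by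
    refine (measure_iUnion_le _).trans ?_
    rw [hΩv, ← ENNReal.tsum_mul_left]
    exact ENNReal.tsum_le_tsum fun q => (volume_dyS q.1).le
  have hTb : ∀ x, czT K b x = ∫ y, (K (x - y) - K (x - c (σ y))) (b y) := by
    intro x
    have i1 := czT_integrable K hK hM hbint (c := fun y => x - y) (by fun_prop)
    have i2 := czT_integrable K hK hM hbint (c := fun y => x - c (σ y)) (hcσ.const_sub x)
    have e : ∫ y, K (x - c (σ y)) (b y) = 0 := by
      have e1 : ∫ y, K (x - c (σ y)) (b y) = ∫ y in Ω, K (x - c (σ y)) (b y) := by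
        rw [setIntegral_eq_integral_of_forall_compl_eq_zero]
        intro y hy; rw [hbo y hy]; simp
      rw [e1, hΩU, integral_iUnion (fun q => measurableSet_dyI _) hJd' i2.integrableOn]
      have : ∀ q : J, ∫ y in dyI q.1, K (x - c (σ y)) (b y) = 0 := by
        intro q
        rw [setIntegral_congr_fun (g := fun y => K (x - c (some q.1)) (b y)) (measurableSet_dyI q.1)
          (fun y hy => by simp only; rw [(hσs y q.1).2 ⟨q.2, hy⟩]),
          ContinuousLinearMap.integral_comp_comm _ hbint.integrableOn, hbq q.1 q.2, map_zero]
      simp [this]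
    rw [czT, ← sub_zero (∫ y, K (x - y) (b y)), ← e, ← integral_sub i1 i2]
    rfl
  have hTb1 : ∫⁻ x in Ωsᶜ, ‖czT K b x‖ₑ ≤ A * ∫⁻ y, ‖b y‖ₑ := by
    have hmeas : Measurable (fun z : ℝ × ℝ =>
        ‖K (z.1 - z.2) - K (z.1 - c (σ z.2))‖ₑ * ‖b z.2‖ₑ) := by
      have h1 : Continuous (fun w : ℝ × ℝ × ℝ => ‖K (w.1 - w.2.1) - K (w.1 - w.2.2)‖ₑ) := by
        fun_prop
      have h2 : Measurable (fun z : ℝ × ℝ => (z.1, z.2, c (σ z.2))) :=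
        measurable_fst.prodMk (measurable_snd.prodMk (hcσ.comp measurable_snd))
      exact (h1.measurable.comp h2).mul (hbm.enorm.comp measurable_snd)
    calc ∫⁻ x in Ωsᶜ, ‖czT K b x‖ₑ
        ≤ ∫⁻ x in Ωsᶜ, ∫⁻ y, ‖K (x - y) - K (x - c (σ y))‖ₑ * ‖b y‖ₑ := by
          apply lintegral_mono
          intro x
          simp only
          rw [hTb x]
          refine (enorm_integral_le_lintegral_enorm _).trans (lintegral_mono fun y => ?_)
          exact ContinuousLinearMap.le_opENorm _ _
      _ = ∫⁻ y, ∫⁻ x in Ωsᶜ, ‖K (x - y) - K (x - c (σ y))‖ₑ * ‖b y‖ₑ :=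
          lintegral_lintegral_swap hmeas.aemeasurable
      _ ≤ ∫⁻ y, A * ‖b y‖ₑ := by
          apply lintegral_mono
          intro y
          by_cases hy : y ∈ Ω
          · obtain ⟨q, hq, hyq⟩ := Set.mem_iUnion₂.1 hy
            simp only
            rw [(hσs y q).2 ⟨hq, hyq⟩, lintegral_mul_const' _ _ (by simp)]
            gcongr
            refine le_trans (lintegral_mono_set ?_) (hA q y hyq)
            exact Set.compl_subset_compl.2 (Set.subset_iUnion (fun q : J => dyS q.1) ⟨q, hq⟩)
          · simp [hbo y hy]
      _ = A * ∫⁻ y, ‖b y‖ₑ := lintegral_const_mul _ hbm.enorm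
  have hTbm : StronglyMeasurable (czT K b) := by
    have h : StronglyMeasurable (fun z : ℝ × ℝ => K (z.1 - z.2) (b z.2)) :=
      (ContinuousLinearMap.apply ℂ E').flip.continuous₂.comp_stronglyMeasurable
        ((hK.comp (continuous_fst.sub continuous_snd)).stronglyMeasurable.prodMk
          (hbm.comp_measurable measurable_snd))
    exact h.integral_prod_right
  have hbad : volume {x | lam < ‖czT K b x‖} ≤ (3 + 4 * A) * volume Ω := by
    have hsub : {x | lam < ‖czT K b x‖} ⊆ Ωs ∪ ({x | Λ ≤ ‖czT K b x‖ₑ} ∩ Ωsᶜ) := by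
      intro x hx
      by_cases h : x ∈ Ωs
      · exact Or.inl h
      · refine Or.inr ⟨?_, h⟩
        simp only [Set.mem_ofPred_eq] at hx ⊢
        rw [← ofReal_norm]; exact ENNReal.ofReal_le_ofReal hx.le
    have h2 : volume ({x | Λ ≤ ‖czT K b x‖ₑ} ∩ Ωsᶜ) ≤ 4 * A * volume Ω := by
      rw [← Measure.restrict_apply (measurableSet_le measurable_const hTbm.enorm)]
      refine (meas_ge_le_lintegral_div hTbm.enorm.aemeasurable hΛ0 hΛt).trans ?_
      apply ENNReal.div_le_of_le_mul
      refine hTb1.trans ?_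
      calc A * ∫⁻ y, ‖b y‖ₑ ≤ A * (4 * Λ * volume Ω) := by gcongr
        _ = _ := by ring
    calc _ ≤ volume Ωs + volume ({x | Λ ≤ ‖czT K b x‖ₑ} ∩ Ωsᶜ) :=
          (measure_mono hsub).trans (measure_union_le _ _)
      _ ≤ 3 * volume Ω + 4 * A * volume Ω := add_le_add hΩsv h2
      _ = _ := by ring
  -- good part
  have hg2 : ∫⁻ x, ‖g x‖ₑ ^ 2 ≤ (∫⁻ x in {x | ‖f x‖ ≤ lam}, ‖f x‖ₑ ^ 2) + 4 * Λ ^ 2 * volume Ω := by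
    rw [← lintegral_add_compl _ hΩm, add_comm]
    apply add_le_add
    · rw [setLIntegral_congr_fun (g := fun x => ‖f x‖ₑ ^ 2) hΩm.compl (fun x hx => by
        simp only; rw [hgo x hx])]
      exact lintegral_mono_set (fun x hx => hJo x hx)
    · calc ∫⁻ x in Ω, ‖g x‖ₑ ^ 2 ≤ ∫⁻ x in Ω, 4 * Λ ^ 2 := by
            apply lintegral_mono
            intro x
            have : ‖g x‖ₑ ≤ 2 * Λ := by
              rw [← ofReal_norm, hΛ, show (2:ℝ≥0∞) = ENNReal.ofReal 2 by simp,
                ← ENNReal.ofReal_mul (by norm_num)]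
              exact ENNReal.ofReal_le_ofReal (hgb x)
            calc ‖g x‖ₑ ^ 2 ≤ (2 * Λ) ^ 2 := by gcongr
              _ = _ := by ring
        _ = _ := by simp
  have hgood := hG g hgm hgint hgb
  have hTf : ∀ x, czT K f x = czT K g x + czT K b x := by
    intro x
    rw [← czT_add K hK hM hgint hbint]
    simp [hb]
  have hsub : {x | (B + 1) * lam < ‖czT K f x‖} ⊆
      {x | lam < ‖czT K b x‖} ∪ {x | B * lam < ‖czT K g x‖} := by
    intro x hx
    by_contra hcon
    simp only [Set.mem_union, Set.mem_ofPred_eq, not_or, not_lt] at hcon hx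
    have := norm_add_le (czT K g x) (czT K b x)
    rw [← hTf] at this
    nlinarith
  have hDΛ : D / Λ ^ 2 * (4 * Λ ^ 2 * volume Ω) = 4 * D * volume Ω := by
    have : D / Λ ^ 2 * Λ ^ 2 = D := ENNReal.div_mul_cancel (by simp [hΛ0]) (by simp [hΛt])
    calc D / Λ ^ 2 * (4 * Λ ^ 2 * volume Ω) = 4 * (D / Λ ^ 2 * Λ ^ 2) * volume Ω := by ring
      _ = _ := by rw [this]
  calc _ ≤ volume {x | lam < ‖czT K b x‖} + volume {x | B * lam < ‖czT K g x‖} :=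
        (measure_mono hsub).trans (measure_union_le _ _)
    _ ≤ (3 + 4 * A) * volume Ω + D / Λ ^ 2 *
        ((∫⁻ x in {x | ‖f x‖ ≤ lam}, ‖f x‖ₑ ^ 2) + 4 * Λ ^ 2 * volume Ω) := by
        refine add_le_add hbad (hgood.trans ?_)
        gcongr
    _ = (3 + 4 * A + 4 * D) * volume Ω + D / Λ ^ 2 * (∫⁻ x in {x | ‖f x‖ ≤ lam}, ‖f x‖ₑ ^ 2) := by
        rw [mul_add, hDΛ]; ring
    _ ≤ _ := by gcongr

end
end PP
end

section
open MeasureTheory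
open scoped ENNReal

namespace PP

lemma lint_rpow_lo {r : ℝ} (hr : -1 < r) {w : ℝ} (hw : 0 ≤ w) :
    ∫⁻ t in Set.Ioo 0 w, ENNReal.ofReal (t ^ r) = ENNReal.ofReal (w ^ (r + 1) / (r + 1)) := by
  have hi : IntegrableOn (fun t : ℝ => t ^ r) (Set.Ioo 0 w) := by
    have := (intervalIntegral.intervalIntegrable_rpow' (a := 0) (b := w) hr)
    rw [intervalIntegrable_iff_integrableOn_Ioo_of_le hw] at this
    exact this
  rw [← ofReal_integral_eq_lintegral_ofReal hi]
  · rw [← integral_Ioc_eq_integral_Ioo, ← intervalIntegral.integral_of_le hw,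
      integral_rpow (Or.inl hr), Real.zero_rpow (by linarith), sub_zero]
  · filter_upwards [ae_restrict_mem measurableSet_Ioo] with t ht
    exact Real.rpow_nonneg ht.1.le _

lemma lint_rpow_hi {r : ℝ} (hr : r < -1) {w : ℝ} (hw : 0 < w) :
    ∫⁻ t in Set.Ioi w, ENNReal.ofReal (t ^ r) = ENNReal.ofReal (-w ^ (r + 1) / (r + 1)) := by
  rw [← ofReal_integral_eq_lintegral_ofReal (integrableOn_Ioi_rpow_of_lt hr hw)]
  · rw [integral_Ioi_rpow_of_lt hr hw]
  · filter_upwards [ae_restrict_mem measurableSet_Ioi] with t ht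
    exact Real.rpow_nonneg (hw.trans ht).le _

lemma marc (p b : ℝ) (hp : 1 < p) (hb : 0 < b) : ∃ C : ℝ≥0∞, C ≠ ⊤ ∧
    ∀ (u v : ℝ → ℝ) (A D : ℝ≥0∞), (∀ x, 0 ≤ u x) → (∀ x, 0 ≤ v x) → Measurable u → Measurable v →
    (p < 2 ∨ D = 0) →
    (∀ lam : ℝ, 0 < lam → volume {x | b * lam < u x} ≤
      A * (2 / ENNReal.ofReal lam * ∫⁻ x in {x | lam / 2 < v x}, ENNReal.ofReal (v x))
        + D / ENNReal.ofReal lam ^ 2 * ∫⁻ x in {x | v x ≤ lam}, ENNReal.ofReal (v x) ^ 2) →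
    ∫⁻ x, ENNReal.ofReal (u x ^ p) ≤ C * (A + D) * ∫⁻ x, ENNReal.ofReal (v x ^ p) := by
  refine ⟨ENNReal.ofReal (b ^ p) * (ENNReal.ofReal p * (ENNReal.ofReal (2 * 2 ^ (p-1) / (p-1)) +
    ENNReal.ofReal (1 / (2 - p)))), by finiteness, ?_⟩
  intro u v A D hu0 hv0 hu hv hpD h
  have h1 : ∫⁻ x, ENNReal.ofReal (u x ^ p) =
      ENNReal.ofReal (b ^ p) * ∫⁻ x, ENNReal.ofReal ((u x / b) ^ p) := by
    rw [← lintegral_const_mul' _ _ (by simp)]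
    congr 1; ext x
    rw [← ENNReal.ofReal_mul (by positivity), Real.div_rpow (hu0 x) hb.le]
    congr 1; field_simp
  rw [h1, lintegral_rpow_eq_lintegral_meas_lt_mul volume
    (Filter.Eventually.of_forall fun x => div_nonneg (hu0 x) hb.le)
    (by fun_prop) (by linarith)]
  have hset : ∀ t, {x | t < u x / b} = {x | b * t < u x} := by
    intro t; ext x; simp only [Set.mem_ofPred_eq]; rw [lt_div_iff₀ hb, mul_comm]
  -- first term
  have hT1 : ∫⁻ t in Set.Ioi (0:ℝ), (2 / ENNReal.ofReal t *
      ∫⁻ x in {x | t / 2 < v x}, ENNReal.ofReal (v x)) * ENNReal.ofReal (t ^ (p-1)) =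
      ENNReal.ofReal (2 * 2 ^ (p-1) / (p-1)) * ∫⁻ x, ENNReal.ofReal (v x ^ p) := by
    have hm : Measurable (fun z : ℝ × ℝ => ENNReal.ofReal (2 * z.1 ^ (p-2)) *
        ({z : ℝ × ℝ | z.1 / 2 < v z.2}.indicator (fun z => ENNReal.ofReal (v z.2)) z)) := by
      apply Measurable.mul
      · fun_prop
      · apply Measurable.indicator (by fun_prop)
        exact measurableSet_lt (by fun_prop) (by fun_prop)
    calc _ = ∫⁻ t in Set.Ioi (0:ℝ), ∫⁻ x, ENNReal.ofReal (2 * t ^ (p-2)) *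
        ({z : ℝ × ℝ | z.1 / 2 < v z.2}.indicator (fun z => ENNReal.ofReal (v z.2)) (t, x)) := by
          apply setLIntegral_congr_fun measurableSet_Ioi
          intro t ht
          simp only [Set.mem_Ioi] at ht
          simp only
          rw [lintegral_const_mul' _ _ ENNReal.ofReal_ne_top, ← lintegral_indicator (measurableSet_lt (by fun_prop) hv)]
          rw [mul_right_comm]
          congr 1
          rw [show (2:ℝ≥0∞) = ENNReal.ofReal 2 by simp, ← ENNReal.ofReal_div_of_pos ht,
            ← ENNReal.ofReal_mul (by positivity)]
          congr 1
          have h9 : t ^ (p - 2) = t ^ (p - 1) / t := by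
            rw [← Real.rpow_sub_one ht.ne']; congr 1; ring
          rw [h9]; ring
      _ = ∫⁻ x, ∫⁻ t in Set.Ioi (0:ℝ), ENNReal.ofReal (2 * t ^ (p-2)) *
        ({z : ℝ × ℝ | z.1 / 2 < v z.2}.indicator (fun z => ENNReal.ofReal (v z.2)) (t, x)) :=
          lintegral_lintegral_swap hm.aemeasurable
      _ = _ := by
          rw [← lintegral_const_mul' _ _ (by simp)]
          congr 1; ext x
          have : ∀ t : ℝ, ENNReal.ofReal (2 * t ^ (p-2)) *
            ({z : ℝ × ℝ | z.1 / 2 < v z.2}.indicator (fun z => ENNReal.ofReal (v z.2)) (t, x)) =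
            (Set.Iio (2 * v x)).indicator (fun t => ENNReal.ofReal (2 * v x) *
              ENNReal.ofReal (t ^ (p-2))) t := by
            intro t
            by_cases ht : t < 2 * v x
            · rw [Set.indicator_of_mem (by simp only [Set.mem_ofPred_eq]; linarith),
                Set.indicator_of_mem (by simpa using ht), ENNReal.ofReal_mul (by norm_num),
                ENNReal.ofReal_mul (by norm_num)]
              ring
            · rw [Set.indicator_of_notMem (by simp only [Set.mem_ofPred_eq]; intro h; apply ht; linarith),
                Set.indicator_of_notMem (by simpa using ht), mul_zero]
          simp_rw [this]
          rw [lintegral_indicator measurableSet_Iio, Measure.restrict_restrict measurableSet_Iio,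
            lintegral_const_mul' _ _ ENNReal.ofReal_ne_top, Set.Iio_inter_Ioi,
            lint_rpow_lo (by linarith) (by linarith [hv0 x]), ← ENNReal.ofReal_mul (by linarith [hv0 x]),
            ← ENNReal.ofReal_mul (by have : 0 < p - 1 := by linarith
                                     positivity)]
          congr 1
          rw [show p - 2 + 1 = p - 1 by ring, Real.mul_rpow (by norm_num) (hv0 x)]
          rcases (hv0 x).eq_or_lt with h0 | h0
          · rw [← h0, Real.zero_rpow (by linarith : p ≠ 0)]; ring
          · have : v x ^ p = v x * v x ^ (p - 1) := by
              rw [Real.rpow_sub_one h0.ne']; field_simp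
            rw [this]; ring
  have hT2 : ∫⁻ t in Set.Ioi (0:ℝ), (D / ENNReal.ofReal t ^ 2 *
      ∫⁻ x in {x | v x ≤ t}, ENNReal.ofReal (v x) ^ 2) * ENNReal.ofReal (t ^ (p-1)) ≤
      D * (ENNReal.ofReal (1 / (2 - p)) * ∫⁻ x, ENNReal.ofReal (v x ^ p)) := by
    rcases hpD with hp2 | hD
    swap
    · simp [hD]
    have hm : Measurable (fun z : ℝ × ℝ => D * ENNReal.ofReal (z.1 ^ (p-3)) *
        ({z : ℝ × ℝ | v z.2 ≤ z.1}.indicator (fun z => ENNReal.ofReal (v z.2) ^ 2) z)) := by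
      apply Measurable.mul
      · fun_prop
      · apply Measurable.indicator (by fun_prop)
        exact measurableSet_le (by fun_prop) (by fun_prop)
    calc _ = ∫⁻ t in Set.Ioi (0:ℝ), ∫⁻ x, D * ENNReal.ofReal (t ^ (p-3)) *
        ({z : ℝ × ℝ | v z.2 ≤ z.1}.indicator (fun z => ENNReal.ofReal (v z.2) ^ 2) (t, x)) := by
          apply setLIntegral_congr_fun measurableSet_Ioi
          intro t ht
          simp only [Set.mem_Ioi] at ht
          simp only
          rw [lintegral_const_mul, ← lintegral_indicator (measurableSet_le hv (by fun_prop))]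
          · rw [mul_right_comm]
            congr 1
            rw [ENNReal.div_eq_inv_mul, mul_comm _ D, mul_assoc]
            congr 1
            rw [← ENNReal.ofReal_pow ht.le, ← ENNReal.ofReal_inv_of_pos (by positivity),
              ← ENNReal.ofReal_mul (by positivity)]
            congr 1
            rw [show p - 3 = (p - 1) - (2:ℕ) by push_cast; ring, Real.rpow_sub_natCast ht.ne']
            field_simp
          · apply Measurable.indicator (by fun_prop) (measurableSet_le hv (by fun_prop))
      _ = ∫⁻ x, ∫⁻ t in Set.Ioi (0:ℝ), D * ENNReal.ofReal (t ^ (p-3)) *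
        ({z : ℝ × ℝ | v z.2 ≤ z.1}.indicator (fun z => ENNReal.ofReal (v z.2) ^ 2) (t, x)) :=
          lintegral_lintegral_swap hm.aemeasurable
      _ ≤ ∫⁻ x, D * (ENNReal.ofReal (1 / (2 - p)) * ENNReal.ofReal (v x ^ p)) := by
          apply lintegral_mono
          intro x
          simp only
          rcases (hv0 x).eq_or_lt with h0 | h0
          · have : ∀ t : ℝ, ({z : ℝ × ℝ | v z.2 ≤ z.1}.indicator
                (fun z => ENNReal.ofReal (v z.2) ^ 2) (t, x)) = 0 := by
              intro t
              apply Set.indicator_apply_eq_zero.2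
              intro _; simp [← h0]
            simp [this]
          have : ∀ t : ℝ, D * ENNReal.ofReal (t ^ (p-3)) *
            ({z : ℝ × ℝ | v z.2 ≤ z.1}.indicator (fun z => ENNReal.ofReal (v z.2) ^ 2) (t, x)) =
            (Set.Ici (v x)).indicator (fun t => D * ENNReal.ofReal (v x) ^ 2 *
              ENNReal.ofReal (t ^ (p-3))) t := by
            intro t
            by_cases ht : v x ≤ t
            · rw [Set.indicator_of_mem (by simpa using ht),
                Set.indicator_of_mem (by simpa using ht)]
              ring
            · rw [Set.indicator_of_notMem (by simpa using ht),
                Set.indicator_of_notMem (by simpa using ht), mul_zero]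
          simp_rw [this]
          rw [lintegral_indicator measurableSet_Ici, Measure.restrict_restrict measurableSet_Ici,
            lintegral_const_mul _ (by fun_prop), 
            show Set.Ici (v x) ∩ Set.Ioi 0 = Set.Ici (v x) from
              Set.inter_eq_left.2 (fun t ht => lt_of_lt_of_le h0 ht),
            setLIntegral_congr Ioi_ae_eq_Ici.symm,
            lint_rpow_hi (by linarith) h0, mul_assoc, ← ENNReal.ofReal_pow (hv0 x),
            ← ENNReal.ofReal_mul (by positivity), ← ENNReal.ofReal_mul (by
                                     have : 0 < 2 - p := by linarith
                                     positivity)]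
          apply le_of_eq
          congr 2
          have h9 : v x ^ (p - 3 + 1) = v x ^ p / v x ^ 2 := by
            rw [show p - 3 + 1 = p - (2:ℕ) by push_cast; ring, Real.rpow_sub_natCast h0.ne']
          have h2 : 2 - p ≠ 0 := by linarith
          rw [h9, show p - 3 + 1 = -(2 - p) by ring]
          field_simp
      _ = D * (ENNReal.ofReal (1 / (2 - p)) * ∫⁻ x, ENNReal.ofReal (v x ^ p)) := by
          rw [lintegral_const_mul _ (by fun_prop), lintegral_const_mul _ (by fun_prop)]
  set X := ∫⁻ x, ENNReal.ofReal (v x ^ p)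
  have hmon : Measurable fun t : ℝ => A * (2 / ENNReal.ofReal t *
      ∫⁻ x in {x | t / 2 < v x}, ENNReal.ofReal (v x)) * ENNReal.ofReal (t ^ (p-1)) := by
    have : Measurable (fun t : ℝ => ∫⁻ x in {x | t / 2 < v x}, ENNReal.ofReal (v x)) := by
      apply Antitone.measurable
      intro s t hst
      apply lintegral_mono_set
      intro x hx
      simp only [Set.mem_ofPred_eq] at hx ⊢
      linarith
    fun_prop
  have hmon' : Measurable fun t : ℝ => (2 / ENNReal.ofReal t *
      ∫⁻ x in {x | t / 2 < v x}, ENNReal.ofReal (v x)) * ENNReal.ofReal (t ^ (p-1)) := by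
    have : Measurable (fun t : ℝ => ∫⁻ x in {x | t / 2 < v x}, ENNReal.ofReal (v x)) := by
      apply Antitone.measurable
      intro s t hst
      apply lintegral_mono_set
      intro x hx
      simp only [Set.mem_ofPred_eq] at hx ⊢
      linarith
    fun_prop
  have key : ∫⁻ t in Set.Ioi (0:ℝ), volume {x | t < u x / b} * ENNReal.ofReal (t ^ (p - 1)) ≤
      A * (ENNReal.ofReal (2 * 2 ^ (p-1) / (p-1)) * X) + D * (ENNReal.ofReal (1 / (2 - p)) * X) := by
    calc _ ≤ ∫⁻ t in Set.Ioi (0:ℝ), ((A * (2 / ENNReal.ofReal t *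
          ∫⁻ x in {x | t / 2 < v x}, ENNReal.ofReal (v x)) * ENNReal.ofReal (t ^ (p-1))) +
          (D / ENNReal.ofReal t ^ 2 *
          ∫⁻ x in {x | v x ≤ t}, ENNReal.ofReal (v x) ^ 2) * ENNReal.ofReal (t ^ (p-1))) := by
          apply setLIntegral_mono' measurableSet_Ioi
          intro t ht
          rw [hset, ← add_mul]
          gcongr
          exact h t ht
      _ = _ := lintegral_add_left hmon _
      _ ≤ _ := by
          refine add_le_add (le_of_eq ?_) hT2
          rw [← hT1, ← lintegral_const_mul _ hmon']
          congr 1; ext t; ring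
  calc _ ≤ ENNReal.ofReal (b ^ p) * (ENNReal.ofReal p * (A * (ENNReal.ofReal (2 * 2 ^ (p-1) / (p-1)) * X)
        + D * (ENNReal.ofReal (1 / (2 - p)) * X))) := by gcongr
    _ ≤ ENNReal.ofReal (b ^ p) * (ENNReal.ofReal p * (
        (A + D) * ((ENNReal.ofReal (2 * 2 ^ (p-1) / (p-1)) + ENNReal.ofReal (1 / (2 - p))) * X))) := by
        gcongr
        rw [add_mul, add_mul, mul_add A, mul_add D]
        refine add_le_add le_self_add le_add_self
    _ = _ := by ring

end PP
end

section
open MeasureTheory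
open scoped ENNReal FourierTransform SchwartzMap ContDiff

namespace PP

lemma planch (g : ℝ → ℂ) (hg1 : Integrable g) (hg2 : MemLp g 2) :
    ∫⁻ x, ‖𝓕 g x‖ₑ ^ 2 = ∫⁻ x, ‖g x‖ₑ ^ 2 := by
  have hc : Continuous (𝓕 g) := 
    VectorFourier.fourierIntegral_continuous Real.continuous_fourierChar
      (L := innerₗ ℝ) continuous_inner hg1
  set G : Lp ℂ 2 (volume : Measure ℝ) := hg2.toLp g with hG
  have hae : ∀ᵐ x, (𝓕 G : Lp ℂ 2 (volume : Measure ℝ)) x = 𝓕 g x := by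
    apply ae_eq_of_integral_contDiff_smul_eq
    · exact (Lp.memLp _).locallyIntegrable (by norm_num)
    · exact hc.locallyIntegrable
    · intro h h_smooth h_cpt
      have hg₁ : HasCompactSupport (Complex.ofRealCLM ∘ h) := h_cpt.comp_left rfl
      have hg₂ : ContDiff ℝ ∞ (Complex.ofRealCLM ∘ h) := by fun_prop
      set H := hg₁.toSchwartzMap hg₂ with hH
      have hHa : ∀ x, H x = (h x : ℂ) := fun x => rfl
      have e1 : ∫ x, h x • (𝓕 G : Lp ℂ 2 (volume : Measure ℝ)) x =
          ((𝓕 G : Lp ℂ 2 (volume : Measure ℝ)) : 𝓢'(ℝ, ℂ)) H := by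
        rw [Lp.toTemperedDistribution_apply]
        simp [hHa]
      rw [e1, ← Lp.fourier_toTemperedDistribution_eq, TemperedDistribution.fourier_apply,
        Lp.toTemperedDistribution_apply]
      have e2 : ∫ x, (𝓕 H) x • G x = ∫ x, (𝓕 (⇑H)) x • g x := by
        apply integral_congr_ae
        filter_upwards [hg2.coeFn_toLp] with x hx
        rw [hx, SchwartzMap.fourier_coe]
      rw [e2]
      have e6 : ∫ x, (𝓕 (⇑H)) x • g x = ∫ x, H x • 𝓕 g x := by
        simpa using! VectorFourier.integral_fourierIntegral_smul_eq_flip (L := innerₗ ℝ)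
          Real.continuous_fourierChar continuous_inner H.integrable hg1
      rw [e6]
      simp [hHa]
  have e3 : ∫⁻ x, ‖𝓕 g x‖ₑ ^ 2 = ∫⁻ x, ‖(𝓕 G : Lp ℂ 2 (volume : Measure ℝ)) x‖ₑ ^ 2 := by
    apply lintegral_congr_ae
    filter_upwards [hae] with x hx
    rw [hx]
  have e4 : ∫⁻ x, ‖g x‖ₑ ^ 2 = ∫⁻ x, ‖G x‖ₑ ^ 2 := by
    apply lintegral_congr_ae
    filter_upwards [hg2.coeFn_toLp] with x hx
    rw [hx]
  have e5 : ∀ U : Lp ℂ 2 (volume : Measure ℝ), ∫⁻ x, ‖U x‖ₑ ^ 2 = ENNReal.ofReal (‖U‖ ^ 2) := by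
    intro U
    have h1 := eLpNorm_nnreal_pow_eq_lintegral (f := U) (μ := (volume : Measure ℝ)) (p := 2) (by norm_num)
    simp only [NNReal.coe_ofNat, ENNReal.coe_ofNat, ENNReal.rpow_ofNat] at h1
    rw [← h1, Lp.norm_def, ENNReal.ofReal_pow (by positivity), ENNReal.ofReal_toReal (Lp.eLpNorm_ne_top U)]
  rw [e3, e4, e5, e5, Lp.norm_fourier_eq]

lemma minsum (ε : ℝ) (h0 : 0 < ε) (h1 : ε ≤ 1) : ∃ C : ℝ, 0 ≤ C ∧ ∀ L : ℝ, 0 < L → ∀ S : Finset ℤ,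
    ∑ k ∈ S, min ((2:ℝ) ^ k * L) (((2:ℝ) ^ k * L) ^ (-ε)) ≤ C := by
  set r : ℝ := (2:ℝ) ^ (-ε) with hr
  have hr0 : 0 < r := by positivity
  have hr1 : r < 1 := Real.rpow_lt_one_of_one_lt_of_neg (by norm_num) (by linarith)
  have hr2 : (2:ℝ)⁻¹ ≤ r := by
    rw [hr, ← Real.rpow_neg_one]
    exact Real.rpow_le_rpow_of_exponent_le (by norm_num) (by linarith)
  have hs : Summable (fun j : ℤ => r ^ j.natAbs) := by
    apply Summable.of_nat_of_neg <;> simpa using summable_geometric_of_lt_one hr0.le hr1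
  refine ⟨2 * ∑' j : ℤ, r ^ j.natAbs, mul_nonneg (by norm_num) (tsum_nonneg fun j => by positivity), ?_⟩
  intro L hL S
  obtain ⟨m, hm1, hm2⟩ := exists_mem_Ico_zpow hL (by norm_num : (1:ℝ) < 2)
  have key : ∀ k : ℤ, min ((2:ℝ) ^ k * L) (((2:ℝ) ^ k * L) ^ (-ε)) ≤ 2 * r ^ (k + m).natAbs := by
    intro k
    have ha : (2:ℝ) ^ (k + m) ≤ 2 ^ k * L := by
      rw [zpow_add₀ (by norm_num)]; gcongr
    have hb : (2:ℝ) ^ k * L ≤ 2 * (2:ℝ) ^ (k + m) := by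
      have : 2 * (2:ℝ) ^ (k + m) = 2 ^ k * 2 ^ (m + 1) := by
        rw [zpow_add₀ (by norm_num), zpow_add₀ (by norm_num)]; simp; ring
      rw [this]; gcongr
    obtain ⟨i, hi | hi⟩ := (k + m).eq_nat_or_neg
    · rw [hi] at ha ⊢
      refine (min_le_right _ _).trans ?_
      calc _ ≤ ((2:ℝ) ^ (i:ℤ)) ^ (-ε) :=
            Real.rpow_le_rpow_of_nonpos (by positivity) ha (by linarith)
        _ = r ^ i := by
            rw [hr, zpow_natCast, ← Real.rpow_natCast, ← Real.rpow_natCast, ← Real.rpow_mul (by norm_num),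
              ← Real.rpow_mul (by norm_num), mul_comm]
        _ ≤ _ := by
            simp only [Int.natAbs_natCast]
            have : 0 < r ^ i := by positivity
            linarith
    · rw [hi] at hb ⊢
      refine (min_le_left _ _).trans (hb.trans ?_)
      simp only [zpow_neg, zpow_natCast, Int.natAbs_neg, Int.natAbs_natCast]
      rw [← inv_pow]
      gcongr
  calc _ ≤ ∑ k ∈ S, 2 * r ^ (k + m).natAbs := Finset.sum_le_sum fun k _ => key k
    _ = 2 * ∑ j ∈ S.map (addRightEmbedding m), r ^ j.natAbs := by
        rw [← Finset.mul_sum, Finset.sum_map]; rfl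
    _ ≤ _ := by
        gcongr
        exact hs.sum_le_tsum _ (fun j _ => by positivity)

section
variable {E E' : Type*} [NormedAddCommGroup E] [NormedSpace ℂ E] [CompleteSpace E]
  [NormedAddCommGroup E'] [NormedSpace ℂ E'] [CompleteSpace E']

lemma czT_sm (K : ℝ → E →L[ℂ] E') (hK : Continuous K)
    {f : ℝ → E} (hf : StronglyMeasurable f) : StronglyMeasurable (czT K f) := by
  apply StronglyMeasurable.integral_prod_right' (f := fun z : ℝ × ℝ => K (z.1 - z.2) (f z.2))
  have h1 : StronglyMeasurable (fun z : ℝ × ℝ => K (z.1 - z.2)) :=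
    Continuous.stronglyMeasurable (by fun_prop)
  have h2 : StronglyMeasurable (fun z : ℝ × ℝ => f z.2) := hf.comp_measurable measurable_snd
  exact (isBoundedBilinearMap_apply (𝕜 := ℂ) (E := E) (F := E')).continuous.comp_stronglyMeasurable (h1.prodMk h2)

end

lemma cz_lp (p B : ℝ) (hp : 1 < p) (hB : 0 ≤ B) : ∃ C : ℝ≥0∞, C ≠ ⊤ ∧
    ∀ (E E' : Type) [NormedAddCommGroup E] [NormedSpace ℂ E] [CompleteSpace E]
    [NormedAddCommGroup E'] [NormedSpace ℂ E'] [CompleteSpace E'] (K : ℝ → E →L[ℂ] E') (_ : Continuous K) (M : ℝ) (_ : ∀ x, ‖K x‖ ≤ M) (A D : ℝ≥0∞)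
    (_ : ∀ q, ∀ y ∈ dyI q, ∫⁻ x in (dyS q)ᶜ, ‖K (x-y) - K (x - q.2*2^q.1)‖ₑ ≤ A)
    (_ : p < 2 ∨ D = 0)
    (_ : ∀ lam : ℝ, 0 < lam → ∀ g, StronglyMeasurable g → Integrable g → (∀ x, ‖g x‖ ≤ 2 * lam) →
      volume {x | B * lam < ‖czT K g x‖} ≤ D / ENNReal.ofReal lam ^ 2 * ∫⁻ x, ‖g x‖ₑ ^ 2)
    (f : ℝ → E), Continuous f → Integrable f →
    ∫⁻ x, ‖czT K f x‖ₑ ^ p ≤ C * (3 + 4 * A + 5 * D) * ∫⁻ x, ‖f x‖ₑ ^ p := by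
  obtain ⟨C, hC, H⟩ := marc p (B + 1) hp (by linarith)
  refine ⟨C, hC, ?_⟩
  intro E E' _ _ _ _ _ _ K hK M hM A D hA hD hG f hf hfi
  have := H (fun x => ‖czT K f x‖) (fun x => ‖f x‖) (3 + 4 * A + 4 * D) D (fun x => norm_nonneg _)
    (fun x => norm_nonneg _) (czT_sm K hK hf.stronglyMeasurable).norm.measurable
    hf.norm.measurable hD (by
      intro lam hl
      have := cz_weak K hK hM hB hA hl (hG lam hl) f hf hfi
      simpa only [ofReal_norm] using this)
  have e1 : (fun x => ‖czT K f x‖ₑ ^ p) = fun x => ENNReal.ofReal (‖czT K f x‖ ^ p) := by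
    ext x; rw [← ofReal_norm, ENNReal.ofReal_rpow_of_nonneg (norm_nonneg _) (by linarith)]
  have e2 : (fun x => ‖f x‖ₑ ^ p) = fun x => ENNReal.ofReal (‖f x‖ ^ p) := by
    ext x; rw [← ofReal_norm, ENNReal.ofReal_rpow_of_nonneg (norm_nonneg _) (by linarith)]
  rw [e1, e2]
  convert this using 3
  ring

end PP
end

section
open MeasureTheory
open scoped ENNReal FourierTransform SchwartzMap ContDiff

namespace PP

noncomputable def ker (Φ : ℝ → ℂ) (t : ℝ) (k : ℤ) (x : ℝ) : ℂ :=
  (((2:ℝ) ^ k : ℝ) : ℂ) * Φ (2 ^ k * x + t)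

lemma lint_aff {f : ℝ → ℝ≥0∞} (hf : Measurable f) {a : ℝ} (ha : 0 < a) (b : ℝ) :
    ∫⁻ x, ENNReal.ofReal a * f (a * x + b) = ∫⁻ x, f x := by
  have h1 : ∫⁻ x, f (x + b) = ∫⁻ x, f x := lintegral_add_right_eq_self f b
  rw [← h1]
  conv_rhs => rw [← Real.smul_map_volume_mul_left ha.ne', lintegral_smul_measure, abs_of_pos ha,
    lintegral_map (by fun_prop) (by fun_prop)]
  rw [lintegral_const_mul _ (by fun_prop), smul_eq_mul]

lemma trans_bd (Φ : 𝓢(ℝ, ℂ)) (h : ℝ) :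
    ∫⁻ u, ‖Φ (u + h) - Φ u‖ₑ ≤ ENNReal.ofReal |h| * ∫⁻ u, ‖deriv Φ u‖ₑ := by
  have hd : Differentiable ℝ Φ := Φ.differentiable
  have hc : Continuous (deriv Φ) := (Φ.smooth 1).continuous_deriv le_rfl
  have h1 : ∀ u, ‖Φ (u + h) - Φ u‖ₑ ≤ ∫⁻ s in Set.Ioc (0:ℝ) 1, ENNReal.ofReal |h| * ‖deriv Φ (u + s * h)‖ₑ := by
    intro u
    have e : ∫ s in (0:ℝ)..1, (h : ℂ) * deriv Φ (u + s * h) = Φ (u + h) - Φ u := by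
      have := intervalIntegral.integral_eq_sub_of_hasDerivAt (f := fun s : ℝ => Φ (u + s * h))
        (f' := fun s => (h : ℂ) * deriv Φ (u + s * h)) (a := 0) (b := 1) (by
          intro s _
          have h2 : HasDerivAt (fun s : ℝ => u + s * h) h s := by
            simpa using ((hasDerivAt_id s).mul_const h).const_add u
          have := (hd (u + s * h)).hasDerivAt.scomp s h2
          simpa using! this) (by
          apply Continuous.intervalIntegrable
          fun_prop)
      simpa using this
    rw [← e, intervalIntegral.integral_of_le zero_le_one]
    refine (enorm_integral_le_lintegral_enorm _).trans (le_of_eq ?_)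
    congr 1; ext s
    rw [enorm_mul]; congr 1
    rw [← ofReal_norm, Complex.norm_real, Real.norm_eq_abs]
  calc _ ≤ ∫⁻ u, ∫⁻ s in Set.Ioc (0:ℝ) 1, ENNReal.ofReal |h| * ‖deriv Φ (u + s * h)‖ₑ :=
        lintegral_mono h1
    _ = ∫⁻ s in Set.Ioc (0:ℝ) 1, ∫⁻ u, ENNReal.ofReal |h| * ‖deriv Φ (u + s * h)‖ₑ := by
        rw [lintegral_lintegral_swap]
        apply Measurable.aemeasurable
        fun_prop
    _ = ∫⁻ s in Set.Ioc (0:ℝ) 1, ENNReal.ofReal |h| * ∫⁻ u, ‖deriv Φ u‖ₑ := by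
        congr 1; ext s
        rw [lintegral_const_mul _ (by fun_prop)]
        congr 1
        exact lintegral_add_right_eq_self (fun u => ‖deriv Φ u‖ₑ) (s * h)
    _ = _ := by simp

lemma enorm_ker (Φ : ℝ → ℂ) (t : ℝ) (k : ℤ) (x : ℝ) :
    ‖ker Φ t k x‖ₑ = ENNReal.ofReal (2 ^ k) * ‖Φ (2 ^ k * x + t)‖ₑ := by
  rw [ker, enorm_mul]; congr 1
  rw [← ofReal_norm, Complex.norm_real, Real.norm_eq_abs, abs_of_pos (by positivity)]

lemma ker_lint (Φ : 𝓢(ℝ, ℂ)) (t : ℝ) (k : ℤ) : ∫⁻ x, ‖ker Φ t k x‖ₑ = ∫⁻ x, ‖Φ x‖ₑ := by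
  simp_rw [enorm_ker]
  exact lint_aff (f := fun x => ‖Φ x‖ₑ) (by fun_prop) (by positivity) t

lemma ker_cont (Φ : 𝓢(ℝ, ℂ)) (t : ℝ) (k : ℤ) : Continuous (ker Φ t k) := by
  unfold ker; fun_prop

lemma sch_lint_fin (Φ : 𝓢(ℝ, ℂ)) : ∫⁻ x, ‖Φ x‖ₑ ≠ ⊤ := Φ.integrable.2.ne

lemma ker_int (Φ : 𝓢(ℝ, ℂ)) (t : ℝ) (k : ℤ) : Integrable (ker Φ t k) := by
  refine ⟨(ker_cont Φ t k).aestronglyMeasurable, ?_⟩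
  rw [HasFiniteIntegral, ker_lint]
  exact (sch_lint_fin Φ).lt_top

lemma ker_bdd (Φ : 𝓢(ℝ, ℂ)) (t : ℝ) (k : ℤ) : ∃ M, ∀ x, ‖ker Φ t k x‖ ≤ M := by
  obtain ⟨M, hM⟩ := Φ.decay 0 0
  refine ⟨2 ^ k * M, fun x => ?_⟩
  rw [ker, norm_mul, Complex.norm_real, Real.norm_eq_abs, abs_of_pos (by positivity)]
  gcongr
  simpa using hM.2 (2 ^ k * x + t)

lemma wint (Φ : 𝓢(ℝ, ℂ)) : ∫⁻ x, ENNReal.ofReal (1 + |x|) * ‖Φ x‖ₑ ≠ ⊤ := by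
  have h1 := (Φ.integrable (μ := volume)).norm
  have h2 := (Φ.integrable_pow_mul volume 1)
  have h3 := h1.add h2
  have : (fun x => ENNReal.ofReal (1 + |x|) * ‖Φ x‖ₑ) =
      fun x => ‖‖Φ x‖ + ‖x‖ ^ 1 * ‖Φ x‖‖ₑ := by
    ext x
    rw [← ofReal_norm, ← ENNReal.ofReal_mul (by positivity), ← ofReal_norm (‖Φ x‖ + _),
      Real.norm_of_nonneg (by positivity : 0 ≤ ‖Φ x‖ + ‖x‖ ^ 1 * ‖Φ x‖), Real.norm_eq_abs]
    congr 1; ring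
  rw [this]
  exact h3.2.ne

lemma tail_bd (Φ : 𝓢(ℝ, ℂ)) (ε : ℝ) (h0 : 0 < ε) (h1 : ε ≤ 1) (t : ℝ) (k : ℤ) {l : ℝ} (hl : 0 < l) :
    ∫⁻ x in {x : ℝ | l ≤ |x|}, ‖ker Φ t k x‖ₑ ≤
      ENNReal.ofReal (((2:ℝ) ^ k * l) ^ (-ε) * (1 + |t|) ^ ε) *
        ∫⁻ x, ENNReal.ofReal (1 + |x|) * ‖Φ x‖ₑ := by
  have hm : MeasurableSet {x : ℝ | l ≤ |x|} := measurableSet_le (by fun_prop) (by fun_prop)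
  set a : ℝ := (2:ℝ) ^ k with ha
  have ha0 : 0 < a := by positivity
  calc _ ≤ ∫⁻ x in {x : ℝ | l ≤ |x|}, ENNReal.ofReal ((a * l) ^ (-ε) * (1 + |t|) ^ ε) *
        (ENNReal.ofReal a * (ENNReal.ofReal (1 + |a * x + t|) * ‖Φ (a * x + t)‖ₑ)) := by
        apply setLIntegral_mono' hm
        intro x hx
        rw [enorm_ker]
        have key : 1 ≤ (a * l) ^ (-ε) * (1 + |t|) ^ ε * (1 + |a * x + t|) := by
          have hx' : l ≤ |x| := hx
          have h2 : a * l ≤ (1 + |a * x + t|) * (1 + |t|) := by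
            calc a * l ≤ a * |x| := by gcongr
              _ = |a * x| := by rw [abs_mul, abs_of_pos ha0]
              _ = |(a * x + t) - t| := by congr 1; ring
              _ ≤ |a * x + t| + |t| := abs_sub _ _
              _ ≤ _ := by nlinarith [abs_nonneg (a * x + t), abs_nonneg t, mul_nonneg (abs_nonneg (a * x + t)) (abs_nonneg t)]
          have h3 : (a * l) ^ ε ≤ (1 + |a * x + t|) * (1 + |t|) ^ ε := by
            calc (a * l) ^ ε ≤ ((1 + |a * x + t|) * (1 + |t|)) ^ ε :=
                  Real.rpow_le_rpow (by positivity) h2 h0.le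
              _ = (1 + |a * x + t|) ^ ε * (1 + |t|) ^ ε := Real.mul_rpow (by positivity) (by positivity)
              _ ≤ (1 + |a * x + t|) ^ (1:ℝ) * (1 + |t|) ^ ε := by
                  gcongr
                  linarith [abs_nonneg (a * x + t)]
              _ = _ := by rw [Real.rpow_one]
          have h4 : 0 < (a * l) ^ ε := by positivity
          rw [Real.rpow_neg (by positivity), mul_assoc, mul_comm ((1 + |t|) ^ ε)]
          rw [le_inv_mul_iff₀ h4]; simpa using h3
        calc ENNReal.ofReal a * ‖Φ (a * x + t)‖ₑ
            = ENNReal.ofReal 1 * (ENNReal.ofReal a * ‖Φ (a * x + t)‖ₑ) := by simp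
          _ ≤ ENNReal.ofReal ((a * l) ^ (-ε) * (1 + |t|) ^ ε * (1 + |a * x + t|)) *
              (ENNReal.ofReal a * ‖Φ (a * x + t)‖ₑ) := by gcongr
          _ = _ := by rw [ENNReal.ofReal_mul (by positivity)]; ring
    _ ≤ ∫⁻ x, ENNReal.ofReal ((a * l) ^ (-ε) * (1 + |t|) ^ ε) *
        (ENNReal.ofReal a * (ENNReal.ofReal (1 + |a * x + t|) * ‖Φ (a * x + t)‖ₑ)) :=
        setLIntegral_le_lintegral _ _
    _ = _ := by
        have := Φ.continuous.measurable
        rw [lintegral_const_mul _ (by fun_prop)]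
        congr 1
        exact lint_aff (f := fun x => ENNReal.ofReal (1 + |x|) * ‖Φ x‖ₑ) (by fun_prop) ha0 t

lemma ker_diff_bd (Φ : 𝓢(ℝ, ℂ)) (t : ℝ) (k : ℤ) (y c : ℝ) :
    ∫⁻ x, ‖ker Φ t k (x - y) - ker Φ t k (x - c)‖ₑ ≤
      ENNReal.ofReal (2 ^ k * |y - c|) * ∫⁻ u, ‖deriv Φ u‖ₑ := by
  set a : ℝ := (2:ℝ) ^ k with ha
  have ha0 : 0 < a := by positivity
  have e : ∀ x, ‖ker Φ t k (x - y) - ker Φ t k (x - c)‖ₑ = ENNReal.ofReal a *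
      ‖Φ ((a * x + (t - a * c)) + (a * (c - y))) - Φ (a * x + (t - a * c))‖ₑ := by
    intro x
    rw [ker, ker, ← mul_sub, enorm_mul]
    congr 1
    · rw [← ofReal_norm, Complex.norm_real, Real.norm_eq_abs, abs_of_pos (by positivity)]
    · congr 3 <;> (simp only [← ha]; ring)
  simp_rw [e]
  rw [lint_aff (f := fun x => ‖Φ (x + (a * (c - y))) - Φ x‖ₑ) (by fun_prop) ha0]
  refine (trans_bd Φ _).trans (le_of_eq ?_)
  rw [abs_mul, abs_of_pos ha0, abs_sub_comm]

lemma hor1 (Φ : 𝓢(ℝ, ℂ)) (ε : ℝ) (h0 : 0 < ε) (h1 : ε ≤ 1) : ∃ C : ℝ, 0 ≤ C ∧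
    ∀ (t : ℝ) (k : ℤ) (q : ℤ × ℤ), ∀ y ∈ dyI q,
    ∫⁻ x in (dyS q)ᶜ, ‖ker Φ t k (x - y) - ker Φ t k (x - q.2*2^q.1)‖ₑ ≤
      ENNReal.ofReal (C * (1 + |t|) ^ ε * min ((2:ℝ) ^ k * 2 ^ q.1) (((2:ℝ) ^ k * 2 ^ q.1) ^ (-ε))) := by
  set W := ∫⁻ x, ENNReal.ofReal (1 + |x|) * ‖Φ x‖ₑ with hW
  have hWf : W ≠ ⊤ := wint Φ
  set V := ∫⁻ u, ‖deriv Φ u‖ₑ with hV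
  have hVf : V ≠ ⊤ := by
    have := sch_lint_fin (SchwartzMap.derivCLM ℝ ℂ Φ)
    simpa using this
  refine ⟨V.toReal + 2 * W.toReal, by positivity, ?_⟩
  intro t k q y hy
  set l : ℝ := (2:ℝ) ^ q.1 with hl
  have hl0 : 0 < l := by positivity
  set c : ℝ := q.2 * l with hc
  rw [mem_dyI, Int.floor_eq_iff, ← hl, le_div_iff₀ hl0, div_lt_iff₀ hl0] at hy
  have hyc : 0 ≤ y - c ∧ y - c < l := by
    constructor <;> simp only [hc] <;> linarith [hy.1, hy.2]
  have ht1 : 1 ≤ (1 + |t|) ^ ε := Real.one_le_rpow (by linarith [abs_nonneg t]) h0.le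
  set m := (2:ℝ) ^ k * l
  have hm0 : 0 < m := by positivity
  have b1 : ∫⁻ x in (dyS q)ᶜ, ‖ker Φ t k (x - y) - ker Φ t k (x - c)‖ₑ ≤
      ENNReal.ofReal ((V.toReal + 2 * W.toReal) * (1 + |t|) ^ ε * m) := by
    refine (setLIntegral_le_lintegral _ _).trans ((ker_diff_bd Φ t k y c).trans ?_)
    rw [← hV]
    nth_rw 1 [← ENNReal.ofReal_toReal hVf]
    rw [← ENNReal.ofReal_mul (by positivity)]
    apply ENNReal.ofReal_le_ofReal
    calc 2 ^ k * |y - c| * V.toReal ≤ m * V.toReal := by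
          rw [abs_of_nonneg hyc.1]; simp only [m]; gcongr; exact hyc.2.le
      _ = V.toReal * 1 * m := by ring
      _ ≤ _ := by
        gcongr
        linarith [@ENNReal.toReal_nonneg W]
  have hfar : ∀ z ∈ Set.Icc c (c + l), ∫⁻ x in (dyS q)ᶜ, ‖ker Φ t k (x - z)‖ₑ ≤
      ENNReal.ofReal (m ^ (-ε) * (1 + |t|) ^ ε) * W := by
    intro z hz
    have hm1 : MeasurableSet {x : ℝ | l ≤ |x|} := measurableSet_le (by fun_prop) (by fun_prop)
    have hm2 : MeasurableSet {x : ℝ | l ≤ |x - z|} := measurableSet_le (by fun_prop) (by fun_prop)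
    calc _ ≤ ∫⁻ x in {x : ℝ | l ≤ |x - z|}, ‖ker Φ t k (x - z)‖ₑ := by
          apply lintegral_mono_set
          intro x hx
          simp only [dyS, Set.mem_compl_iff, Set.mem_Ico, not_and, not_lt] at hx
          simp only [Set.mem_ofPred_eq]
          by_contra hcon
          rw [not_le, abs_lt] at hcon
          have := hx (by simp only [hc] at hz; nlinarith [hz.1, hz.2])
          simp only [hc] at hz; nlinarith [hz.1, hz.2]
      _ = ∫⁻ x in {x : ℝ | l ≤ |x|}, ‖ker Φ t k x‖ₑ := by
          rw [← lintegral_indicator hm2, ← lintegral_indicator hm1,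
            ← lintegral_sub_right_eq_self ({x : ℝ | l ≤ |x|}.indicator _) z]
          rfl
      _ ≤ _ := tail_bd Φ ε h0 h1 t k hl0
  have b2 : ∫⁻ x in (dyS q)ᶜ, ‖ker Φ t k (x - y) - ker Φ t k (x - c)‖ₑ ≤
      ENNReal.ofReal ((V.toReal + 2 * W.toReal) * (1 + |t|) ^ ε * m ^ (-ε)) := by
    calc _ ≤ ∫⁻ x in (dyS q)ᶜ, (‖ker Φ t k (x - y)‖ₑ + ‖ker Φ t k (x - c)‖ₑ) :=
          lintegral_mono fun x => enorm_sub_le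
      _ = _ := lintegral_add_left (by have := (ker_cont Φ t k).measurable; fun_prop) _
      _ ≤ ENNReal.ofReal (m ^ (-ε) * (1 + |t|) ^ ε) * W + ENNReal.ofReal (m ^ (-ε) * (1 + |t|) ^ ε) * W :=
          add_le_add (hfar y ⟨by linarith, by linarith⟩) (hfar c ⟨le_rfl, by linarith⟩)
      _ ≤ _ := by
          rw [← ENNReal.ofReal_toReal hWf, ← ENNReal.ofReal_mul (by positivity),
            ← ENNReal.ofReal_add (by positivity) (by positivity)]
          apply ENNReal.ofReal_le_ofReal
          rw [ENNReal.toReal_ofReal (by positivity)]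
          have : 0 ≤ V.toReal * ((1 + |t|) ^ ε * m ^ (-ε)) := by positivity
          nlinarith
  rcases min_choice m (m ^ (-ε)) with h | h <;> rw [h]
  · exact b1
  · exact b2

lemma hor (Φ : 𝓢(ℝ, ℂ)) (ε : ℝ) (h0 : 0 < ε) (h1 : ε ≤ 1) : ∃ C : ℝ, 0 ≤ C ∧
    ∀ (E E' : Type) [NormedAddCommGroup E] [NormedSpace ℂ E] 
    [NormedAddCommGroup E'] [NormedSpace ℂ E'] (t : ℝ) (S : Finset ℤ) (L : S → (E →L[ℂ] E')),
    (∀ k, ‖L k‖ ≤ 1) → ∀ (q : ℤ × ℤ), ∀ y ∈ dyI q,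
    ∫⁻ x in (dyS q)ᶜ, ‖(∑ k : S, ker Φ t k (x - y) • L k) - ∑ k : S, ker Φ t k (x - q.2*2^q.1) • L k‖ₑ ≤
      ENNReal.ofReal (C * (1 + |t|) ^ ε) := by
  obtain ⟨C1, hC1, H1⟩ := hor1 Φ ε h0 h1
  obtain ⟨C2, hC2, H2⟩ := minsum ε h0 h1
  refine ⟨C1 * C2, by positivity, ?_⟩
  intro E E' _ _ _ _ t S L hL q y hy
  calc _ ≤ ∫⁻ x in (dyS q)ᶜ, ∑ k : S, ‖ker Φ t k (x - y) - ker Φ t k (x - q.2*2^q.1)‖ₑ := by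
        apply lintegral_mono
        intro x
        simp only
        rw [← Finset.sum_sub_distrib]
        refine (enorm_sum_le (ε := E →L[ℂ] E') _ _).trans (Finset.sum_le_sum fun k _ => ?_)
        rw [← sub_smul, enorm_smul]
        have : ‖L k‖ₑ ≤ 1 := by
          rw [← ofReal_norm]; exact ENNReal.ofReal_le_one.2 (hL k)
        exact mul_le_of_le_one_right' this
    _ = ∑ k : S, ∫⁻ x in (dyS q)ᶜ, ‖ker Φ t k (x - y) - ker Φ t k (x - q.2*2^q.1)‖ₑ := by
        apply lintegral_finsetSum
        intro k _
        have := (ker_cont Φ t k).measurable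
        fun_prop
    _ ≤ ∑ k : S, ENNReal.ofReal (C1 * (1 + |t|) ^ ε * min ((2:ℝ) ^ (k:ℤ) * 2 ^ q.1) (((2:ℝ) ^ (k:ℤ) * 2 ^ q.1) ^ (-ε))) :=
        Finset.sum_le_sum fun k _ => H1 t k q y hy
    _ ≤ _ := by
        rw [← ENNReal.ofReal_sum_of_nonneg (fun k _ => by positivity)]
        apply ENNReal.ofReal_le_ofReal
        rw [← Finset.mul_sum]
        have := H2 (2 ^ q.1) (by positivity) S
        rw [← Finset.sum_coe_sort] at this
        calc _ ≤ C1 * (1 + |t|) ^ ε * C2 := by gcongr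
          _ = _ := by ring

end PP
end

section
open MeasureTheory
open scoped ENNReal FourierTransform SchwartzMap ContDiff

namespace PP

noncomputable def tk (Φ : ℝ → ℂ) (t : ℝ) (k : ℤ) (f : ℝ → ℂ) (x : ℝ) : ℂ :=
  ∫ y, ker Φ t k (x - y) * f y

lemma tk_integrand (Φ : 𝓢(ℝ, ℂ)) (t : ℝ) (k : ℤ) {f : ℝ → ℂ} (hf : Integrable f) (x : ℝ) :
    Integrable (fun y => ker Φ t k (x - y) * f y) := by
  obtain ⟨M, hM⟩ := ker_bdd Φ t k
  have := (ker_cont Φ t k)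
  exact hf.bdd_mul (c := M) (by fun_prop) (Filter.Eventually.of_forall fun y => hM _)

lemma tk_cont (Φ : 𝓢(ℝ, ℂ)) (t : ℝ) (k : ℤ) {f : ℝ → ℂ} (hf : Integrable f) :
    Continuous (tk Φ t k f) := by
  obtain ⟨M, hM⟩ := ker_bdd Φ t k
  have := (ker_cont Φ t k)
  apply continuous_of_dominated (bound := fun y => M * ‖f y‖)
  · intro x; exact (tk_integrand Φ t k hf x).1
  · intro x; filter_upwards with y; rw [norm_mul]; gcongr; exact hM _
  · exact hf.norm.const_mul M
  · filter_upwards with y; fun_prop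

lemma tk_conv (Φ : 𝓢(ℝ, ℂ)) (t : ℝ) (k : ℤ) (f : ℝ → ℂ) :
    tk Φ t k f = convolution f (ker Φ t k) (ContinuousLinearMap.mul ℂ ℂ) volume := by
  ext x
  simp only [tk, convolution, ContinuousLinearMap.mul_apply', mul_comm]

lemma tk_int (Φ : 𝓢(ℝ, ℂ)) (t : ℝ) (k : ℤ) {f : ℝ → ℂ} (hf : Integrable f) :
    Integrable (tk Φ t k f) := by
  rw [tk_conv]
  exact Integrable.integrable_convolution (ContinuousLinearMap.mul ℂ ℂ) hf (ker_int Φ t k)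

lemma tk_bdd (Φ : 𝓢(ℝ, ℂ)) (t : ℝ) (k : ℤ) {f : ℝ → ℂ} (hf : Integrable f) :
    ∃ M, ∀ x, ‖tk Φ t k f x‖ ≤ M := by
  obtain ⟨M, hM⟩ := ker_bdd Φ t k
  refine ⟨∫ y, M * ‖f y‖, fun x => ?_⟩
  refine norm_integral_le_of_norm_le (hf.norm.const_mul M) ?_
  filter_upwards with y; rw [norm_mul]; gcongr; exact hM _

lemma tk_sup (Φ : 𝓢(ℝ, ℂ)) (t : ℝ) (k : ℤ) {f : ℝ → ℂ} {b : ℝ} (hb : ∀ᵐ x, ‖f x‖ ≤ b) (hb0 : 0 ≤ b) (x : ℝ) :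
    ‖tk Φ t k f x‖ ≤ b * (∫⁻ x, ‖Φ x‖ₑ).toReal := by
  rw [← ENNReal.ofReal_le_ofReal_iff (by positivity), ofReal_norm, ENNReal.ofReal_mul hb0,
    ENNReal.ofReal_toReal (sch_lint_fin Φ), ← ker_lint Φ t k]
  refine (enorm_integral_le_lintegral_enorm _).trans ?_
  have := (ker_cont Φ t k).measurable
  calc _ ≤ ∫⁻ y, ENNReal.ofReal b * ‖ker Φ t k (x - y)‖ₑ := by
        apply lintegral_mono_ae
        filter_upwards [hb] with y hy
        rw [enorm_mul, mul_comm]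
        gcongr
        rw [← ofReal_norm]; exact ENNReal.ofReal_le_ofReal hy
    _ = _ := by
        rw [lintegral_const_mul _ (by fun_prop), lintegral_sub_left_eq_self (fun y => ‖ker Φ t k y‖ₑ) x]

lemma memLp2_of_bdd {f : ℝ → ℂ} (hf : Integrable f) {b : ℝ} (hb : ∀ x, ‖f x‖ ≤ b) : MemLp f 2 := by
  rw [memLp_two_iff_integrable_sq_norm hf.1]
  have := hf.norm.bdd_mul (c := b) hf.1.norm (Filter.Eventually.of_forall fun x => by simpa using hb x)
  exact this.congr (Filter.Eventually.of_forall fun x => by simp [sq])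

lemma int_aff (f : ℝ → ℂ) {a : ℝ} (ha : 0 < a) (b : ℝ) :
    ∫ x, (a : ℂ) * f (a * x + b) = ∫ x, f x := by
  rw [integral_const_mul, Measure.integral_comp_mul_left (fun x => f (x + b)) a,
    integral_add_right_eq_self f b, abs_of_pos (by positivity), Complex.real_smul, ← mul_assoc]
  push_cast
  rw [mul_inv_cancel₀ (by exact_mod_cast ha.ne'), one_mul]

lemma four_ker (Φ : 𝓢(ℝ, ℂ)) (t : ℝ) (k : ℤ) (ξ : ℝ) :
    𝓕 (ker Φ t k) ξ = Complex.exp (↑(2 * Real.pi * t * ((2:ℝ) ^ (-k) * ξ)) * Complex.I) * 𝓕 (⇑Φ) ((2:ℝ) ^ (-k) * ξ) := by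
  set a : ℝ := (2:ℝ) ^ k with ha
  have ha0 : 0 < a := by positivity
  have h1 : 𝓕 (ker Φ t k) ξ = ∫ x, (a : ℂ) * (Complex.exp (↑(2 * Real.pi * t * (a⁻¹ * ξ)) * Complex.I) *
      ((fun v => Complex.exp (↑(-2 * Real.pi * v * (a⁻¹ * ξ)) * Complex.I) * Φ v) (a * x + t))) := by
    rw [Real.fourier_real_eq_integral_exp_smul]
    congr 1; ext x
    simp only [ker, smul_eq_mul, ← ha]
    rw [← mul_assoc (Complex.exp _) (Complex.exp _), ← Complex.exp_add]
    have : ((-2 * Real.pi * x * ξ : ℝ) : ℂ) * Complex.I = 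
      ↑(2 * Real.pi * t * (a⁻¹ * ξ)) * Complex.I + ↑(-2 * Real.pi * (a * x + t) * (a⁻¹ * ξ)) * Complex.I := by
      rw [← add_mul]; congr 1
      rw [← Complex.ofReal_add]; congr 1
      field_simp
      ring
    rw [this]; ring
  rw [h1, int_aff (fun v => Complex.exp (↑(2 * Real.pi * t * (a⁻¹ * ξ)) * Complex.I) *
    (Complex.exp (↑(-2 * Real.pi * v * (a⁻¹ * ξ)) * Complex.I) * Φ v)) ha0 t,
    integral_const_mul,
    Real.fourier_real_eq_integral_exp_smul, zpow_neg]
  rfl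

lemma norm_four_ker (Φ : 𝓢(ℝ, ℂ)) (t : ℝ) (k : ℤ) (ξ : ℝ) :
    ‖𝓕 (ker Φ t k) ξ‖ = ‖𝓕 (⇑Φ) ((2:ℝ) ^ (-k) * ξ)‖ := by
  rw [four_ker, norm_mul, Complex.norm_exp_ofReal_mul_I, one_mul]

lemma four_tk (Φ : 𝓢(ℝ, ℂ)) (t : ℝ) (k : ℤ) {f : ℝ → ℂ} (hf : Integrable f) (ξ : ℝ) :
    ‖𝓕 (tk Φ t k f) ξ‖ = ‖𝓕 (⇑Φ) ((2:ℝ) ^ (-k) * ξ)‖ * ‖𝓕 f ξ‖ := by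
  rw [tk_conv, Real.fourier_mul_convolution_eq hf (ker_int Φ t k), norm_mul, norm_four_ker, mul_comm]

def SqSum (Φ : ℝ → ℂ) (D : ℝ) : Prop := 0 ≤ D ∧ ∀ (S : Finset ℤ) (ξ : ℝ),
  ∑ k : S, ‖𝓕 Φ ((2:ℝ) ^ (-(k:ℤ)) * ξ)‖ ^ 2 ≤ D

lemma SqSum.en {Φ : ℝ → ℂ} {D : ℝ} (h : SqSum Φ D) (S : Finset ℤ) (ξ : ℝ) :
    ∑ k : S, ‖𝓕 Φ ((2:ℝ) ^ (-(k:ℤ)) * ξ)‖ₑ ^ 2 ≤ ENNReal.ofReal D := by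
  have := ENNReal.ofReal_le_ofReal (h.2 S ξ)
  rw [ENNReal.ofReal_sum_of_nonneg (fun k _ => by positivity)] at this
  simpa only [ENNReal.ofReal_pow (norm_nonneg _), ofReal_norm] using this

lemma four_cont {f : ℝ → ℂ} (hf : Integrable f) : Continuous (𝓕 f) :=
  VectorFourier.fourierIntegral_continuous Real.continuous_fourierChar
      (L := innerₗ ℝ) continuous_inner hf

lemma sq_L2 (Φ : 𝓢(ℝ, ℂ)) {D : ℝ} (hD : SqSum Φ D) (t : ℝ) (S : Finset ℤ) {f : ℝ → ℂ}
    (hf : Integrable f) {b : ℝ} (hb : ∀ x, ‖f x‖ ≤ b) :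
    ∫⁻ x, ∑ k : S, ‖tk Φ t k f x‖ₑ ^ 2 ≤ ENNReal.ofReal D * ∫⁻ x, ‖f x‖ₑ ^ 2 := by
  have hfm := (four_cont hf).measurable
  have hm : ∀ k : S, Measurable (tk Φ t k f) := fun k => (tk_cont Φ t k hf).measurable
  have hm2 : Measurable (𝓕 (⇑Φ)) := (four_cont Φ.integrable).measurable
  rw [lintegral_finsetSum _ (fun k _ => by have := hm k; fun_prop)]
  have : ∀ k : S, ∫⁻ x, ‖tk Φ t k f x‖ₑ ^ 2 =
      ∫⁻ ξ, ‖𝓕 (⇑Φ) ((2:ℝ) ^ (-(k:ℤ)) * ξ)‖ₑ ^ 2 * ‖𝓕 f ξ‖ₑ ^ 2 := by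
    intro k
    obtain ⟨M, hM⟩ := tk_bdd Φ t k hf
    rw [← planch _ (tk_int Φ t k hf) (memLp2_of_bdd (tk_int Φ t k hf) hM)]
    congr 1; ext ξ
    rw [← ofReal_norm, four_tk Φ t k hf, ENNReal.ofReal_mul (norm_nonneg _), ofReal_norm, ofReal_norm, mul_pow]
  simp_rw [this]
  rw [← lintegral_finsetSum _ (fun k _ => by fun_prop), ← planch f hf (memLp2_of_bdd hf hb),
    ← lintegral_const_mul _ (by fun_prop)]
  apply lintegral_mono
  intro ξ
  simp only
  rw [← Finset.sum_mul]
  gcongr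
  exact hD.en S ξ

lemma cs_en {ι : Type*} (s : Finset ι) (u v : ι → ℝ≥0∞) :
    (∑ i ∈ s, u i * v i) ^ 2 ≤ (∑ i ∈ s, u i ^ 2) * ∑ i ∈ s, v i ^ 2 := by
  have := ENNReal.inner_le_Lp_mul_Lq s u v (p := 2) (q := 2) (by constructor <;> norm_num)
  calc _ ≤ ((∑ i ∈ s, u i ^ (2:ℝ)) ^ (1 / (2:ℝ)) * (∑ i ∈ s, v i ^ (2:ℝ)) ^ (1 / (2:ℝ))) ^ 2 := by gcongr
    _ = _ := by
      rw [mul_pow, ← ENNReal.rpow_natCast, ← ENNReal.rpow_natCast, ← ENNReal.rpow_mul, ← ENNReal.rpow_mul]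
      norm_num

lemma dual_L2 (Φ : 𝓢(ℝ, ℂ)) {D : ℝ} (hD : SqSum Φ D) (t : ℝ) (S : Finset ℤ) {f : S → ℝ → ℂ}
    (hf : ∀ k, Integrable (f k)) {b : ℝ} (hb : ∀ k x, ‖f k x‖ ≤ b) :
    ∫⁻ x, ‖∑ k : S, tk Φ t k (f k) x‖ₑ ^ 2 ≤ ENNReal.ofReal D * ∫⁻ x, ∑ k : S, ‖f k x‖ₑ ^ 2 := by
  have hfm := fun k => (four_cont (hf k)).measurable
  have hm : ∀ k : S, AEMeasurable (f k) := fun k => (hf k).1.aemeasurable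
  have hi : Integrable (fun x => ∑ k : S, tk Φ t k (f k) x) := 
    integrable_finsetSum _ fun k _ => tk_int Φ t k (hf k)
  choose M hM using fun k : S => tk_bdd Φ t k (hf k)
  rw [← planch _ hi (memLp2_of_bdd (b := ∑ k, M k) hi (fun x =>
    (norm_sum_le _ _).trans (Finset.sum_le_sum fun k _ => hM k x)))]
  rw [lintegral_finsetSum' _ (fun k _ => by have := hm k; fun_prop)]
  simp_rw [fun k => (planch (f k) (hf k) (memLp2_of_bdd (hf k) (hb k))).symm]
  rw [← lintegral_finsetSum _ (fun k _ => by have := hfm k; fun_prop),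
    ← lintegral_const_mul _ (Finset.measurable_sum _ fun k _ => by have := hfm k; fun_prop)]
  apply lintegral_mono
  intro ξ
  have e : 𝓕 (fun x => ∑ k : S, tk Φ t k (f k) x) ξ = ∑ k : S, 𝓕 (tk Φ t k (f k)) ξ := by
    simp only [Real.fourier_real_eq_integral_exp_smul, Finset.smul_sum]
    apply integral_finsetSum
    intro k _
    refine (tk_int Φ t k (hf k)).bdd_mul (c := 1) (by fun_prop) ?_
    filter_upwards with x
    rw [Complex.norm_exp_ofReal_mul_I]
  simp only [e]
  calc _ ≤ (∑ k : S, ‖𝓕 (tk Φ t k (f k)) ξ‖ₑ) ^ 2 := by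
        gcongr; exact enorm_sum_le _ _
    _ = (∑ k : S, ‖𝓕 (⇑Φ) ((2:ℝ) ^ (-(k:ℤ)) * ξ)‖ₑ * ‖𝓕 (f k) ξ‖ₑ) ^ 2 := by
        congr 1; apply Finset.sum_congr rfl
        intro k _
        rw [← ofReal_norm, four_tk Φ t k (hf k), ENNReal.ofReal_mul (norm_nonneg _), ofReal_norm, ofReal_norm]
    _ ≤ _ := cs_en _ _ _
    _ ≤ _ := by gcongr; exact hD.en S ξ

end PP
end

section
open MeasureTheory
open scoped ENNReal FourierTransform SchwartzMap ContDiff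

namespace PP

section
variable {E E' : Type} [NormedAddCommGroup E] [NormedSpace ℂ E] [NormedAddCommGroup E'] [NormedSpace ℂ E']

lemma kop_cont (Φ : 𝓢(ℝ, ℂ)) (t : ℝ) (S : Finset ℤ) (L : S → (E →L[ℂ] E')) :
    Continuous (fun x => ∑ k : S, ker Φ t k x • L k) := by
  apply continuous_finsetSum
  intro k _
  have := ker_cont Φ t k
  fun_prop

lemma kop_bdd (Φ : 𝓢(ℝ, ℂ)) (t : ℝ) (S : Finset ℤ) (L : S → (E →L[ℂ] E')) :
    ∃ M, ∀ x, ‖∑ k : S, ker Φ t k x • L k‖ ≤ M := by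
  choose M hM using fun k : S => ker_bdd Φ t k
  refine ⟨∑ k : S, M k * ‖L k‖, fun x => (norm_sum_le _ _).trans (Finset.sum_le_sum fun k _ => ?_)⟩
  rw [norm_smul]; gcongr; exact hM k x

lemma kop_span [CompleteSpace E'] (Φ : 𝓢(ℝ, ℂ)) (t : ℝ) (S : Finset ℤ) (e : S → E') {f : ℝ → ℂ} (hf : Integrable f) (x : ℝ) :
    czT (fun x => ∑ k : S, ker Φ t k x • ContinuousLinearMap.toSpanSingleton ℂ (e k)) f x =
      ∑ k : S, tk Φ t k f x • e k := by
  simp only [czT, ContinuousLinearMap.sum_apply, ContinuousLinearMap.smul_apply,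
    ContinuousLinearMap.toSpanSingleton_apply, smul_smul]
  rw [integral_finsetSum _ (fun (k : S) _ => (tk_integrand Φ t k hf x).smul_const (e k))]
  apply Finset.sum_congr rfl
  intro k _
  rw [integral_smul_const]; rfl

lemma kop_proj (Φ : 𝓢(ℝ, ℂ)) (t : ℝ) (S : Finset ℤ) {f : ℝ → EuclideanSpace ℂ S} (hf : Integrable f) (x : ℝ) :
    czT (fun x => ∑ k : S, ker Φ t k x • (EuclideanSpace.proj k : EuclideanSpace ℂ S →L[ℂ] ℂ)) f x =
      ∑ k : S, tk Φ t k (fun y => f y k) x := by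
  simp only [czT, ContinuousLinearMap.sum_apply, ContinuousLinearMap.smul_apply, EuclideanSpace.coe_proj]
  rw [integral_finsetSum _ (fun k _ => ?_)]
  · rfl
  · have : Integrable (fun y => f y k) := (EuclideanSpace.proj k : EuclideanSpace ℂ S →L[ℂ] ℂ).integrable_comp hf
    exact tk_integrand Φ t k this x
end

lemma eu_en {S : Finset ℤ} (v : EuclideanSpace ℂ S) : ‖v‖ₑ ^ 2 = ∑ k, ‖v k‖ₑ ^ 2 := by
  rw [← ofReal_norm, ← ENNReal.ofReal_pow (norm_nonneg _), EuclideanSpace.norm_sq_eq,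
    ENNReal.ofReal_sum_of_nonneg (fun k _ => by positivity)]
  simp only [ENNReal.ofReal_pow (norm_nonneg _), ofReal_norm]

lemma eu_rpow {S : Finset ℤ} (v : EuclideanSpace ℂ S) (p : ℝ) : ‖v‖ₑ ^ p = (∑ k, ‖v k‖ₑ ^ 2) ^ (p / 2) := by
  rw [← eu_en, ← ENNReal.rpow_natCast, ← ENNReal.rpow_mul]
  congr 1; push_cast; ring

lemma const_bd {C : ℝ≥0∞} (hC : C ≠ ⊤) {A D : ℝ} (hA : 0 ≤ A) (hD : 0 ≤ D) : ∃ C' : ℝ, 0 ≤ C' ∧ ∀ w : ℝ, 1 ≤ w →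
    C * (3 + 4 * ENNReal.ofReal (A * w) + 5 * ENNReal.ofReal D) ≤ ENNReal.ofReal (C' * w) := by
  refine ⟨C.toReal * (3 + 4 * A + 5 * D), by positivity, fun w hw => ?_⟩
  have hw0 : 0 ≤ w := by linarith
  have e3 : (3:ℝ≥0∞) = ENNReal.ofReal 3 := by simp
  have e4 : (4:ℝ≥0∞) = ENNReal.ofReal 4 := by simp
  have e5 : (5:ℝ≥0∞) = ENNReal.ofReal 5 := by simp
  rw [← ENNReal.ofReal_toReal hC, e3, e4, e5, ← ENNReal.ofReal_mul (by norm_num), ← ENNReal.ofReal_mul (by norm_num),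
    ← ENNReal.ofReal_add (by norm_num) (by positivity), ← ENNReal.ofReal_add (by positivity) (by positivity),
    ← ENNReal.ofReal_mul (by positivity)]
  apply ENNReal.ofReal_le_ofReal
  rw [ENNReal.toReal_ofReal (by positivity), mul_assoc]
  gcongr
  nlinarith

lemma one_le_w {ε : ℝ} (h0 : 0 < ε) (t : ℝ) : 1 ≤ (1 + |t|) ^ ε :=
  Real.one_le_rpow (by linarith [abs_nonneg t]) h0.le

theorem max1 (Φ : 𝓢(ℝ, ℂ)) (ε : ℝ) (h0 : 0 < ε) (h1 : ε ≤ 1) (p : ℝ) (hp : 1 < p) :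
    ∃ C : ℝ, 0 ≤ C ∧ ∀ (t : ℝ) (S : Finset ℤ) (f : ℝ → ℂ), Continuous f → Integrable f →
    ∫⁻ x, (S.sup fun k => ‖tk Φ t k f x‖ₑ) ^ p ≤ ENNReal.ofReal (C * (1 + |t|) ^ ε) * ∫⁻ x, ‖f x‖ₑ ^ p := by
  set V := (∫⁻ x, ‖Φ x‖ₑ).toReal
  obtain ⟨C0, hC0, H⟩ := cz_lp p (2 * V) hp (by positivity)
  obtain ⟨A, hA, HA⟩ := hor Φ ε h0 h1
  obtain ⟨C, hC, HC⟩ := const_bd hC0 hA le_rfl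
  refine ⟨C, hC, fun t S f hf hfi => ?_⟩
  set L : S → (ℂ →L[ℂ] (S → ℂ)) := fun k => ContinuousLinearMap.toSpanSingleton ℂ (Pi.single k (1:ℂ)) with hL
  obtain ⟨M, hM⟩ := kop_bdd Φ t S L
  have hLn : ∀ k, ‖L k‖ ≤ 1 := fun k => by simp [hL, Pi.norm_single]
  have hcomp : ∀ {g : ℝ → ℂ}, Integrable g → ∀ x, czT (fun x => ∑ k : S, ker Φ t k x • L k) g x =
      fun k : S => tk Φ t k g x := by
    intro g hg x
    rw [hL, kop_span Φ t S _ hg]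
    ext k
    simp [Finset.sum_apply, Pi.single_apply]
  have := H ℂ (S → ℂ) (fun x => ∑ k : S, ker Φ t k x • L k) (kop_cont Φ t S L) M hM _ 0
    (HA ℂ (S → ℂ) t S L hLn) (Or.inr rfl) (by
      intro lam hl g _ hg hgb
      have : {x | 2 * V * lam < ‖czT (fun x => ∑ k : S, ker Φ t k x • L k) g x‖} = ∅ := by
        ext x
        simp only [Set.mem_ofPred_eq, Set.mem_empty_iff_false, iff_false, not_lt]
        rw [hcomp hg, pi_norm_le_iff_of_nonneg (by positivity)]
        intro k
        have := tk_sup Φ t k (Filter.Eventually.of_forall hgb) (by linarith) x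
        linarith
      rw [this]; simp) f hf hfi
  calc _ ≤ ∫⁻ x, ‖czT (fun x => ∑ k : S, ker Φ t k x • L k) f x‖ₑ ^ p := by
        apply lintegral_mono
        intro x
        simp only
        gcongr
        apply Finset.sup_le
        intro k hk
        rw [hcomp hfi, ← ofReal_norm, ← ofReal_norm]
        exact ENNReal.ofReal_le_ofReal (norm_le_pi_norm (fun k : S => tk Φ t k f x) ⟨k, hk⟩)
    _ ≤ _ := this
    _ ≤ _ := by
        gcongr
        have := HC ((1 + |t|) ^ ε) (one_le_w h0 t)
        simpa using this

lemma cheb {E' : Type*} [NormedAddCommGroup E'] {u : ℝ → E'} (hu : StronglyMeasurable u) {lam : ℝ} (hl : 0 < lam)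
    {D X : ℝ≥0∞} (h : ∫⁻ x, ‖u x‖ₑ ^ 2 ≤ D * X) :
    volume {x | 1 * lam < ‖u x‖} ≤ D / ENNReal.ofReal lam ^ 2 * X := by
  have h1 := mul_meas_ge_le_lintegral (μ := volume) (f := fun x => ‖u x‖ₑ ^ 2) (by have := hu.enorm; fun_prop) (ENNReal.ofReal lam ^ 2)
  have h2 : volume {x | 1 * lam < ‖u x‖} ≤ volume {x | ENNReal.ofReal lam ^ 2 ≤ ‖u x‖ₑ ^ 2} := by
    apply measure_mono
    intro x hx
    simp only [Set.mem_ofPred_eq, one_mul] at hx ⊢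
    rw [← ofReal_norm]
    gcongr
  have h3 : ENNReal.ofReal lam ^ 2 ≠ 0 := by simpa using hl
  have h4 : ENNReal.ofReal lam ^ 2 ≠ ⊤ := by finiteness
  refine h2.trans ?_
  rw [div_eq_mul_inv, mul_right_comm, ← div_eq_mul_inv, ENNReal.le_div_iff_mul_le (Or.inl h3) (Or.inl h4), mul_comm]
  exact h1.trans h

theorem sq_lo (Φ : 𝓢(ℝ, ℂ)) {D : ℝ} (hD : SqSum Φ D) (ε : ℝ) (h0 : 0 < ε) (h1 : ε ≤ 1) (p : ℝ) (hp : 1 < p) (hp2 : p < 2) :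
    ∃ C : ℝ, 0 ≤ C ∧ ∀ (t : ℝ) (S : Finset ℤ) (f : ℝ → ℂ), Continuous f → Integrable f →
    ∫⁻ x, (∑ k : S, ‖tk Φ t k f x‖ₑ ^ 2) ^ (p / 2) ≤ ENNReal.ofReal (C * (1 + |t|) ^ ε) * ∫⁻ x, ‖f x‖ₑ ^ p := by
  obtain ⟨C0, hC0, H⟩ := cz_lp p 1 hp (by positivity)
  obtain ⟨A, hA, HA⟩ := hor Φ ε h0 h1
  obtain ⟨C, hC, HC⟩ := const_bd hC0 hA hD.1
  refine ⟨C, hC, fun t S f hf hfi => ?_⟩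
  set L : S → (ℂ →L[ℂ] (EuclideanSpace ℂ S)) := fun k =>
    ContinuousLinearMap.toSpanSingleton ℂ (EuclideanSpace.single k (1:ℂ)) with hL
  obtain ⟨M, hM⟩ := kop_bdd Φ t S L
  have hLn : ∀ k, ‖L k‖ ≤ 1 := fun k => by simp [hL]
  have hcomp : ∀ {g : ℝ → ℂ}, Integrable g → ∀ x k, czT (fun x => ∑ k : S, ker Φ t k x • L k) g x k =
      tk Φ t k g x := by
    intro g hg x k
    rw [hL, kop_span Φ t S _ hg]
    simp [Pi.single_apply]
  have := H ℂ (EuclideanSpace ℂ S) (fun x => ∑ k : S, ker Φ t k x • L k) (kop_cont Φ t S L) M hM _ (ENNReal.ofReal D)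
    (HA ℂ (EuclideanSpace ℂ S) t S L hLn) (Or.inl hp2) (by
      intro lam hl g hgm hg hgb
      apply cheb (czT_sm _ (kop_cont Φ t S L) hgm) hl
      simp only [eu_en, hcomp hg]
      exact sq_L2 Φ hD t S hg hgb) f hf hfi
  simp only [eu_rpow, hcomp hfi] at this
  refine this.trans ?_
  gcongr
  exact HC ((1 + |t|) ^ ε) (one_le_w h0 t)

theorem dual_lo (Φ : 𝓢(ℝ, ℂ)) {D : ℝ} (hD : SqSum Φ D) (ε : ℝ) (h0 : 0 < ε) (h1 : ε ≤ 1) (p : ℝ) (hp : 1 < p) (hp2 : p < 2) :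
    ∃ C : ℝ, 0 ≤ C ∧ ∀ (t : ℝ) (S : Finset ℤ) (f : ℝ → EuclideanSpace ℂ S), Continuous f → Integrable f →
    ∫⁻ x, ‖∑ k : S, tk Φ t k (fun y => f y k) x‖ₑ ^ p ≤ ENNReal.ofReal (C * (1 + |t|) ^ ε) * ∫⁻ x, ‖f x‖ₑ ^ p := by
  obtain ⟨C0, hC0, H⟩ := cz_lp p 1 hp (by positivity)
  obtain ⟨A, hA, HA⟩ := hor Φ ε h0 h1
  obtain ⟨C, hC, HC⟩ := const_bd hC0 hA hD.1
  refine ⟨C, hC, fun t S f hf hfi => ?_⟩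
  set L : S → (EuclideanSpace ℂ S →L[ℂ] ℂ) := fun k => (EuclideanSpace.proj k : EuclideanSpace ℂ S →L[ℂ] ℂ) with hL
  obtain ⟨M, hM⟩ := kop_bdd Φ t S L
  have hLn : ∀ k, ‖L k‖ ≤ 1 := fun k => by
    apply ContinuousLinearMap.opNorm_le_bound _ zero_le_one
    intro x
    rw [one_mul]
    exact PiLp.norm_apply_le x k
  have := H (EuclideanSpace ℂ S) ℂ (fun x => ∑ k : S, ker Φ t k x • L k) (kop_cont Φ t S L) M hM _ (ENNReal.ofReal D)
    (HA (EuclideanSpace ℂ S) ℂ t S L hLn) (Or.inl hp2) (by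
      intro lam hl g hgm hg hgb
      apply cheb (czT_sm _ (kop_cont Φ t S L) hgm) hl
      simp only [hL, kop_proj Φ t S hg, eu_en]
      exact dual_L2 Φ hD t S (f := fun k y => g y k) (fun k =>
        (EuclideanSpace.proj k : EuclideanSpace ℂ S →L[ℂ] ℂ).integrable_comp hg)
        (fun k x => (PiLp.norm_apply_le (g x) k).trans (hgb x))) f hf hfi
  simp only [hL, kop_proj Φ t S hfi] at this
  refine this.trans ?_
  gcongr
  exact HC ((1 + |t|) ^ ε) (one_le_w h0 t)

noncomputable def refl (Φ : 𝓢(ℝ, ℂ)) : 𝓢(ℝ, ℂ) :=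
  SchwartzMap.compCLMOfContinuousLinearEquiv ℝ (ContinuousLinearEquiv.neg ℝ) Φ

lemma refl_apply (Φ : 𝓢(ℝ, ℂ)) (x : ℝ) : refl Φ x = Φ (-x) := rfl

lemma refl_sq {Φ : 𝓢(ℝ, ℂ)} {D : ℝ} (hD : SqSum Φ D) : SqSum (refl Φ) D := by
  refine ⟨hD.1, fun S ξ => ?_⟩
  have : ∀ η, 𝓕 (⇑(refl Φ)) η = 𝓕 (⇑Φ) (-η) := by
    intro η
    rw [Real.fourier_real_eq_integral_exp_smul, Real.fourier_real_eq_integral_exp_smul,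
      ← integral_neg_eq_self]
    congr 1; ext x
    rw [refl_apply]; simp
  simp only [this, ← mul_neg]
  exact hD.2 S (-ξ)

lemma ker_refl (Φ : 𝓢(ℝ, ℂ)) (t : ℝ) (k : ℤ) (x : ℝ) : ker (refl Φ) (-t) k x = ker Φ t k (-x) := by
  simp only [ker, refl_apply]; congr 2; ring

lemma tk_adj (Φ : 𝓢(ℝ, ℂ)) (t : ℝ) (k : ℤ) {f h : ℝ → ℂ} (hf : Integrable f) (hh : Integrable h) :
    ∫ x, tk Φ t k f x * h x = ∫ y, f y * tk (refl Φ) (-t) k h y := by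
  obtain ⟨M, hM⟩ := ker_bdd Φ t k
  have hc := ker_cont Φ t k
  simp only [tk]
  simp_rw [← integral_mul_const, ← integral_const_mul]
  rw [integral_integral_swap]
  · congr 1; ext y; congr 1; ext x
    rw [ker_refl, neg_sub]; ring
  · have := (hh.mul_prod hf).bdd_mul (c := M) (f := fun z : ℝ × ℝ => ker Φ t k (z.1 - z.2)) 
      (Continuous.aestronglyMeasurable (by fun_prop)) (Filter.Eventually.of_forall fun y => hM _)
    refine this.congr (Filter.Eventually.of_forall fun z => ?_)
    simp only [Function.uncurry]; ring

end PP
end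

section
open MeasureTheory
open scoped ENNReal FourierTransform SchwartzMap ContDiff ComplexConjugate

namespace PP

theorem sq_hi (Φ : 𝓢(ℝ, ℂ)) {D : ℝ} (hD : SqSum Φ D) (ε : ℝ) (h0 : 0 < ε) (h1 : ε ≤ 1) (p : ℝ) (hp2 : 2 < p) :
    ∃ C : ℝ, 0 ≤ C ∧ ∀ (t : ℝ) (S : Finset ℤ) (f : ℝ → ℂ), Continuous f → Integrable f →
    ∫⁻ x, (∑ k : S, ‖tk Φ t k f x‖ₑ ^ 2) ^ (p / 2) ≤ ENNReal.ofReal (C * (1 + |t|) ^ ε) * ∫⁻ x, ‖f x‖ₑ ^ p := by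
  have hpm : 0 < p - 1 := by linarith
  set q := p / (p - 1) with hq
  have hq1 : 1 < q := by rw [hq, lt_div_iff₀ hpm]; linarith
  have hq2 : q < 2 := by rw [hq, div_lt_iff₀ hpm]; linarith
  have hpq : p.HolderConjugate q := Real.HolderConjugate.conjExponent (by linarith)
  obtain ⟨C, hC, H⟩ := dual_lo (refl Φ) (refl_sq hD) (ε / (p - 1)) (by positivity)
    (by rw [div_le_one hpm]; linarith) q hq1 hq2
  refine ⟨C ^ (p - 1), by positivity, fun t S f hf hfi => ?_⟩
  set v : ℝ → EuclideanSpace ℂ S := fun x => WithLp.toLp 2 (fun k : S => tk Φ t k f x) with hv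
  have hvk : ∀ x k, v x k = tk Φ t k f x := fun x k => rfl
  have hvc : Continuous v := by
    have := fun k : S => tk_cont Φ t k hfi
    fun_prop
  choose M hM using fun k : S => tk_bdd Φ t k hfi
  have hvle : ∀ x, ‖v x‖ ≤ ∑ k : S, ‖tk Φ t k f x‖ := by
    intro x
    have : v x = ∑ k : S, EuclideanSpace.single k (tk Φ t k f x) := by
      ext k; simp [hvk, Pi.single_apply]
    rw [this]
    refine (norm_sum_le _ _).trans (le_of_eq ?_)
    simp
  have hvi : Integrable v := by
    refine (integrable_finsetSum Finset.univ (fun (k : S) _ => (tk_int Φ t k hfi).norm)).mono'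
      hvc.aestronglyMeasurable (Filter.Eventually.of_forall hvle)
  set B := ∑ k : S, M k with hB
  have hvB : ∀ x, ‖v x‖ ≤ B := fun x => (hvle x).trans (Finset.sum_le_sum fun k _ => hM k x)
  set h : ℝ → EuclideanSpace ℂ S := fun x => WithLp.toLp 2 (fun k : S =>
    ((‖v x‖ ^ (p - 2) : ℝ) : ℂ) * conj (tk Φ t k f x)) with hh
  have hhk : ∀ x k, h x k = ((‖v x‖ ^ (p - 2) : ℝ) : ℂ) * conj (tk Φ t k f x) := fun x k => rfl
  have huc : Continuous (fun x => ‖v x‖ ^ (p - 2)) := 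
    hvc.norm.rpow_const (fun x => Or.inr (by linarith))
  have hhc : Continuous h := by
    have := fun k : S => tk_cont Φ t k hfi
    have h3 : Continuous (fun x => ((‖v x‖ ^ (p - 2) : ℝ) : ℂ)) := Complex.continuous_ofReal.comp huc
    apply (PiLp.continuous_toLp 2 _).comp
    apply continuous_pi
    intro k
    exact h3.mul (Complex.continuous_conj.comp (this k))
  have hpow : ∀ x, ‖v x‖ ^ (p - 2) * ‖v x‖ = ‖v x‖ ^ (p - 1) := by
    intro x
    rw [← Real.rpow_add_one' (norm_nonneg _) (by linarith)]; congr 1; ring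
  have hhn : ∀ x, ‖h x‖ = ‖v x‖ ^ (p - 1) := by
    intro x
    rw [← hpow, EuclideanSpace.norm_eq, EuclideanSpace.norm_eq (v x)]
    simp only [hhk, norm_mul, mul_pow, ← Finset.mul_sum, Complex.norm_real, RCLike.norm_conj, hvk]
    rw [Real.sqrt_mul (by positivity), Real.sqrt_sq (by positivity)]
    rw [Real.norm_of_nonneg (by positivity), EuclideanSpace.norm_eq (v x)]
  have hhi : Integrable h := by
    refine (hvi.norm.const_mul (B ^ (p - 2))).mono' hhc.aestronglyMeasurable (Filter.Eventually.of_forall fun x => ?_)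
    rw [hhn, ← hpow]
    gcongr
    exact hvB x
  have hpi : Integrable (fun x => ‖v x‖ ^ p) := by
    refine (hvi.norm.const_mul (B ^ (p - 1))).mono' 
      (hvc.norm.rpow_const (fun x => Or.inr (by linarith))).aestronglyMeasurable (Filter.Eventually.of_forall fun x => ?_)
    rw [Real.norm_of_nonneg (by positivity)]
    have : ‖v x‖ ^ p = ‖v x‖ ^ (p - 1) * ‖v x‖ := by
      rw [← Real.rpow_add_one' (norm_nonneg _) (by linarith)]; congr 1; ring
    rw [this]
    gcongr
    exact hvB x
  have hgoal : ∫⁻ x, (∑ k : S, ‖tk Φ t k f x‖ₑ ^ 2) ^ (p / 2) = ∫⁻ x, ‖v x‖ₑ ^ p := by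
    congr 1; ext x; rw [eu_rpow]
  rw [hgoal]
  have hconv : ∀ (z : EuclideanSpace ℂ S) (r : ℝ), 0 ≤ r → ‖z‖ₑ ^ r = ENNReal.ofReal (‖z‖ ^ r) := by
    intro z r hr
    rw [← ofReal_norm, ENNReal.ofReal_rpow_of_nonneg (norm_nonneg _) hr]
  set X := ∫⁻ x, ‖v x‖ₑ ^ p with hX
  have hXr : X = ENNReal.ofReal (∫ x, ‖v x‖ ^ p) := by
    rw [ofReal_integral_eq_lintegral_ofReal hpi (Filter.Eventually.of_forall fun x => by positivity), hX]
    congr 1; ext x; rw [hconv _ _ (by linarith)]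
  have hXt : X ≠ ⊤ := by rw [hXr]; exact ENNReal.ofReal_ne_top
  set W : ℝ → ℂ := fun y => ∑ k : S, tk (refl Φ) (-t) k (fun y => h y k) y with hW
  have hhki : ∀ k, Integrable (fun y => h y k) := fun k =>
    (EuclideanSpace.proj k : EuclideanSpace ℂ S →L[ℂ] ℂ).integrable_comp hhi
  have hid : ((∫ x, ‖v x‖ ^ p : ℝ) : ℂ) = ∫ y, f y * W y := by
    rw [← integral_complex_ofReal]
    have e1 : ∀ x, ((‖v x‖ ^ p : ℝ) : ℂ) = ∑ k : S, tk Φ t k f x * h x k := by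
      intro x
      have e2 : ∀ k : S, tk Φ t k f x * h x k = ((‖v x‖ ^ (p - 2) * ‖v x k‖ ^ 2 : ℝ) : ℂ) := by
        intro k
        rw [hhk, mul_left_comm, Complex.mul_conj, Complex.normSq_eq_norm_sq, hvk]; push_cast; rfl
      rw [Finset.sum_congr rfl (fun k _ => e2 k), ← Complex.ofReal_sum, ← Finset.mul_sum,
        ← EuclideanSpace.norm_sq_eq]
      congr 1
      rw [← Real.rpow_natCast, ← Real.rpow_add_of_nonneg (norm_nonneg _) (by linarith) (by norm_num)]
      congr 1; push_cast; ring
    simp_rw [e1]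
    rw [integral_finsetSum]
    · simp_rw [fun k : S => tk_adj Φ t k hfi (hhki k)]
      rw [← integral_finsetSum]
      · simp only [hW, Finset.mul_sum]
      · intro k _
        obtain ⟨M', hM'⟩ := tk_bdd (refl Φ) (-t) k (hhki k)
        exact hfi.mul_bdd (c := M') (tk_cont (refl Φ) (-t) k (hhki k)).aestronglyMeasurable 
          (Filter.Eventually.of_forall hM')
    · intro k _
      exact (hhki k).bdd_mul (c := M k) (tk_cont Φ t k hfi).aestronglyMeasurable 
          (Filter.Eventually.of_forall (hM k))
  have hWc : Continuous W := continuous_finsetSum _ fun k _ => tk_cont (refl Φ) (-t) k (hhki k)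
  have hW' := H (-t) S h hhc hhi
  have hhX : ∫⁻ x, ‖h x‖ₑ ^ q = X := by
    rw [hX]; congr 1; ext x
    rw [hconv _ _ (by linarith), hconv _ _ (by linarith), hhn, ← Real.rpow_mul (norm_nonneg _), hq]
    congr 2; field_simp
  rw [hhX, abs_neg] at hW'
  set c := ENNReal.ofReal (C * (1 + |t|) ^ (ε / (p - 1))) with hc
  set F := ∫⁻ x, ‖f x‖ₑ ^ p with hF
  have main : X ≤ F ^ (1 / p) * (c * X) ^ (1 / q) := by
    calc X = ‖((∫ x, ‖v x‖ ^ p : ℝ) : ℂ)‖ₑ := by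
          rw [hXr, ← ofReal_norm, Complex.norm_real, Real.norm_of_nonneg (integral_nonneg fun x => by positivity)]
      _ ≤ ∫⁻ y, ‖f y * W y‖ₑ := by rw [hid]; exact enorm_integral_le_lintegral_enorm _
      _ = ∫⁻ y, ((fun y => ‖f y‖ₑ) * fun y => ‖W y‖ₑ) y := by simp only [enorm_mul, Pi.mul_apply]
      _ ≤ F ^ (1 / p) * (∫⁻ y, ‖W y‖ₑ ^ q) ^ (1 / q) :=
          ENNReal.lintegral_mul_le_Lp_mul_Lq volume hpq (by fun_prop) (by fun_prop)
      _ ≤ _ := by gcongr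
  have hfin : X ≤ c ^ (p - 1) * F := by
    by_cases hX0 : X = 0
    · rw [hX0]; exact zero_le
    have hXq0 : X ^ (1 / q) ≠ 0 := by simp [hX0, hXt]
    have hXqt : X ^ (1 / q) ≠ ⊤ := ENNReal.rpow_ne_top_of_nonneg (by positivity) hXt
    have hs : X = X ^ (1 / p) * X ^ (1 / q) := by
      rw [← ENNReal.rpow_add _ _ hX0 hXt, hpq.one_div_add_one_div, div_one, ENNReal.rpow_one]
    have h5 : X ^ (1 / p) * X ^ (1 / q) ≤ (F ^ (1 / p) * c ^ (1 / q)) * X ^ (1 / q) := by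
      rw [← hs, mul_assoc, ← ENNReal.mul_rpow_of_nonneg _ _ (by positivity)]
      exact main
    have h6 := (ENNReal.mul_le_mul_iff_left hXq0 hXqt).1 h5
    calc X = (X ^ (1 / p)) ^ p := by rw [← ENNReal.rpow_mul, one_div_mul_cancel (by linarith), ENNReal.rpow_one]
      _ ≤ (F ^ (1 / p) * c ^ (1 / q)) ^ p := by gcongr
      _ = _ := by
        rw [ENNReal.mul_rpow_of_nonneg _ _ (by linarith), ← ENNReal.rpow_mul, ← ENNReal.rpow_mul,
          one_div_mul_cancel (by linarith), ENNReal.rpow_one, mul_comm]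
        congr 2
        rw [hq]; field_simp
  refine hfin.trans (le_of_eq ?_)
  congr 1
  rw [hc, ENNReal.ofReal_rpow_of_nonneg (by positivity) hpm.le, Real.mul_rpow hC (by positivity),
    ← Real.rpow_mul (by positivity)]
  congr 3
  field_simp

theorem sq1 (Φ : 𝓢(ℝ, ℂ)) {D : ℝ} (hD : SqSum Φ D) (ε : ℝ) (h0 : 0 < ε) (h1 : ε ≤ 1) (p : ℝ) (hp : 1 < p) :
    ∃ C : ℝ, 0 ≤ C ∧ ∀ (t : ℝ) (S : Finset ℤ) (f : ℝ → ℂ), Continuous f → Integrable f →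
    (∃ b, ∀ x, ‖f x‖ ≤ b) →
    ∫⁻ x, (∑ k : S, ‖tk Φ t k f x‖ₑ ^ 2) ^ (p / 2) ≤ ENNReal.ofReal (C * (1 + |t|) ^ ε) * ∫⁻ x, ‖f x‖ₑ ^ p := by
  rcases lt_trichotomy p 2 with h | h | h
  · obtain ⟨C, hC, H⟩ := sq_lo Φ hD ε h0 h1 p hp h
    exact ⟨C, hC, fun t S f hf hfi _ => H t S f hf hfi⟩
  · refine ⟨D, hD.1, fun t S f hf hfi hb => ?_⟩
    obtain ⟨b, hb⟩ := hb
    have := sq_L2 Φ hD t S hfi hb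
    subst h
    simp only [ne_eq, OfNat.ofNat_ne_zero, not_false_eq_true, div_self, ENNReal.rpow_one, ENNReal.rpow_ofNat]
    refine this.trans ?_
    gcongr
    exact le_mul_of_one_le_right hD.1 (one_le_w h0 t)
  · obtain ⟨C, hC, H⟩ := sq_hi Φ hD ε h0 h1 p h
    exact ⟨C, hC, fun t S f hf hfi _ => H t S f hf hfi⟩

end PP
end

section
open MeasureTheory
open scoped ENNReal FourierTransform SchwartzMap ContDiff

namespace PP

lemma sch_decay {n : ℕ} (F : 𝓢(Fin n → ℝ, ℂ)) : ∃ C : ℝ, 0 ≤ C ∧ ∀ z (j : Fin n), ‖F z‖ ≤ C * (1 + (z j) ^ 2)⁻¹ := by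
  obtain ⟨C0, h0, H0⟩ := F.decay 0 0
  obtain ⟨C2, h2, H2⟩ := F.decay 2 0
  refine ⟨C0 + C2, by positivity, fun z j => ?_⟩
  rw [← div_eq_mul_inv, le_div_iff₀ (by positivity)]
  have a := H0 z
  have b := H2 z
  simp only [norm_iteratedFDeriv_zero, pow_zero, one_mul] at a b
  have c : (z j) ^ 2 ≤ ‖z‖ ^ 2 := by
    rw [← sq_abs]; gcongr; exact norm_le_pi_norm z j
  nlinarith [mul_le_mul_of_nonneg_right c (norm_nonneg (F z))]

lemma line_cont {n : ℕ} (F : 𝓢(Fin n → ℝ, ℂ)) (x : Fin n → ℝ) (j : Fin n) :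
    Continuous (fun s => F (Function.update x j s)) :=
  F.continuous.comp (continuous_const.update j continuous_id)

lemma line_int {n : ℕ} (F : 𝓢(Fin n → ℝ, ℂ)) (x : Fin n → ℝ) (j : Fin n) :
    Integrable (fun s => F (Function.update x j s)) := by
  obtain ⟨C, _, H⟩ := sch_decay F
  refine (integrable_inv_one_add_sq.const_mul C).mono' (line_cont F x j).aestronglyMeasurable
    (Filter.Eventually.of_forall fun s => ?_)
  simpa using H (Function.update x j s) j

lemma sch_bdd {n : ℕ} (F : 𝓢(Fin n → ℝ, ℂ)) : ∃ C : ℝ, 0 ≤ C ∧ ∀ z, ‖F z‖ ≤ C := by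
  obtain ⟨C0, h0, H0⟩ := F.decay 0 0
  exact ⟨C0, h0.le, fun z => by simpa using H0 z⟩

noncomputable def TK {n : ℕ} (Φ : ℝ → ℂ) (t : ℝ) (k : ℤ) (j : Fin n) (F : (Fin n → ℝ) → ℂ) (x : Fin n → ℝ) : ℂ :=
  tk Φ t k (fun s => F (Function.update x j s)) (x j)

lemma TK_update {n : ℕ} (Φ : ℝ → ℂ) (t : ℝ) (k : ℤ) (j : Fin n) (F : (Fin n → ℝ) → ℂ) (x : Fin n → ℝ) (s : ℝ) :
    TK Φ t k j F (Function.update x j s) = tk Φ t k (fun s => F (Function.update x j s)) s := by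
  simp [TK]

lemma TK_meas {n : ℕ} (Φ : 𝓢(ℝ, ℂ)) (t : ℝ) (k : ℤ) (j : Fin n) (F : 𝓢(Fin n → ℝ, ℂ)) :
    Measurable (TK Φ t k j F) := by
  have h : Continuous (fun z : (Fin n → ℝ) × ℝ => ker Φ t k (z.1 j - z.2) * F (Function.update z.1 j z.2)) := by
    have h1 := ker_cont Φ t k
    have h2 := F.continuous
    have h3 : Continuous (fun z : (Fin n → ℝ) × ℝ => Function.update z.1 j z.2) := continuous_fst.update j continuous_snd
    exact (h1.comp (by fun_prop)).mul (h2.comp h3)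
  exact (h.stronglyMeasurable.integral_prod_right (ν := volume)).measurable

lemma lift_le {n : ℕ} (j : Fin n) {G H : (Fin n → ℝ) → ℝ≥0∞} (hG : Measurable G) (hH : Measurable H) (c : ℝ≥0∞)
    (h : ∀ x, ∫⁻ s, G (Function.update x j s) ≤ c * ∫⁻ s, H (Function.update x j s)) :
    ∫⁻ x, G x ≤ c * ∫⁻ x, H x := by
  rw [← lintegral_const_mul _ hH]
  refine lintegral_le_of_lmarginal_le (μ := fun _ : Fin n => (volume : Measure ℝ)) {j} hG (hH.const_mul c) ?_
  rw [lmarginal_singleton, lmarginal_singleton]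
  intro x
  refine (h x).trans ?_
  beta_reduce
  rw [lintegral_const_mul]
  exact hH.comp (by fun_prop)

lemma root_bd {A B : ℝ≥0∞} {C w p : ℝ} (hC : 0 ≤ C) (hw : 1 ≤ w) (hp : 1 < p)
    (h : A ≤ ENNReal.ofReal (C * w) * B) : A ^ (1 / p) ≤ ENNReal.ofReal ((C + 1) * w) * B ^ (1 / p) := by
  have hp' : 0 ≤ 1 / p := by positivity
  calc A ^ (1 / p) ≤ (ENNReal.ofReal (C * w) * B) ^ (1 / p) := by gcongr
    _ = (ENNReal.ofReal (C * w)) ^ (1 / p) * B ^ (1 / p) := ENNReal.mul_rpow_of_nonneg _ _ hp'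
    _ ≤ (ENNReal.ofReal ((C + 1) * w)) ^ (1 / p) * B ^ (1 / p) := by gcongr; linarith
    _ ≤ _ := by
      gcongr
      have h1 : 1 ≤ ENNReal.ofReal ((C + 1) * w) := by
        rw [ENNReal.one_le_ofReal]; nlinarith
      calc _ ≤ (ENNReal.ofReal ((C + 1) * w)) ^ (1:ℝ) := by
            apply ENNReal.rpow_le_rpow_of_exponent_le h1
            rw [div_le_one (by linarith)]; exact hp.le
        _ = _ := ENNReal.rpow_one _

lemma eLp_en {n : ℕ} (u : (Fin n → ℝ) → ℝ≥0∞) {p : ℝ≥0∞} (h0 : 1 < p) (ht : p ≠ ⊤) :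
    eLpNorm u p volume = (∫⁻ x, u x ^ p.toReal) ^ (1 / p.toReal) := by
  rw [eLpNorm_eq_lintegral_rpow_enorm_toReal (by positivity) ht]; simp

lemma one_lt_tr {p : ℝ≥0∞} (h0 : 1 < p) (ht : p ≠ ⊤) : 1 < p.toReal := by
  rw [← ENNReal.toReal_one]; exact (ENNReal.toReal_lt_toReal (by simp) ht).2 h0

noncomputable def sqf {n : ℕ} (Φ : ℝ → ℂ) (t : ℝ) (S : Finset ℤ) (j : Fin n) (F : (Fin n → ℝ) → ℂ) (x : Fin n → ℝ) : ℝ≥0∞ :=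
  (∑ k : S, ‖TK Φ t k j F x‖ₑ ^ 2) ^ (1 / 2 : ℝ)

noncomputable def mxf {n : ℕ} (Φ : ℝ → ℂ) (t : ℝ) (S : Finset ℤ) (j : Fin n) (F : (Fin n → ℝ) → ℂ) (x : Fin n → ℝ) : ℝ≥0∞ :=
  S.sup fun k => ‖TK Φ t k j F x‖ₑ

lemma sqf_meas {n : ℕ} (Φ : 𝓢(ℝ, ℂ)) (t : ℝ) (S : Finset ℤ) (j : Fin n) (F : 𝓢(Fin n → ℝ, ℂ)) :
    Measurable (sqf Φ t S j F) := by
  have := fun k => TK_meas Φ t k j F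
  unfold sqf; fun_prop

lemma mxf_meas {n : ℕ} (Φ : 𝓢(ℝ, ℂ)) (t : ℝ) (S : Finset ℤ) (j : Fin n) (F : 𝓢(Fin n → ℝ, ℂ)) :
    Measurable (mxf Φ t S j F) := by
  have := fun k => TK_meas Φ t k j F
  unfold mxf
  simp only [Finset.sup_eq_iSup]
  exact Measurable.iSup fun k => Measurable.iSup_Prop _ (this k).enorm

theorem sqN {n : ℕ} (j : Fin n) (Φ : 𝓢(ℝ, ℂ)) {D : ℝ} (hD : SqSum Φ D) (ε : ℝ) (h0 : 0 < ε) (h1 : ε ≤ 1) (p : ℝ≥0∞)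
    (hp : 1 < p) (hpt : p ≠ ⊤) :
    ∃ C : ℝ, 0 ≤ C ∧ ∀ (t : ℝ) (S : Finset ℤ) (F : 𝓢(Fin n → ℝ, ℂ)),
    eLpNorm (sqf Φ t S j F) p volume ≤ ENNReal.ofReal (C * (1 + |t|) ^ ε) * eLpNorm F p volume := by
  have hp1 := one_lt_tr hp hpt
  obtain ⟨C, hC, H⟩ := sq1 Φ hD ε h0 h1 p.toReal hp1
  refine ⟨C + 1, by positivity, fun t S F => ?_⟩
  rw [eLp_en _ hp hpt, eLpNorm_eq_lintegral_rpow_enorm_toReal (by positivity) hpt]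
  refine root_bd hC (one_le_w h0 t) hp1 ?_
  refine lift_le j ((sqf_meas Φ t S j F).pow_const _) (by have := F.continuous.measurable; fun_prop) _ fun x => ?_
  refine le_trans (le_of_eq ?_) (H t S _ (line_cont F x j) (line_int F x j) ?_)
  · congr 1; ext s
    simp only [sqf, TK_update]
    rw [← ENNReal.rpow_mul]; congr 1; ring
  · obtain ⟨b, _, hb⟩ := sch_bdd F
    exact ⟨b, fun s => hb _⟩

lemma sup_le_top {n : ℕ} (F : 𝓢(Fin n → ℝ, ℂ)) (z : Fin n → ℝ) : ‖F z‖ₑ ≤ eLpNorm F ⊤ volume := by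
  by_contra h
  push Not at h
  have ho : IsOpen {z | eLpNorm F ⊤ volume < ‖F z‖ₑ} := isOpen_lt continuous_const F.continuous.enorm
  have h2 : volume {z | eLpNorm F ⊤ volume < ‖F z‖ₑ} = 0 := by
    have := enorm_ae_le_eLpNormEssSup (F : (Fin n → ℝ) → ℂ) volume
    rw [← eLpNorm_exponent_top, ae_iff] at this
    simpa using this
  exact (ho.measure_pos volume ⟨z, h⟩).ne' h2

theorem mxN {n : ℕ} (j : Fin n) (Φ : 𝓢(ℝ, ℂ)) (ε : ℝ) (h0 : 0 < ε) (h1 : ε ≤ 1) (p : ℝ≥0∞) (hp : 1 < p) :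
    ∃ C : ℝ, 0 ≤ C ∧ ∀ (t : ℝ) (S : Finset ℤ) (F : 𝓢(Fin n → ℝ, ℂ)),
    eLpNorm (mxf Φ t S j F) p volume ≤ ENNReal.ofReal (C * (1 + |t|) ^ ε) * eLpNorm F p volume := by
  by_cases hpt : p = ⊤
  · subst hpt
    set V := (∫⁻ x, ‖Φ x‖ₑ).toReal with hV
    refine ⟨V, by positivity, fun t S F => ?_⟩
    rw [eLpNorm_exponent_top]
    refine essSup_le_of_ae_le _ (Filter.Eventually.of_forall fun x => ?_)
    simp only [enorm_eq_self, mxf]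
    refine Finset.sup_le fun k _ => ?_
    have hfin : eLpNorm F ⊤ volume ≠ ⊤ := (F.memLp ⊤ volume).2.ne
    have := tk_sup Φ t k (f := fun s => F (Function.update x j s)) (b := (eLpNorm F ⊤ volume).toReal)
      (Filter.Eventually.of_forall fun s => by
        have := ENNReal.toReal_mono hfin (sup_le_top F (Function.update x j s))
        simpa using this) (by positivity) (x j)
    change ‖tk Φ t k (fun s => F (Function.update x j s)) (x j)‖ₑ ≤ _
    rw [← ofReal_norm]
    calc _ ≤ ENNReal.ofReal ((eLpNorm F ⊤ volume).toReal * V) := ENNReal.ofReal_le_ofReal this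
      _ = ENNReal.ofReal V * eLpNorm F ⊤ volume := by
        rw [mul_comm, ENNReal.ofReal_mul (by positivity), ENNReal.ofReal_toReal hfin]
      _ ≤ _ := by
        gcongr
        exact le_mul_of_one_le_right (by positivity) (one_le_w h0 t)
  · have hp1 := one_lt_tr hp hpt
    obtain ⟨C, hC, H⟩ := max1 Φ ε h0 h1 p.toReal hp1
    refine ⟨C + 1, by positivity, fun t S F => ?_⟩
    rw [eLp_en _ hp hpt, eLpNorm_eq_lintegral_rpow_enorm_toReal (by positivity) hpt]
    refine root_bd hC (one_le_w h0 t) hp1 ?_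
    refine lift_le j ((mxf_meas Φ t S j F).pow_const _) (by have := F.continuous.measurable; fun_prop) _ fun x => ?_
    refine le_trans (le_of_eq ?_) (H t S _ (line_cont F x j) (line_int F x j))
    congr 1; ext s
    simp only [mxf, TK_update]

theorem holder {n : ℕ} {ι : Type*} (s : Finset ι) (u : ι → (Fin n → ℝ) → ℝ≥0∞)
    (hu : ∀ i ∈ s, Measurable (u i)) (p : ι → ℝ≥0∞) (hp : ∀ i ∈ s, 1 < p i) (hs : ∑ i ∈ s, (p i)⁻¹ = 1) :
    ∫⁻ x, ∏ i ∈ s, u i x ≤ ∏ i ∈ s, eLpNorm (u i) (p i) volume := by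
  classical
  set A := s.filter (fun i => p i = ⊤) with hA
  set B := s.filter (fun i => ¬ p i = ⊤) with hB
  have hsp : ∀ f : ι → ℝ≥0∞, ∏ i ∈ s, f i = (∏ i ∈ A, f i) * ∏ i ∈ B, f i := fun f =>
    (Finset.prod_filter_mul_prod_filter_not s _ f).symm
  have hsumB : ∑ i ∈ B, (1 / (p i).toReal) = 1 := by
    have e : ∑ i ∈ B, (p i)⁻¹ = 1 := by
      rw [← hs, ← Finset.sum_filter_add_sum_filter_not s (fun i => p i = ⊤)]
      rw [Finset.sum_eq_zero (s := s.filter (fun i => p i = ⊤)), zero_add]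
      intro i hi; simp [(Finset.mem_filter.1 hi).2]
    have := congrArg ENNReal.toReal e
    rw [ENNReal.toReal_sum] at this
    · simpa [one_div] using this
    · intro i hi
      have := hp i (Finset.mem_filter.1 hi).1
      simp; rintro h; simp [h] at this
  have hae : ∀ᵐ x, ∀ i ∈ A, u i x ≤ eLpNorm (u i) (p i) volume := by
    rw [Finset.eventually_all]
    intro i hi
    rw [(Finset.mem_filter.1 hi).2, eLpNorm_exponent_top]
    simpa using enorm_ae_le_eLpNormEssSup (u i) volume
  calc ∫⁻ x, ∏ i ∈ s, u i x ≤ ∫⁻ x, (∏ i ∈ A, eLpNorm (u i) (p i) volume) *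
        ∏ i ∈ B, (u i x ^ (p i).toReal) ^ (1 / (p i).toReal) := by
        apply lintegral_mono_ae
        filter_upwards [hae] with x hx
        rw [hsp]
        refine mul_le_mul' (Finset.prod_le_prod' hx) (le_of_eq (Finset.prod_congr rfl fun i hi => ?_))
        have h := one_lt_tr (hp i (Finset.mem_filter.1 hi).1) (Finset.mem_filter.1 hi).2
        rw [← ENNReal.rpow_mul, mul_one_div_cancel (by linarith), ENNReal.rpow_one]
    _ = (∏ i ∈ A, eLpNorm (u i) (p i) volume) *
        ∫⁻ x, ∏ i ∈ B, (u i x ^ (p i).toReal) ^ (1 / (p i).toReal) := by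
        rw [lintegral_const_mul]
        exact Finset.measurable_prod _ fun i hi => ((hu i (Finset.mem_filter.1 hi).1).pow_const _).pow_const _
    _ ≤ (∏ i ∈ A, eLpNorm (u i) (p i) volume) * ∏ i ∈ B, (∫⁻ x, u i x ^ (p i).toReal) ^ (1 / (p i).toReal) := by
        gcongr
        exact ENNReal.lintegral_prod_norm_pow_le B
          (fun i hi => ((hu i (Finset.mem_filter.1 hi).1).pow_const _).aemeasurable) hsumB (fun i hi => by positivity)
    _ = _ := by
        rw [hsp]; congr 1
        refine Finset.prod_congr rfl fun i hi => ?_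
        rw [eLp_en _ (hp i (Finset.mem_filter.1 hi).1) (Finset.mem_filter.1 hi).2]

end PP
end

section
open MeasureTheory
open scoped ENNReal FourierTransform SchwartzMap ContDiff

namespace PP

noncomputable def ee (x : ℝ) : ℂ := Complex.exp (((2 * Real.pi * x : ℝ) : ℂ) * Complex.I)

lemma ee_add (x y : ℝ) : ee (x + y) = ee x * ee y := by
  unfold ee; rw [← Complex.exp_add]; congr 1; push_cast; ring

lemma ee_norm (x : ℝ) : ‖ee x‖ = 1 := Complex.norm_exp_ofReal_mul_I _

lemma ee_cont : Continuous ee := by unfold ee; fun_prop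

lemma ee_sum {ι : Type*} (s : Finset ι) (f : ι → ℝ) : ee (∑ i ∈ s, f i) = ∏ i ∈ s, ee (f i) := by
  unfold ee; rw [← Complex.exp_sum]; congr 1; rw [Finset.mul_sum, Complex.ofReal_sum, Finset.sum_mul]

lemma fourierT_ee {n : ℕ} (F : (Fin n → ℝ) → ℂ) (ξ : Fin n → ℝ) :
    fourierT n F ξ = ∫ x, ee (-∑ j, x j * ξ j) * F x := by
  unfold fourierT ee
  congr 1; ext x; congr 3; push_cast; ring

lemma FH {n : ℕ} (F : 𝓢(Fin n → ℝ, ℂ)) : ∃ G : 𝓢(Fin n → ℝ, ℂ), (∀ ξ, G ξ = fourierT n F ξ) ∧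
    ∀ x, F x = ∫ ξ, ee (∑ j, x j * ξ j) * G ξ := by
  let e := EuclideanSpace.equiv (Fin n) ℝ
  let F' : 𝓢(EuclideanSpace ℝ (Fin n), ℂ) := SchwartzMap.compCLMOfContinuousLinearEquiv ℂ e F
  let G : 𝓢(Fin n → ℝ, ℂ) := SchwartzMap.compCLMOfContinuousLinearEquiv ℂ e.symm (𝓕 F')
  have hvp := PiLp.volume_preserving_toLp (Fin n)
  have hme : MeasurableEmbedding (WithLp.toLp 2 : (Fin n → ℝ) → EuclideanSpace ℝ (Fin n)) :=
    (MeasurableEquiv.toLp 2 (Fin n → ℝ)).measurableEmbedding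
  refine ⟨G, fun ξ => ?_, fun x => ?_⟩
  · change (𝓕 F') (WithLp.toLp 2 ξ) = _
    rw [SchwartzMap.fourier_coe, Real.fourier_eq', ← hvp.integral_comp hme]
    unfold fourierT
    congr 1; ext x
    have hi : inner ℝ (WithLp.toLp 2 x : EuclideanSpace ℝ (Fin n)) (WithLp.toLp 2 ξ) = ∑ j, x j * ξ j := by
      simp [PiLp.inner_apply, mul_comm]
    rw [hi]; rfl
  · have h1 : F x = (𝓕⁻ (𝓕 F')) (WithLp.toLp 2 x) := by
      rw [FourierTransform.fourierInv_fourier_eq]; rfl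
    rw [h1, SchwartzMap.fourierInv_coe, Real.fourierInv_eq', ← hvp.integral_comp hme]
    congr 1

lemma TK_four {n : ℕ} (Φ : 𝓢(ℝ, ℂ)) (t : ℝ) (k : ℤ) (j : Fin n) (F G : 𝓢(Fin n → ℝ, ℂ))
    (hG : ∀ x, F x = ∫ ξ, ee (∑ j, x j * ξ j) * G ξ) (x : Fin n → ℝ) :
    TK Φ t k j F x = ∫ τ, (G τ * 𝓕 (ker Φ t k) (τ j)) * ee (∑ i, x i * τ i) := by
  have hsum : ∀ (y : ℝ) (τ : Fin n → ℝ), ∑ i, Function.update x j y i * τ i = ∑ i, x i * τ i + -((x j - y) * τ j) := by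
    intro y τ
    rw [← Finset.add_sum_erase _ _ (Finset.mem_univ j), ← Finset.add_sum_erase Finset.univ (fun i => x i * τ i) (Finset.mem_univ j)]
    rw [Finset.sum_congr rfl (g := fun i => x i * τ i)]
    · simp; ring
    · intro i hi; rw [Function.update_of_ne (Finset.ne_of_mem_erase hi)]
  have h1 : TK Φ t k j F x = ∫ y, ∫ τ, ee (∑ i, x i * τ i + -((x j - y) * τ j)) * (ker Φ t k (x j - y) * G τ) := by
    unfold TK tk
    congr 1; ext y
    beta_reduce
    rw [hG, ← integral_const_mul]
    congr 1; ext τ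
    rw [hsum]; ring
  rw [h1, integral_integral_swap]
  · congr 1; ext τ
    have h2 : ∀ y, ee (∑ i, x i * τ i + -((x j - y) * τ j)) * (ker Φ t k (x j - y) * G τ) =
      (G τ * ee (∑ i, x i * τ i)) * (fun u => ee (-(u * τ j)) * ker Φ t k u) (x j - y) := by
      intro y; rw [ee_add]; ring
    simp_rw [h2]
    rw [integral_const_mul, integral_sub_left_eq_self (fun u => ee (-(u * τ j)) * ker Φ t k u) volume (x j),
      Real.fourier_real_eq_integral_exp_smul]
    have h3 : ∀ u, ee (-(u * τ j)) * ker Φ t k u = Complex.exp (↑(-2 * Real.pi * u * τ j) * Complex.I) • ker Φ t k u := by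
      intro u; unfold ee; rw [smul_eq_mul]; congr 4; ring
    simp_rw [h3]; ring
  · have h4 : Integrable (fun z : ℝ × (Fin n → ℝ) => ker Φ t k (x j - z.1) * G z.2) (volume.prod volume) :=
      ((ker_int Φ t k).comp_sub_left (x j)).mul_prod G.integrable
    refine h4.bdd_mul (c := 1) (f := fun z : ℝ × (Fin n → ℝ) => ee (∑ i, x i * z.2 i + -((x j - z.1) * z.2 j))) ?_ ?_
    · exact (ee_cont.comp (by fun_prop)).aestronglyMeasurable
    · exact Filter.Eventually.of_forall fun z => (ee_norm _).le

theorem form_prod {n : ℕ} (Φ : Fin n → 𝓢(ℝ, ℂ)) (t : Fin n → ℝ) (k : ℤ) (F : ℕ → 𝓢(Fin n → ℝ, ℂ)) :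
    formM n (fun ξ => ∏ j, 𝓕 (ker (Φ j) (t j) k) (ξ j)) (fun j => ⇑(F j)) =
    ∫ x, F 0 x * ∏ j : Fin n, TK (Φ j) (t j) k j (F (j.1 + 1)) x := by
  choose G hG1 hG2 using fun i => FH (F i)
  set q : Fin n → (Fin n → ℝ) → ℂ := fun j τ => G (j.1 + 1) τ * 𝓕 (ker (Φ j) (t j) k) (τ j) with hq
  have hqi : ∀ j, Integrable (q j) := by
    intro j
    obtain ⟨M, hM⟩ : ∃ M, ∀ s, ‖𝓕 (ker (Φ j) (t j) k) s‖ ≤ M := by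
      refine ⟨∫ v, ‖ker (Φ j) (t j) k v‖, fun s => ?_⟩
      exact VectorFourier.norm_fourierIntegral_le_integral_norm _ _ _ _ _
    exact (G (j.1 + 1)).integrable.mul_bdd (c := M)
      ((four_cont (ker_int (Φ j) (t j) k)).comp (continuous_apply j)).aestronglyMeasurable
      (Filter.Eventually.of_forall fun τ => hM _)
  have h1 : ∀ x, F 0 x * ∏ j : Fin n, TK (Φ j) (t j) k j (F (j.1 + 1)) x =
      ∫ τ : Fin n → Fin n → ℝ, ee (∑ i, x i * (∑ j, τ j) i) * (F 0 x * ∏ j, q j (τ j)) := by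
    intro x
    simp_rw [fun j : Fin n => TK_four (Φ j) (t j) k j (F (j.1 + 1)) (G (j.1 + 1)) (hG2 _) x]
    rw [← integral_fintype_prod_volume_eq_prod, ← integral_const_mul]
    congr 1; ext τ
    rw [Finset.prod_mul_distrib, ← ee_sum, Finset.sum_comm]
    simp only [Finset.sum_apply, Finset.mul_sum]
    ring
  simp_rw [h1]
  rw [integral_integral_swap]
  · unfold formM
    congr 1; ext τ
    have h2 : ∀ x, ee (∑ i, x i * (∑ j, τ j) i) * (F 0 x * ∏ j, q j (τ j)) =
      (ee (-∑ i, x i * (-∑ j, τ j) i) * F 0 x) * ∏ j, q j (τ j) := by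
      intro x; simp only [Pi.neg_apply, mul_neg, Finset.sum_neg_distrib, neg_neg]; ring
    simp_rw [h2]
    rw [integral_mul_const, ← fourierT_ee, hq, Finset.prod_mul_distrib, ← mul_assoc]
    simp_rw [hG1]
  · have h4 : Integrable (fun z : (Fin n → ℝ) × (Fin n → Fin n → ℝ) => F 0 z.1 * ∏ j, q j (z.2 j)) (volume.prod volume) :=
      (F 0).integrable.mul_prod (Integrable.fintype_prod hqi)
    refine h4.bdd_mul (c := 1) (f := fun z : (Fin n → ℝ) × (Fin n → Fin n → ℝ) => ee (∑ i, z.1 i * (∑ j, z.2 j) i)) ?_ ?_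
    · exact (ee_cont.comp (by simp only [Finset.sum_apply]; fun_prop)).aestronglyMeasurable
    · exact Filter.Eventually.of_forall fun z => (ee_norm _).le

end PP
end

section
open MeasureTheory
open scoped ENNReal FourierTransform SchwartzMap ContDiff

namespace PP

lemma prod_two {n : ℕ} {M : Type*} [CommMonoid M] {j0 j1 : Fin n} (hne : j0 ≠ j1) (f : Fin n → M) :
    ∏ j, f j = f j0 * f j1 * ∏ j ∈ Finset.univ \ {j0, j1}, f j := by
  rw [← Finset.prod_sdiff (Finset.subset_univ {j0, j1}), Finset.prod_pair hne, mul_comm]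

theorem model {n : ℕ} {j0 j1 : Fin n} (hne : j0 ≠ j1) (Φ : Fin n → 𝓢(ℝ, ℂ)) {D : Fin n → ℝ}
    (hD0 : SqSum (Φ j0) (D j0)) (hD1 : SqSum (Φ j1) (D j1)) (ε : ℝ) (h0 : 0 < ε) (h1 : ε ≤ 1) (p : ℕ → ℝ≥0∞)
    (hp : ∀ i ≤ n, 1 < p i) (hp0 : p (j0.1 + 1) ≠ ⊤) (hp1 : p (j1.1 + 1) ≠ ⊤)
    (hs : ∑ i ∈ Finset.range (n + 1), (p i)⁻¹ = 1) :
    ∃ C : ℝ, 0 ≤ C ∧ ∀ (t : Fin n → ℝ) (S : Finset ℤ) (F : ℕ → 𝓢(Fin n → ℝ, ℂ)),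
    ‖∑ k ∈ S, formM n (fun ξ => ∏ j, 𝓕 (ker (Φ j) (t j) k) (ξ j)) (fun j => ⇑(F j))‖ ≤
      C * (∏ j, (1 + |t j|) ^ ε) * ∏ i ∈ Finset.range (n + 1), (eLpNorm (F i) (p i) volume).toReal := by
  classical
  have hC : ∀ j : Fin n, ∃ C : ℝ, 0 ≤ C ∧ ∀ (t : ℝ) (S : Finset ℤ) (F : 𝓢(Fin n → ℝ, ℂ)),
      eLpNorm (if j = j0 ∨ j = j1 then sqf (Φ j) t S j F else mxf (Φ j) t S j F) (p (j.1 + 1)) volume ≤ 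
      ENNReal.ofReal (C * (1 + |t|) ^ ε) * eLpNorm F (p (j.1 + 1)) volume := by
    intro j
    by_cases hj : j = j0 ∨ j = j1
    · simp only [hj, if_true]
      rcases hj with rfl | rfl
      · exact sqN j (Φ j) hD0 ε h0 h1 _ (hp _ (by omega)) hp0
      · exact sqN j (Φ j) hD1 ε h0 h1 _ (hp _ (by omega)) hp1
    · simp only [hj, if_false]
      exact mxN j (Φ j) ε h0 h1 _ (hp _ (by omega))
  choose C hC0 HC using hC
  refine ⟨∏ j, C j, Finset.prod_nonneg fun j _ => hC0 j, fun t S F => ?_⟩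
  set w : Fin n → (Fin n → ℝ) → ℝ≥0∞ := fun j => if j = j0 ∨ j = j1 then sqf (Φ j) (t j) S j (F (j.1 + 1)) else
    mxf (Φ j) (t j) S j (F (j.1 + 1)) with hw
  have hwm : ∀ j, Measurable (w j) := by
    intro j; simp only [hw]; split_ifs
    · exact sqf_meas _ _ _ _ _
    · exact mxf_meas _ _ _ _ _
  have hpt : ∀ x, ∑ k ∈ S, ∏ j : Fin n, ‖TK (Φ j) (t j) k j (F (j.1 + 1)) x‖ₑ ≤ ∏ j, w j x := by
    intro x
    rw [prod_two hne]
    have e0 : w j0 = sqf (Φ j0) (t j0) S j0 (F (j0.1 + 1)) := by simp [hw]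
    have e1 : w j1 = sqf (Φ j1) (t j1) S j1 (F (j1.1 + 1)) := by simp [hw]
    have e2 : ∀ j ∈ Finset.univ \ {j0, j1}, w j = mxf (Φ j) (t j) S j (F (j.1 + 1)) := by
      intro j hj; simp only [Finset.mem_sdiff, Finset.mem_univ, true_and, Finset.mem_insert, Finset.mem_singleton] at hj
      simp [hw, hj]
    calc _ ≤ ∑ k ∈ S, (‖TK (Φ j0) (t j0) k j0 (F (j0.1 + 1)) x‖ₑ * ‖TK (Φ j1) (t j1) k j1 (F (j1.1 + 1)) x‖ₑ) *
          ∏ j ∈ Finset.univ \ {j0, j1}, w j x := by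
          refine Finset.sum_le_sum fun k hk => ?_
          rw [prod_two hne]
          refine mul_le_mul' le_rfl (Finset.prod_le_prod' fun j hj => ?_)
          rw [e2 j hj]
          exact Finset.le_sup (f := fun k => ‖TK (Φ j) (t j) k j (F (j.1 + 1)) x‖ₑ) hk
      _ ≤ _ := by
          rw [← Finset.sum_mul]
          refine mul_le_mul' ?_ le_rfl
          rw [e0, e1, sqf, sqf, ← Finset.sum_coe_sort S]
          have := ENNReal.inner_le_Lp_mul_Lq Finset.univ
            (fun k : S => ‖TK (Φ j0) (t j0) k j0 (F (j0.1 + 1)) x‖ₑ)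
            (fun k : S => ‖TK (Φ j1) (t j1) k j1 (F (j1.1 + 1)) x‖ₑ) (p := 2) (q := 2) (by constructor <;> norm_num)
          simpa only [ENNReal.rpow_two] using this
  have hint : ‖∑ k ∈ S, formM n (fun ξ => ∏ j, 𝓕 (ker (Φ j) (t j) k) (ξ j)) (fun j => ⇑(F j))‖ₑ ≤
      ∫⁻ x, ‖F 0 x‖ₑ * ∏ j, w j x := by
    have hm : ∀ k, Measurable (fun x => ‖F 0 x‖ₑ * ∏ j : Fin n, ‖TK (Φ j) (t j) k j (F (j.1 + 1)) x‖ₑ) := by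
      intro k
      exact (F 0).continuous.measurable.enorm.mul (Finset.measurable_prod _ fun j _ => (TK_meas _ _ _ _ _).enorm)
    calc _ ≤ ∑ k ∈ S, ‖formM n (fun ξ => ∏ j, 𝓕 (ker (Φ j) (t j) k) (ξ j)) (fun j => ⇑(F j))‖ₑ := enorm_sum_le _ _
      _ ≤ ∑ k ∈ S, ∫⁻ x, ‖F 0 x‖ₑ * ∏ j : Fin n, ‖TK (Φ j) (t j) k j (F (j.1 + 1)) x‖ₑ := by
        refine Finset.sum_le_sum fun k hk => ?_
        rw [form_prod]
        refine (enorm_integral_le_lintegral_enorm _).trans (le_of_eq ?_)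
        congr 1; ext x
        rw [enorm_mul]; congr 1
        simp only [← ofReal_norm, norm_prod]
        rw [ENNReal.ofReal_prod_of_nonneg fun _ _ => norm_nonneg _]
      _ = ∫⁻ x, ∑ k ∈ S, ‖F 0 x‖ₑ * ∏ j : Fin n, ‖TK (Φ j) (t j) k j (F (j.1 + 1)) x‖ₑ :=
        (lintegral_finsetSum _ fun k _ => hm k).symm
      _ ≤ _ := by
        refine lintegral_mono fun x => ?_
        rw [← Finset.mul_sum]
        exact mul_le_mul' le_rfl (hpt x)
  have hhol := holder (Finset.univ : Finset (Option (Fin n))) (fun o => o.elim (fun x => ‖F 0 x‖ₑ) w)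
    (by rintro (_ | j) _
        · exact (F 0).continuous.measurable.enorm
        · exact hwm j) (fun o => o.elim (p 0) fun j => p (j.1 + 1))
    (by rintro (_ | j) _
        · exact hp 0 (by omega)
        · exact hp _ (by omega))
    (by rw [Fintype.sum_option, ← hs, Finset.sum_range_succ', Finset.sum_range, add_comm]; rfl)
  simp only [Fintype.prod_option, Option.elim] at hhol
  have hfin : ∀ i ≤ n, eLpNorm (F i) (p i) volume ≠ ⊤ := fun i _ => ((F i).memLp (p i) volume).2.ne
  have htot : ‖∑ k ∈ S, formM n (fun ξ => ∏ j, 𝓕 (ker (Φ j) (t j) k) (ξ j)) (fun j => ⇑(F j))‖ₑ ≤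
      ENNReal.ofReal ((∏ j, C j) * (∏ j, (1 + |t j|) ^ ε) * ∏ i ∈ Finset.range (n + 1), (eLpNorm (F i) (p i) volume).toReal) := by
    refine hint.trans (hhol.trans ?_)
    rw [← Finset.prod_mul_distrib, Finset.prod_range_succ', Finset.prod_range, ← mul_assoc, ← Finset.prod_mul_distrib,
      ENNReal.ofReal_mul (Finset.prod_nonneg fun j _ => by have := hC0 j; positivity), ENNReal.ofReal_toReal (hfin 0 (by omega)), mul_comm]
    rw [ENNReal.ofReal_prod_of_nonneg (fun j _ => by have := hC0 j; positivity)]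
    refine mul_le_mul' (Finset.prod_le_prod' fun j _ => ?_) (le_of_eq ?_)
    · rw [ENNReal.ofReal_mul (by have := hC0 j; positivity), ENNReal.ofReal_toReal (hfin _ (by omega))]
      exact HC j (t j) S (F (j.1 + 1))
    · exact eLpNorm_enorm _
  rw [← ofReal_norm] at htot
  refine (ENNReal.ofReal_le_ofReal_iff ?_).1 htot
  exact mul_nonneg (mul_nonneg (Finset.prod_nonneg fun j _ => hC0 j) (by positivity)) (by positivity)

end PP
end

section
open MeasureTheory
open scoped ENNReal FourierTransform SchwartzMap ContDiff

namespace PP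

lemma dyad {g : ℝ → ℂ} (hc : Continuous g) (hs : HasCompactSupport g) (h0 : (0:ℝ) ∉ tsupport g) :
    ∃ D : ℝ, 0 ≤ D ∧ ∀ (S : Finset ℤ) (x : ℝ), ∑ k ∈ S, ‖g ((2:ℝ) ^ (-k) * x)‖ ≤ D := by
  obtain ⟨M, hM⟩ := hs.exists_bound_of_continuous hc
  have hM0 : 0 ≤ M := (norm_nonneg _).trans (hM 0)
  obtain ⟨r, hr⟩ := hs.isCompact.isBounded.subset_closedBall 0
  obtain ⟨δ, hδ, hδ'⟩ := Metric.isOpen_iff.1 (isClosed_tsupport g).isOpen_compl 0 h0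
  obtain ⟨C, hC, HC⟩ := minsum 1 one_pos le_rfl
  have hK : ∀ x, 0 < |x| → ‖g x‖ ≤ M * (δ⁻¹ + |r|) * min |x| (|x|⁻¹) := by
    intro x hx
    by_cases hgx : g x = 0
    · rw [hgx, norm_zero]; positivity
    have hxt : x ∈ tsupport g := subset_tsupport _ hgx
    have h1 : |x| ≤ r := by simpa using hr hxt
    have h2 : δ ≤ |x| := by
      by_contra h
      push Not at h
      exact hδ' (by simpa using h) hxt
    have h3 : 1 ≤ (δ⁻¹ + |r|) * min |x| (|x|⁻¹) := by
      rcases min_choice |x| (|x|⁻¹) with h | h <;> rw [h]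
      · have : 1 ≤ δ⁻¹ * |x| := by rw [← div_eq_inv_mul, one_le_div hδ]; exact h2
        nlinarith [mul_nonneg (abs_nonneg r) hx.le]
      · have : 1 ≤ |r| * |x|⁻¹ := by
          rw [← div_eq_mul_inv, one_le_div hx]; exact h1.trans (le_abs_self r)
        have : 0 ≤ δ⁻¹ * |x|⁻¹ := by positivity
        nlinarith
    rw [mul_assoc]
    exact (hM x).trans (le_mul_of_one_le_right hM0 h3)
  refine ⟨M * (δ⁻¹ + |r|) * C, by positivity, fun S x => ?_⟩
  by_cases hx : x = 0
  · have : g 0 = 0 := by by_contra h; exact h0 (subset_tsupport _ h)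
    simp only [hx, mul_zero, this, norm_zero, Finset.sum_const_zero]; positivity
  have hx' : 0 < |x| := abs_pos.2 hx
  calc ∑ k ∈ S, ‖g ((2:ℝ) ^ (-k) * x)‖ ≤ ∑ k ∈ S, M * (δ⁻¹ + |r|) * min ((2:ℝ) ^ (-k) * |x|) (((2:ℝ) ^ (-k) * |x|) ^ (-1 : ℝ)) := by
        refine Finset.sum_le_sum fun k _ => ?_
        have h2 : |(2:ℝ) ^ (-k) * x| = (2:ℝ) ^ (-k) * |x| := by rw [abs_mul, abs_of_pos (by positivity)]
        have := hK ((2:ℝ) ^ (-k) * x) (by rw [h2]; positivity)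
        rw [Real.rpow_neg_one]
        rwa [h2] at this
    _ = M * (δ⁻¹ + |r|) * ∑ k ∈ S.map (Equiv.neg ℤ).toEmbedding, min ((2:ℝ) ^ k * |x|) (((2:ℝ) ^ k * |x|) ^ (-1 : ℝ)) := by
        rw [← Finset.mul_sum, Finset.sum_map]; rfl
    _ ≤ _ := by
        gcongr
        exact HC |x| hx' _

lemma cos_series {x : ℝ} (hx : |x| ≤ 1 / 2) :
    HasSum (fun n : ℕ => (-(1 / Real.pi ^ 2) * (1 / (n:ℝ) ^ 2) * (1 - (-1) ^ n)) * Real.cos (2 * Real.pi * (n * x))) (|x| - 1 / 4) := by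
  have hB : ∀ y : ℝ, Polynomial.eval y (Polynomial.map (algebraMap ℚ ℝ) (Polynomial.bernoulli 2)) = y ^ 2 - y + 1 / 6 := by
    intro y
    rw [Polynomial.bernoulli]
    simp only [Finset.sum_range_succ, Finset.sum_range_zero, Polynomial.map_add, Polynomial.map_monomial, Polynomial.eval_add, Polynomial.eval_monomial, Polynomial.map_zero, Polynomial.eval_zero]
    simp [bernoulli_one, bernoulli_two]
    ring
  have h1 := hasSum_one_div_nat_pow_mul_cos one_ne_zero (x := |x|) ⟨abs_nonneg x, by linarith⟩
  have h2 := hasSum_one_div_nat_pow_mul_cos one_ne_zero (x := |x| + 1 / 2) ⟨by positivity, by linarith⟩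
  simp only [mul_one, hB] at h1 h2
  have h3 := (h1.sub h2).mul_left (-(1 / Real.pi ^ 2))
  have ev : (-(1 / Real.pi ^ 2)) * ((-1) ^ (1 + 1) * (2 * Real.pi) ^ 2 / 2 / (2).factorial * (|x| ^ 2 - |x| + 1 / 6) - (-1) ^ (1 + 1) * (2 * Real.pi) ^ 2 / 2 / (2).factorial * ((|x| + 1 / 2) ^ 2 - (|x| + 1 / 2) + 1 / 6)) = |x| - 1 / 4 := by
    have := Real.pi_pos
    simp only [Nat.factorial]
    field_simp
    push_cast
    ring
  rw [ev] at h3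
  refine Eq.subst (motive := fun f : ℕ → ℝ => HasSum f (|x| - 1 / 4)) (funext fun n => ?_) h3
  symm
  have e2 : Real.cos (2 * Real.pi * n * |x|) = Real.cos (2 * Real.pi * (n * x)) := by
    rw [← Real.cos_abs (2 * Real.pi * (n * x))]; congr 1
    rw [abs_mul (2 * Real.pi), abs_mul (n:ℝ), abs_of_pos (by positivity : 0 < 2 * Real.pi), Nat.abs_cast]; ring
  have e1 : Real.cos (2 * Real.pi * n * (|x| + 1 / 2)) = (-1) ^ n * Real.cos (2 * Real.pi * (n * x)) := by
    rw [show 2 * Real.pi * n * (|x| + 1 / 2) = 2 * Real.pi * n * |x| + n * Real.pi by ring, Real.cos_add_nat_mul_pi, e2]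
  rw [e1, e2]; ring

lemma sign_meas : Measurable Real.sign := by
  unfold Real.sign
  exact Measurable.ite measurableSet_Iio measurable_const (Measurable.ite measurableSet_Ioi measurable_const measurable_const)

lemma sign_le (x : ℝ) : |Real.sign x| ≤ 1 := by
  rcases Real.sign_apply_eq x with h | h | h <;> rw [h] <;> norm_num

lemma sign_int (a s : ℝ) : ∫ β in Set.Icc (0:ℝ) 1, a * Real.sign (β * a + s) = |a + s| - |s| := by
  rw [integral_Icc_eq_integral_Ioc, ← intervalIntegral.integral_of_le zero_le_one]
  by_cases ha : a = 0
  · simp [ha]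
  rw [integral_eq_of_hasDerivAt_off_countable (fun β => |β * a + s|) _ (s := {-s / a}) (Set.countable_singleton _)]
  · simp
  · fun_prop
  · rintro β ⟨_, hβ⟩
    have hne : β * a + s ≠ 0 := by
      intro h; apply hβ; rw [Set.mem_singleton_iff, eq_div_iff ha]; linarith
    have h1 : HasDerivAt (fun β => β * a + s) a β := by
      simpa using ((hasDerivAt_id β).mul_const a).add_const s
    have h2 := (hasDerivAt_abs hne).comp β h1
    refine h2.congr_deriv ?_
    rw [mul_comm]; congr 1
    rcases lt_or_gt_of_ne hne with h | h
    · simp [Real.sign_of_neg h, sign_neg h]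
    · simp [Real.sign_of_pos h, sign_pos h]
  · refine (intervalIntegrable_const (c := |a|)).mono_fun ((sign_meas.comp (by fun_prop : Measurable fun β : ℝ => β * a + s)).const_mul a).aestronglyMeasurable (Filter.Eventually.of_forall fun β => ?_)
    beta_reduce
    rw [norm_mul, Real.norm_eq_abs, Real.norm_eq_abs, Real.norm_eq_abs, abs_abs]
    exact mul_le_of_le_one_right (abs_nonneg _) (sign_le _)

noncomputable def nu (m : ℕ) : Measure (Fin m → ℝ) := Measure.pi fun _ => volume.restrict (Set.Icc (0:ℝ) 1)

instance nu_prob (m : ℕ) : IsProbabilityMeasure (nu m) := by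
  have : IsProbabilityMeasure (volume.restrict (Set.Icc (0:ℝ) 1)) := ⟨by simp⟩
  unfold nu; infer_instance

lemma nu_ae (m : ℕ) : ∀ᵐ α ∂(nu m), ∀ i, α i ∈ Set.Icc (0:ℝ) 1 := by
  have : nu m = (volume : Measure (Fin m → ℝ)).restrict (Set.univ.pi fun _ => Set.Icc 0 1) := by
    unfold nu; rw [volume_pi, Measure.restrict_pi_pi]
  rw [this]
  filter_upwards [ae_restrict_mem (MeasurableSet.univ_pi fun _ => measurableSet_Icc)] with α hα i
  exact hα i trivial

noncomputable def lin {m : ℕ} (α : Fin m → ℝ) (ξ : Fin (m + 1) → ℝ) : ℝ :=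
  (∑ j : Fin m, α j * ξ j.castSucc) + ξ (Fin.last m)

lemma mu_eq (m : ℕ) (ξ : Fin (m + 1) → ℝ) : muSymbol m ξ = ∫ α, Real.sign (lin α ξ) ∂(nu m) := by
  unfold muSymbol nu
  rw [volume_pi, Measure.restrict_pi_pi]; rfl

lemma fub {m : ℕ} (i : Fin (m + 1)) {f : (Fin (m + 1) → ℝ) → ℝ} (hf : Integrable f (nu (m + 1))) :
    ∫ α, f α ∂(nu (m + 1)) = ∫ α, (∫ β in Set.Icc (0:ℝ) 1, f (Function.update α i β)) ∂(nu (m + 1)) := by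
  have hprob : IsProbabilityMeasure (volume.restrict (Set.Icc (0:ℝ) 1)) := ⟨by simp⟩
  have mp := (measurePreserving_piFinSuccAbove (fun _ : Fin (m + 1) => volume.restrict (Set.Icc (0:ℝ) 1)) i).symm
  have e := fun g : (Fin (m + 1) → ℝ) → ℝ => mp.integral_comp' g
  have hs : ∀ z : ℝ × (Fin m → ℝ), (MeasurableEquiv.piFinSuccAbove (fun _ => ℝ) i).symm z = i.insertNth z.1 z.2 := fun z => rfl
  have hi : Integrable (fun z : ℝ × (Fin m → ℝ) => f (i.insertNth z.1 z.2))
      ((volume.restrict (Set.Icc (0:ℝ) 1)).prod (Measure.pi fun _ => volume.restrict (Set.Icc (0:ℝ) 1))) :=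
    (mp.integrable_comp_emb (MeasurableEquiv.measurableEmbedding _)).2 hf
  unfold nu
  rw [← e, ← e]
  simp only [hs, Fin.update_insertNth]
  rw [integral_prod_symm _ hi]
  rw [integral_fun_snd (fun y => ∫ β in Set.Icc (0:ℝ) 1, f (i.insertNth β y))]
  simp

lemma lin_cont (m : ℕ) : Continuous (fun z : (Fin m → ℝ) × (Fin (m + 1) → ℝ) => lin z.1 z.2) := by
  unfold lin; fun_prop

lemma lin_update {m : ℕ} (α : Fin m → ℝ) (i : Fin m) (β : ℝ) (ξ : Fin (m + 1) → ℝ) :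
    lin (Function.update α i β) ξ = β * ξ i.castSucc + lin (Function.update α i 0) ξ := by
  unfold lin
  rw [← Finset.add_sum_erase _ _ (Finset.mem_univ i),
    ← Finset.add_sum_erase Finset.univ (fun j : Fin m => Function.update α i 0 j * ξ j.castSucc) (Finset.mem_univ i)]
  rw [Finset.sum_congr rfl (g := fun j : Fin m => Function.update α i 0 j * ξ j.castSucc)]
  · simp; ring
  · intro j hj
    rw [Function.update_of_ne (Finset.ne_of_mem_erase hj), Function.update_of_ne (Finset.ne_of_mem_erase hj)]

lemma mu_rep {m : ℕ} (i : Fin (m + 1)) (ξ : Fin (m + 2) → ℝ) :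
    ξ i.castSucc * muSymbol (m + 1) ξ =
      ∫ α, (|lin (Function.update α i 1) ξ| - |lin (Function.update α i 0) ξ|) ∂(nu (m + 1)) := by
  rw [mu_eq, ← integral_const_mul, fub i]
  · congr 1; ext α
    rw [lin_update α i 1 ξ, one_mul, ← sign_int]
    congr 1; ext β
    rw [lin_update α i β ξ]
  · refine Integrable.of_bound (C := |ξ i.castSucc|) ?_ (Filter.Eventually.of_forall fun α => ?_)
    · have := sign_meas
      have h2 : Measurable (fun α : Fin (m + 1) → ℝ => lin α ξ) := by unfold lin; fun_prop
      exact (this.comp h2 |>.const_mul _).aestronglyMeasurable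
    · rw [norm_mul]; exact mul_le_of_le_one_right (norm_nonneg _) (sign_le _)

lemma mu_meas (m : ℕ) : Measurable (muSymbol m) := by
  have h : Measurable (fun z : (Fin (m + 1) → ℝ) × (Fin m → ℝ) => Real.sign (lin z.2 z.1)) :=
    sign_meas.comp ((lin_cont m).measurable.comp measurable_swap)
  have : muSymbol m = fun ξ => ∫ α, Real.sign (lin α ξ) ∂(nu m) := by ext ξ; exact mu_eq m ξ
  rw [this]
  exact (h.stronglyMeasurable.integral_prod_right (ν := nu m)).measurable

lemma mu_le (m : ℕ) (ξ : Fin (m + 1) → ℝ) : |muSymbol m ξ| ≤ 1 := by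
  rw [mu_eq, ← Real.norm_eq_abs]
  refine (norm_integral_le_of_norm_le_const (C := 1) (Filter.Eventually.of_forall fun α => sign_le _)).trans ?_
  simp

lemma mu_scale (m : ℕ) (c : ℝ) (hc : 0 < c) (ξ : Fin (m + 1) → ℝ) : muSymbol m (fun j => c * ξ j) = muSymbol m ξ := by
  rw [mu_eq, mu_eq]; congr 1; ext α
  have : lin α (fun j => c * ξ j) = c * lin α ξ := by
    unfold lin; rw [mul_add, Finset.mul_sum]; congr 1; refine Finset.sum_congr rfl fun j _ => by ring
  rw [this]
  rcases lt_trichotomy (lin α ξ) 0 with h | h | h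
  · rw [Real.sign_of_neg h, Real.sign_of_neg (mul_neg_of_pos_of_neg hc h)]
  · rw [h, mul_zero]
  · rw [Real.sign_of_pos h, Real.sign_of_pos (mul_pos hc h)]

end PP
end

section
open MeasureTheory
open scoped ENNReal FourierTransform SchwartzMap ContDiff

namespace PP

noncomputable def Wf (n : ℕ) (F : ℕ → (Fin n → ℝ) → ℂ) (τ : Fin n → Fin n → ℝ) : ℂ :=
  fourierT n (F 0) (-(∑ j, τ j)) * (∏ j : Fin n, fourierT n (F (j.1 + 1)) (τ j))

lemma Wf_int {n : ℕ} (F : ℕ → 𝓢(Fin n → ℝ, ℂ)) : Integrable (Wf n (fun j => ⇑(F j))) := by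
  choose G hG _ using fun j => FH (F j)
  have e : Wf n (fun j => ⇑(F j)) = fun τ => G 0 (-(∑ j, τ j)) * (∏ j : Fin n, G (j.1 + 1) (τ j)) := by
    ext τ; simp only [Wf, hG]
  rw [e]
  obtain ⟨M, _, hM⟩ := sch_bdd (G 0)
  refine Integrable.bdd_mul (c := M) ?_ ?_ (Filter.Eventually.of_forall fun τ => hM _)
  · exact Integrable.fintype_prod (f := fun (j : Fin n) x => G (j.1 + 1) x) (fun j => (G (j.1 + 1)).integrable)
  · exact ((G 0).continuous.comp (by fun_prop)).aestronglyMeasurable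

lemma formM_eq (n : ℕ) (m : (Fin n → ℝ) → ℂ) (F : ℕ → (Fin n → ℝ) → ℂ) :
    formM n m F = ∫ τ, Wf n F τ * m (fun j => τ j j) := rfl

lemma diag_meas {n : ℕ} : Measurable (fun τ : Fin n → Fin n → ℝ => fun j => τ j j) := by fun_prop

lemma formM_int {n : ℕ} (F : ℕ → 𝓢(Fin n → ℝ, ℂ)) {m : (Fin n → ℝ) → ℂ} (hm : Measurable m) {K : ℝ}
    (hK : ∀ ξ, ‖m ξ‖ ≤ K) : Integrable (fun τ => Wf n (fun j => ⇑(F j)) τ * m (fun j => τ j j)) :=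
  (Wf_int F).mul_bdd (c := K) (hm.comp diag_meas).aestronglyMeasurable (Filter.Eventually.of_forall fun τ => hK _)

lemma formM_sum {n : ℕ} (F : ℕ → 𝓢(Fin n → ℝ, ℂ)) {ι : Type*} (S : Finset ι) (m : ι → (Fin n → ℝ) → ℂ)
    (hm : ∀ i, Measurable (m i)) {K : ι → ℝ} (hK : ∀ i ξ, ‖m i ξ‖ ≤ K i) :
    formM n (fun ξ => ∑ i ∈ S, m i ξ) (fun j => ⇑(F j)) = ∑ i ∈ S, formM n (m i) (fun j => ⇑(F j)) := by
  simp only [formM_eq, Finset.mul_sum]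
  exact integral_finsetSum _ fun i _ => formM_int F (hm i) (hK i)

lemma formM_smul {n : ℕ} (F : ℕ → (Fin n → ℝ) → ℂ) (c : ℂ) (m : (Fin n → ℝ) → ℂ) :
    formM n (fun ξ => c * m ξ) F = c * formM n m F := by
  simp only [formM_eq]
  rw [← integral_const_mul]; congr 1; ext τ; ring

lemma formM_add {n : ℕ} (F : ℕ → 𝓢(Fin n → ℝ, ℂ)) {m m' : (Fin n → ℝ) → ℂ}
    (hm : Measurable m) (hm' : Measurable m') {K K' : ℝ} (hK : ∀ ξ, ‖m ξ‖ ≤ K) (hK' : ∀ ξ, ‖m' ξ‖ ≤ K') :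
    formM n (fun ξ => m ξ + m' ξ) (fun j => ⇑(F j)) = formM n m (fun j => ⇑(F j)) + formM n m' (fun j => ⇑(F j)) := by
  simp only [formM_eq]
  rw [← integral_add (formM_int F hm hK) (formM_int F hm' hK')]; congr 1; ext τ; ring

lemma formM_avg {n : ℕ} (F : ℕ → 𝓢(Fin n → ℝ, ℂ)) {A : Type*} [MeasurableSpace A] (ν : Measure A) [IsProbabilityMeasure ν]
    (q : A → (Fin n → ℝ) → ℂ) (hq : Measurable (fun z : A × (Fin n → ℝ) => q z.1 z.2)) {K : ℝ}
    (hK : ∀ᵐ α ∂ν, ∀ ξ, ‖q α ξ‖ ≤ K) {B : ℝ} (hB : ∀ᵐ α ∂ν, ‖formM n (q α) (fun j => ⇑(F j))‖ ≤ B) :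
    ‖formM n (fun ξ => ∫ α, q α ξ ∂ν) (fun j => ⇑(F j))‖ ≤ B := by
  have hi : Integrable (fun z : (Fin n → Fin n → ℝ) × A => Wf n (fun j => ⇑(F j)) z.1 * q z.2 (fun j => z.1 j j)) (volume.prod ν) := by
    refine ((Wf_int F).comp_fst ν).mul_bdd (c := K) ?_ ?_
    · exact (hq.comp (measurable_snd.prodMk (diag_meas.comp measurable_fst))).aestronglyMeasurable
    · have := (Measure.quasiMeasurePreserving_snd (μ := (volume : Measure (Fin n → Fin n → ℝ))) (ν := ν)).ae hK
      filter_upwards [this] with z hz using hz _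
  have e : formM n (fun ξ => ∫ α, q α ξ ∂ν) (fun j => ⇑(F j)) = ∫ α, formM n (q α) (fun j => ⇑(F j)) ∂ν := by
    simp only [formM_eq, ← integral_const_mul]
    exact integral_integral_swap hi
  rw [e]
  refine (norm_integral_le_of_norm_le_const hB).trans ?_
  simp

lemma formM_lim {n : ℕ} (F : ℕ → 𝓢(Fin n → ℝ, ℂ)) {ι : Type*} [Countable ι] (q : ι → (Fin n → ℝ) → ℂ) (m : (Fin n → ℝ) → ℂ)
    (hq : ∀ i, Measurable (q i)) {D : ℝ} (hD : ∀ (S : Finset ι) ξ, ∑ i ∈ S, ‖q i ξ‖ ≤ D)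
    (hm : ∀ ξ, HasSum (fun i => q i ξ) (m ξ)) {B : ℝ}
    (hB : ∀ S : Finset ι, ‖formM n (fun ξ => ∑ i ∈ S, q i ξ) (fun j => ⇑(F j))‖ ≤ B) :
    ‖formM n m (fun j => ⇑(F j))‖ ≤ B := by
  have ht : Filter.Tendsto (fun S : Finset ι => formM n (fun ξ => ∑ i ∈ S, q i ξ) (fun j => ⇑(F j))) Filter.atTop
      (nhds (formM n m (fun j => ⇑(F j)))) := by
    simp only [formM_eq]
    refine tendsto_integral_filter_of_dominated_convergence (fun τ => ‖Wf n (fun j => ⇑(F j)) τ‖ * D) ?_ ?_ ?_ ?_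
    · refine Filter.Eventually.of_forall fun S => ?_
      refine (Wf_int F).aestronglyMeasurable.mul ?_
      exact ((Finset.measurable_fun_sum S fun i _ => hq i).comp diag_meas).aestronglyMeasurable
    · refine Filter.Eventually.of_forall fun S => Filter.Eventually.of_forall fun τ => ?_
      rw [norm_mul]
      gcongr
      exact (norm_sum_le _ _).trans (hD S _)
    · exact (Wf_int F).norm.mul_const D
    · refine Filter.Eventually.of_forall fun τ => ?_
      exact Filter.Tendsto.const_mul _ (hm _)
  exact le_of_tendsto ht.norm (Filter.Eventually.of_forall hB)

lemma formM_ser {n : ℕ} (F : ℕ → 𝓢(Fin n → ℝ, ℂ)) (c : ℕ → ℂ) (q : ℕ → (Fin n → ℝ) → ℂ) (m : (Fin n → ℝ) → ℂ)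
    (hq : ∀ i, Measurable (q i)) {K : ℝ} (hK : ∀ i ξ, ‖q i ξ‖ ≤ K) (hc : Summable fun i => ‖c i‖)
    (hm : ∀ ξ, HasSum (fun i => c i * q i ξ) (m ξ)) {B : ℕ → ℝ}
    (hB : ∀ i, ‖formM n (q i) (fun j => ⇑(F j))‖ ≤ B i) (hs : Summable fun i => ‖c i‖ * B i) :
    ‖formM n m (fun j => ⇑(F j))‖ ≤ ∑' i, ‖c i‖ * B i := by
  have hK0 : 0 ≤ K := (norm_nonneg _).trans (hK 0 0)
  refine formM_lim F (fun i ξ => c i * q i ξ) m (fun i => (hq i).const_mul _) (D := (∑' i, ‖c i‖) * K) ?_ hm ?_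
  · intro S ξ
    calc ∑ i ∈ S, ‖c i * q i ξ‖ ≤ ∑ i ∈ S, ‖c i‖ * K := by
          refine Finset.sum_le_sum fun i _ => ?_
          rw [norm_mul]; gcongr; exact hK i ξ
      _ = (∑ i ∈ S, ‖c i‖) * K := by rw [Finset.sum_mul]
      _ ≤ _ := by
          gcongr
          exact hc.sum_le_tsum S (fun i _ => norm_nonneg _)
  · intro S
    rw [formM_sum F S (fun i ξ => c i * q i ξ) (fun i => (hq i).const_mul _) (K := fun i => ‖c i‖ * K) (fun i ξ => by
      rw [norm_mul]; gcongr; exact hK i ξ)]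
    simp only [formM_smul]
    refine (norm_sum_le _ _).trans ?_
    calc _ ≤ ∑ i ∈ S, ‖c i‖ * B i := by
          refine Finset.sum_le_sum fun i _ => ?_
          rw [norm_mul]; gcongr; exact hB i
      _ ≤ _ := hs.sum_le_tsum S (fun i _ => mul_nonneg (norm_nonneg _) ((norm_nonneg _).trans (hB i)))

end PP
end

section
open MeasureTheory
open scoped ENNReal FourierTransform SchwartzMap ContDiff

namespace PP

noncomputable def Pg {n : ℕ} (g : Fin n → ℝ → ℂ) (t ξ : Fin n → ℝ) : ℂ := ∏ j, (ee (t j * ξ j) * g j (ξ j))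

noncomputable def NF {n : ℕ} (p : ℕ → ℝ≥0∞) (F : ℕ → 𝓢(Fin n → ℝ, ℂ)) : ℝ :=
  ∏ i ∈ Finset.range (n + 1), (eLpNorm (F i) (p i) volume).toReal

lemma NF_nonneg {n : ℕ} (p : ℕ → ℝ≥0∞) (F : ℕ → 𝓢(Fin n → ℝ, ℂ)) : 0 ≤ NF p F :=
  Finset.prod_nonneg fun _ _ => ENNReal.toReal_nonneg

lemma Pg_cont {n : ℕ} (g : Fin n → 𝓢(ℝ, ℂ)) (t : Fin n → ℝ) : Continuous (Pg (fun j => ⇑(g j)) t) := by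
  have := ee_cont
  have := fun j => (g j).continuous
  unfold Pg; fun_prop

lemma Pg_eq {n : ℕ} (g : Fin n → ℝ → ℂ) (t ξ : Fin n → ℝ) :
    Pg g t ξ = ee (∑ j, t j * ξ j) * ∏ j, g j (ξ j) := by
  unfold Pg; rw [Finset.prod_mul_distrib, ee_sum]

lemma sch_bdd1 (g : 𝓢(ℝ, ℂ)) : ∃ M : ℝ, 0 ≤ M ∧ ∀ x, ‖g x‖ ≤ M := by
  obtain ⟨C, hC⟩ := g.decay 0 0
  exact ⟨C, hC.1.le, fun x => by simpa using hC.2 x⟩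

lemma g_bdd {n : ℕ} (g : Fin n → 𝓢(ℝ, ℂ)) : ∃ M : ℝ, 0 ≤ M ∧ ∀ ξ : Fin n → ℝ, ‖∏ j, g j (ξ j)‖ ≤ M := by
  choose M h0 hM using fun j => sch_bdd1 (g j)
  refine ⟨∏ j, M j, Finset.prod_nonneg fun j _ => h0 j, fun ξ => ?_⟩
  rw [norm_prod]
  exact Finset.prod_le_prod (fun j _ => norm_nonneg _) fun j _ => hM j _

lemma SqSum_of {g : 𝓢(ℝ, ℂ)} (hs : HasCompactSupport g) (h0 : (0:ℝ) ∉ tsupport g) :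
    ∃ D, SqSum (𝓕⁻ g : 𝓢(ℝ, ℂ)) D := by
  obtain ⟨D, hD0, hD⟩ := dyad g.continuous hs h0
  obtain ⟨M, hM0, hM⟩ := sch_bdd1 g
  have e : 𝓕 (⇑(𝓕⁻ g : 𝓢(ℝ, ℂ))) = ⇑g := by
    rw [← SchwartzMap.fourier_coe, FourierTransform.fourier_fourierInv_eq]
  refine ⟨M * D, by positivity, fun S ξ => ?_⟩
  rw [e]
  have : ∑ k ∈ S, ‖g ((2:ℝ) ^ (-(k:ℤ)) * ξ)‖ ^ 2 ≤ M * D := by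
    calc ∑ k ∈ S, ‖g ((2:ℝ) ^ (-(k:ℤ)) * ξ)‖ ^ 2 ≤ ∑ k ∈ S, M * ‖g ((2:ℝ) ^ (-(k:ℤ)) * ξ)‖ := by
          refine Finset.sum_le_sum fun k _ => ?_
          rw [sq]; gcongr; exact hM _
      _ ≤ _ := by
          rw [← Finset.mul_sum]; gcongr; exact hD S ξ
  rwa [← Finset.sum_coe_sort] at this

lemma modelg {n : ℕ} {j0 j1 : Fin n} (hne : j0 ≠ j1) (g : Fin n → 𝓢(ℝ, ℂ))
    (hs0 : HasCompactSupport (g j0)) (h0 : (0:ℝ) ∉ tsupport (g j0))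
    (hs1 : HasCompactSupport (g j1)) (h1 : (0:ℝ) ∉ tsupport (g j1))
    (ε : ℝ) (hε : 0 < ε) (hε1 : ε ≤ 1) (p : ℕ → ℝ≥0∞) (hp : ∀ i ≤ n, 1 < p i)
    (hp0 : p (j0.1 + 1) ≠ ⊤) (hp1 : p (j1.1 + 1) ≠ ⊤) (hs : ∑ i ∈ Finset.range (n + 1), (p i)⁻¹ = 1) :
    ∃ C : ℝ, 0 ≤ C ∧ ∀ (t : Fin n → ℝ) (S : Finset ℤ) (F : ℕ → 𝓢(Fin n → ℝ, ℂ)),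
      ‖formM n (fun ξ => ∑ k ∈ S, Pg (fun j => ⇑(g j)) t (fun j => (2:ℝ) ^ (-k) * ξ j)) (fun j => ⇑(F j))‖
        ≤ C * (∏ j, (1 + |t j|) ^ ε) * NF p F := by
  obtain ⟨D0, hD0⟩ := SqSum_of hs0 h0
  obtain ⟨D1, hD1⟩ := SqSum_of hs1 h1
  obtain ⟨C, hC, H⟩ := model hne (fun j => (𝓕⁻ (g j) : 𝓢(ℝ, ℂ))) (D := fun j => if j = j0 then D0 else D1)
    (by simpa using hD0) (by simpa [hne.symm] using hD1) ε hε hε1 p hp hp0 hp1 hs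
  refine ⟨C, hC, fun t S F => ?_⟩
  have h := H t S F
  have e : ∀ j, 𝓕 (⇑(𝓕⁻ (g j) : 𝓢(ℝ, ℂ))) = ⇑(g j) := fun j => by
    rw [← SchwartzMap.fourier_coe, FourierTransform.fourier_fourierInv_eq]
  obtain ⟨M, hM0, hM⟩ := g_bdd g
  rw [formM_sum F S (fun k ξ => Pg (fun j => ⇑(g j)) t (fun j => (2:ℝ) ^ (-k) * ξ j)) (K := fun _ => M)]
  · refine le_trans (le_of_eq ?_) h
    congr 2; ext k
    congr 1; ext ξ
    unfold Pg
    refine Finset.prod_congr rfl fun j _ => ?_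
    rw [four_ker, e, ee]
    congr 4; ring
  · intro k
    exact ((Pg_cont g t).comp (by fun_prop)).measurable
  · intro k ξ
    rw [Pg_eq, norm_mul, ee_norm, one_mul]; exact hM _

noncomputable def cc (i : ℕ) : ℝ := -(1 / Real.pi ^ 2) * (1 / (i:ℝ) ^ 2) * (1 - (-1) ^ i)

lemma cc_le (i : ℕ) : |cc i| ≤ 1 / (i:ℝ) ^ 2 := by
  unfold cc
  have h1 : |(1:ℝ) - (-1) ^ i| ≤ 2 := by
    rcases neg_one_pow_eq_or ℝ i with h | h <;> rw [h] <;> norm_num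
  have h2 : 1 / Real.pi ^ 2 * 2 ≤ 1 := by
    have := Real.pi_gt_three
    rw [div_mul_eq_mul_div, div_le_one (by positivity)]; nlinarith
  rw [abs_mul, abs_mul, abs_neg, abs_of_nonneg (by positivity : 0 ≤ 1 / Real.pi ^ 2), abs_of_nonneg (by positivity : (0:ℝ) ≤ 1 / (i:ℝ) ^ 2)]
  calc 1 / Real.pi ^ 2 * (1 / (i:ℝ) ^ 2) * |(1:ℝ) - (-1) ^ i| ≤ 1 / Real.pi ^ 2 * (1 / (i:ℝ) ^ 2) * 2 := by gcongr
    _ = (1 / Real.pi ^ 2 * 2) * (1 / (i:ℝ) ^ 2) := by ring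
    _ ≤ 1 * (1 / (i:ℝ) ^ 2) := by gcongr
    _ = _ := one_mul _

lemma cc_sum (y : ℝ) (hy : 0 < y) : Summable (fun i : ℕ => |cc i| * (1 + i * y) ^ (1 / 2 : ℝ)) := by
  have hs : Summable (fun i : ℕ => (1 + y) ^ (1 / 2 : ℝ) * (1 / (i:ℝ) ^ (3 / 2 : ℝ))) :=
    ((Real.summable_one_div_nat_rpow (p := 3 / 2)).2 (by norm_num)).mul_left _
  refine Summable.of_nonneg_of_le (fun i => by positivity) (fun i => ?_) hs
  by_cases hi : i = 0
  · subst hi; simp [cc]; 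
  have hi1 : (1:ℝ) ≤ i := by exact_mod_cast Nat.one_le_iff_ne_zero.2 hi
  have hi0 : (0:ℝ) < i := by linarith
  calc |cc i| * (1 + i * y) ^ (1 / 2 : ℝ) ≤ (1 / (i:ℝ) ^ 2) * (i * (1 + y)) ^ (1 / 2 : ℝ) := by
        gcongr
        · exact cc_le i
        · nlinarith
    _ = (1 + y) ^ (1 / 2 : ℝ) * (1 / (i:ℝ) ^ (3 / 2 : ℝ)) := by
        rw [Real.mul_rpow hi0.le (by positivity)]
        have : (i:ℝ) ^ 2 = (i:ℝ) ^ (3 / 2 : ℝ) * (i:ℝ) ^ (1 / 2 : ℝ) := by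
          rw [← Real.rpow_add hi0]; norm_num
        rw [this]
        field_simp

lemma cc_sum' : Summable (fun i : ℕ => |cc i|) := by
  refine Summable.of_nonneg_of_le (fun i => abs_nonneg _) (fun i => ?_) (cc_sum 1 one_pos)
  refine le_mul_of_one_le_right (abs_nonneg _) (Real.one_le_rpow ?_ (by norm_num))
  have : (0:ℝ) ≤ i := by positivity
  linarith

noncomputable def Hb {n : ℕ} (g : Fin n → ℝ → ℂ) (β ξ : Fin n → ℝ) : ℂ := ((|∑ j, β j * ξ j| : ℝ) : ℂ) * ∏ j, g j (ξ j)

end PP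
end

section
open MeasureTheory
open scoped ENNReal FourierTransform SchwartzMap ContDiff

namespace PP

lemma ee_cos (x : ℝ) : (1 / 2 : ℂ) * (ee x + ee (-x)) = ((Real.cos (2 * Real.pi * x) : ℝ) : ℂ) := by
  unfold ee
  rw [Complex.ofReal_cos, Complex.cos]
  rw [show ((2 * Real.pi * -x : ℝ) : ℂ) = -((2 * Real.pi * x : ℝ) : ℂ) by push_cast; ring]
  ring

lemma lin_le {n : ℕ} {β ξ : Fin n → ℝ} {r : ℝ} (hβ : ∀ j, |β j| ≤ 1) (hξ : ∀ j, |ξ j| ≤ r) :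
    |∑ j, β j * ξ j| ≤ n * r := by
  refine (Finset.abs_sum_le_sum_abs _ _).trans ?_
  calc ∑ j, |β j * ξ j| ≤ ∑ j : Fin n, r := by
        refine Finset.sum_le_sum fun j _ => ?_
        rw [abs_mul]
        exact (mul_le_of_le_one_left (abs_nonneg _) (hβ j)).trans (hξ j)
    _ = _ := by simp

lemma Hb_le {n : ℕ} (g : Fin n → ℝ → ℂ) {β ξ : Fin n → ℝ} {r M : ℝ} (hr : 0 ≤ r) (hβ : ∀ j, |β j| ≤ 1)
    (hg : ∀ j x, g j x ≠ 0 → |x| ≤ r) (hM : ∀ ξ : Fin n → ℝ, ‖∏ j, g j (ξ j)‖ ≤ M) :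
    ‖Hb g β ξ‖ ≤ n * r * M := by
  unfold Hb
  by_cases h : ∏ j, g j (ξ j) = 0
  · have : 0 ≤ M := (norm_nonneg _).trans (hM ξ)
    rw [h, mul_zero, norm_zero]; positivity
  · have h1 : ∀ j, |ξ j| ≤ r := fun j => hg j _ (Finset.prod_ne_zero_iff.1 h j (Finset.mem_univ _))
    rw [norm_mul, Complex.norm_real, Real.norm_eq_abs, abs_abs]
    have := lin_le hβ h1
    gcongr
    exact hM ξ

lemma Hb_series {n : ℕ} (g : Fin n → ℝ → ℂ) {β ξ : Fin n → ℝ} {R : ℝ} (hR : 0 < R)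
    (hlin : ∏ j, g j (ξ j) ≠ 0 → |∑ j, β j * ξ j| ≤ R) :
    HasSum (fun i : ℕ => ((2 * R * cc i : ℝ) : ℂ) * ((1 / 2 : ℂ) * (Pg g (fun j => i * (1 / (2 * R)) * β j) ξ + Pg g (fun j => -(i * (1 / (2 * R)) * β j)) ξ)))
      (Hb g β ξ + ((-(R / 2) : ℝ) : ℂ) * Pg g (fun _ => 0) ξ) := by
  have e1 : ∀ i : ℕ, (1 / 2 : ℂ) * (Pg g (fun j => i * (1 / (2 * R)) * β j) ξ + Pg g (fun j => -(i * (1 / (2 * R)) * β j)) ξ)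
      = ((Real.cos (2 * Real.pi * (i * ((∑ j, β j * ξ j) / (2 * R)))) : ℝ) : ℂ) * ∏ j, g j (ξ j) := by
    intro i
    rw [Pg_eq, Pg_eq, ← add_mul, ← mul_assoc, ← ee_cos]
    have h1 : ∑ j, i * (1 / (2 * R)) * β j * ξ j = i * ((∑ j, β j * ξ j) / (2 * R)) := by
      rw [Finset.sum_div, Finset.mul_sum]; refine Finset.sum_congr rfl fun j _ => by ring
    have h2 : ∑ j, -(i * (1 / (2 * R)) * β j) * ξ j = -(i * ((∑ j, β j * ξ j) / (2 * R))) := by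
      rw [← h1, ← Finset.sum_neg_distrib]; refine Finset.sum_congr rfl fun j _ => by ring
    rw [h1, h2]
  simp only [e1]
  have e2 : Pg g (fun _ => 0) ξ = ∏ j, g j (ξ j) := by
    rw [Pg_eq]; simp [ee]
  rw [e2, Hb]
  by_cases h : ∏ j, g j (ξ j) = 0
  · simp only [h, mul_zero, add_zero]; exact hasSum_zero
  have hx : |(∑ j, β j * ξ j) / (2 * R)| ≤ 1 / 2 := by
    rw [abs_div, abs_of_pos (by positivity : 0 < 2 * R), div_le_iff₀ (by positivity)]
    linarith [hlin h]
  have h3 := (cos_series hx).mul_left (2 * R)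
  have h4 := (Complex.hasSum_ofReal.2 h3).mul_right (∏ j, g j (ξ j))
  have e3 : 2 * R * (|(∑ j, β j * ξ j) / (2 * R)| - 1 / 4) = |∑ j, β j * ξ j| + -(R / 2) := by
    rw [abs_div, abs_of_pos (by positivity : 0 < 2 * R)]; field_simp; ring
  rw [e3, Complex.ofReal_add, add_mul] at h4
  refine Eq.subst (motive := fun f : ℕ → ℂ => HasSum f _) (funext fun i => ?_) h4
  unfold cc
  push_cast
  ring

lemma Hb_cont {n : ℕ} (g : Fin n → 𝓢(ℝ, ℂ)) : Continuous (fun z : (Fin n → ℝ) × (Fin n → ℝ) => Hb (fun j => ⇑(g j)) z.1 z.2) := by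
  have := fun j => (g j).continuous
  unfold Hb; fun_prop

lemma abs_bd {n : ℕ} (hn : 0 < n) (g : Fin n → 𝓢(ℝ, ℂ)) {r : ℝ} (hr : 0 < r) (hg : ∀ j x, g j x ≠ 0 → |x| ≤ r)
    (p : ℕ → ℝ≥0∞) {C ε : ℝ} (hC : 0 ≤ C) (hε : 0 < ε) (hεn : ε * n = 1 / 2)
    (HM : ∀ (t : Fin n → ℝ) (S : Finset ℤ) (F : ℕ → 𝓢(Fin n → ℝ, ℂ)),
      ‖formM n (fun ξ => ∑ k ∈ S, Pg (fun j => ⇑(g j)) t (fun j => (2:ℝ) ^ (-k) * ξ j)) (fun j => ⇑(F j))‖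
        ≤ C * (∏ j, (1 + |t j|) ^ ε) * NF p F) :
    ∃ B : ℝ, 0 ≤ B ∧ ∀ (β : Fin n → ℝ) (S : Finset ℤ) (F : ℕ → 𝓢(Fin n → ℝ, ℂ)), (∀ j, |β j| ≤ 1) →
      ‖formM n (fun ξ => ∑ k ∈ S, Hb (fun j => ⇑(g j)) β (fun j => (2:ℝ) ^ (-k) * ξ j)) (fun j => ⇑(F j))‖ ≤ B * NF p F := by
  set R : ℝ := n * r with hRdef
  have hn' : (0:ℝ) < n := by exact_mod_cast hn
  have hR : 0 < R := by positivity
  set y : ℝ := 1 / (2 * R) with hy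
  have hy0 : 0 < y := by positivity
  obtain ⟨M, hM0, hM⟩ := g_bdd g
  have hPm : ∀ (S : Finset ℤ) t, Measurable (fun ξ : Fin n → ℝ => ∑ k ∈ S, Pg (fun j => ⇑(g j)) t (fun j => (2:ℝ) ^ (-k) * ξ j)) := by
    intro S t
    have := Pg_cont g t
    exact (continuous_finsetSum _ fun k _ => this.comp (by fun_prop)).measurable
  have hPb : ∀ (S : Finset ℤ) t (ξ : Fin n → ℝ), ‖∑ k ∈ S, Pg (fun j => ⇑(g j)) t (fun j => (2:ℝ) ^ (-k) * ξ j)‖ ≤ S.card * M := by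
    intro S t ξ
    refine (norm_sum_le _ _).trans ?_
    rw [← nsmul_eq_mul]
    refine Finset.sum_le_card_nsmul _ _ _ fun k _ => ?_
    rw [Pg_eq, norm_mul, ee_norm, one_mul]; exact hM _
  have hsum := cc_sum y hy0
  refine ⟨(∑' i : ℕ, |cc i| * (1 + i * y) ^ (1 / 2 : ℝ)) * (2 * R * C) + R / 2 * C, ?_, fun β S F hβ => ?_⟩
  · have : 0 ≤ ∑' i : ℕ, |cc i| * (1 + i * y) ^ (1 / 2 : ℝ) := tsum_nonneg fun i => by positivity
    positivity
  set P := fun (t : Fin n → ℝ) (ξ : Fin n → ℝ) => ∑ k ∈ S, Pg (fun j => ⇑(g j)) t (fun j => (2:ℝ) ^ (-k) * ξ j) with hP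
  set Hs := fun (ξ : Fin n → ℝ) => ∑ k ∈ S, Hb (fun j => ⇑(g j)) β (fun j => (2:ℝ) ^ (-k) * ξ j) with hHs
  have hNF := NF_nonneg p F
  have hPB : ∀ t : Fin n → ℝ, ∀ i : ℕ, (∀ j, |t j| ≤ i * y) → ‖formM n (P t) (fun j => ⇑(F j))‖ ≤ C * (1 + i * y) ^ (1 / 2 : ℝ) * NF p F := by
    intro t i ht
    refine (HM t S F).trans ?_
    gcongr
    calc ∏ j, (1 + |t j|) ^ ε ≤ ∏ j : Fin n, (1 + i * y) ^ ε := by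
          refine Finset.prod_le_prod (fun j _ => by positivity) fun j _ => ?_
          have := ht j
          gcongr
      _ = _ := by
          rw [Finset.prod_const, Finset.card_univ, Fintype.card_fin, ← Real.rpow_mul_natCast (by positivity), hεn]
  have hser := formM_ser F (fun i => ((2 * R * cc i : ℝ) : ℂ))
    (fun i ξ => (1 / 2 : ℂ) * (P (fun j => i * y * β j) ξ + P (fun j => -(i * y * β j)) ξ))
    (fun ξ => Hs ξ + ((-(R / 2) : ℝ) : ℂ) * P (fun _ => 0) ξ)
    (fun i => ((hPm S _).add (hPm S _)).const_mul _) (K := S.card * M) ?_ ?_ ?_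
    (B := fun i => C * (1 + i * y) ^ (1 / 2 : ℝ) * NF p F) ?_ ?_
  · have hH : Hs = fun ξ => (Hs ξ + ((-(R / 2) : ℝ) : ℂ) * P (fun _ => 0) ξ) + ((R / 2 : ℝ) : ℂ) * P (fun _ => 0) ξ := by
      ext ξ; push_cast; ring
    have hHm : Measurable Hs := by
      have := Hb_cont g
      exact (continuous_finsetSum S fun (k : ℤ) _ => this.comp (by fun_prop : Continuous fun ξ : Fin n → ℝ => (β, fun j => (2:ℝ) ^ (-k) * ξ j))).measurable
    have hHb : ∀ ξ, ‖Hs ξ‖ ≤ S.card * (n * r * M) := by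
      intro ξ
      refine (norm_sum_le _ _).trans ?_
      rw [← nsmul_eq_mul]
      exact Finset.sum_le_card_nsmul _ _ _ fun k _ => Hb_le _ hr.le hβ hg hM
    rw [hH, formM_add F (m := fun ξ => Hs ξ + ((-(R / 2) : ℝ) : ℂ) * P (fun _ => 0) ξ) (m' := fun ξ => ((R / 2 : ℝ) : ℂ) * P (fun _ => 0) ξ) (hHm.add ((hPm S _).const_mul _)) ((hPm S _).const_mul _) (K := S.card * (n * r * M) + R / 2 * (S.card * M)) (K' := R / 2 * (S.card * M)), formM_smul]
    · refine (norm_add_le _ _).trans ?_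
      rw [add_mul]
      refine add_le_add (hser.trans (le_of_eq ?_)) ?_
      · rw [← tsum_mul_right, ← tsum_mul_right]
        refine tsum_congr fun i => ?_
        rw [Complex.norm_real, Real.norm_eq_abs, abs_mul, abs_of_pos (by positivity : 0 < 2 * R)]
        ring
      · rw [norm_mul, Complex.norm_real, Real.norm_eq_abs, abs_of_pos (by positivity : 0 < R / 2), mul_assoc]
        have := hPB (fun _ => 0) 0 (fun j => by simp)
        simp only [Nat.cast_zero, zero_mul, add_zero, Real.one_rpow, mul_one] at this
        gcongr
    · intro ξ
      refine (norm_add_le _ _).trans (add_le_add (hHb ξ) ?_)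
      rw [norm_mul, Complex.norm_real, Real.norm_eq_abs, abs_neg, abs_of_pos (by positivity : 0 < R / 2)]
      gcongr; exact hPb S _ ξ
    · intro ξ
      rw [norm_mul, Complex.norm_real, Real.norm_eq_abs, abs_of_pos (by positivity : 0 < R / 2)]
      gcongr; exact hPb S _ ξ
  · intro i ξ
    rw [norm_mul]
    have h1 := hPb S (fun j => i * y * β j) ξ
    have h2 := hPb S (fun j => -(i * y * β j)) ξ
    have h3 := norm_add_le (P (fun j => i * y * β j) ξ) (P (fun j => -(i * y * β j)) ξ)
    have h4 : ‖(1 / 2 : ℂ)‖ = 1 / 2 := by norm_num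
    rw [h4]
    simp only [hP] at h3 ⊢
    linarith
  · simp only [Complex.norm_real, Real.norm_eq_abs, abs_mul]
    exact cc_sum'.mul_left _
  · intro ξ
    have := hasSum_sum (s := S) fun k _ => Hb_series (fun j => ⇑(g j)) (β := β) (ξ := fun j => (2:ℝ) ^ (-k) * ξ j) hR
      (fun h => lin_le hβ fun j => hg j _ (Finset.prod_ne_zero_iff.1 h j (Finset.mem_univ _)))
    simp only [Finset.sum_add_distrib, ← Finset.mul_sum] at this
    exact this
  · intro i
    rw [formM_smul, formM_add F (hPm S _) (hPm S _) (hPb S _) (hPb S _), norm_mul]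
    have hb : ∀ j, |i * y * β j| ≤ i * y := fun j => by
      rw [abs_mul, abs_of_nonneg (by positivity : 0 ≤ i * y)]
      exact mul_le_of_le_one_right (by positivity) (hβ j)
    have h1 := hPB (fun j => i * y * β j) i hb
    have h2 := hPB (fun j => -(i * y * β j)) i (fun j => by rw [abs_neg]; exact hb j)
    have h3 := norm_add_le (formM n (P (fun j => i * y * β j)) (fun j => ⇑(F j))) (formM n (P (fun j => -(i * y * β j))) (fun j => ⇑(F j)))
    have h4 : ‖(1 / 2 : ℂ)‖ = 1 / 2 := by norm_num
    rw [h4]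
    linarith
  · refine (hsum.mul_left (2 * R * C * NF p F)).congr fun i => ?_
    rw [Complex.norm_real, Real.norm_eq_abs, abs_mul, abs_of_pos (by positivity : 0 < 2 * R)]
    ring

end PP
end

section
open MeasureTheory
open scoped ENNReal FourierTransform SchwartzMap ContDiff

namespace PP

def sn {m : ℕ} (i : Fin (m + 1)) (b : ℝ) (α : Fin (m + 1) → ℝ) : Fin (m + 2) → ℝ :=
  Fin.snoc (α := fun _ => ℝ) (Function.update α i b) 1

lemma sn_last {m : ℕ} (i : Fin (m + 1)) (b : ℝ) (α : Fin (m + 1) → ℝ) : sn i b α (Fin.last _) = 1 := by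
  simp [sn]

lemma sn_cast {m : ℕ} (i : Fin (m + 1)) (b : ℝ) (α : Fin (m + 1) → ℝ) (j : Fin (m + 1)) :
    sn i b α j.castSucc = Function.update α i b j := by
  simp [sn]

lemma sn_cont {m : ℕ} (i : Fin (m + 1)) (b : ℝ) : Continuous (sn i b) := by
  refine continuous_pi fun j => ?_
  induction j using Fin.lastCases with
  | last => simp only [sn_last]; exact continuous_const
  | cast j =>
    simp only [sn_cast]
    exact (continuous_apply j).comp (continuous_id.update i continuous_const)

lemma sn_lin {m : ℕ} (i : Fin (m + 1)) (b : ℝ) (α : Fin (m + 1) → ℝ) (ξ : Fin (m + 2) → ℝ) :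
    ∑ j, sn i b α j * ξ j = lin (Function.update α i b) ξ := by
  rw [Fin.sum_univ_castSucc, lin]
  simp only [sn_last, sn_cast, one_mul]

lemma sn_le {m : ℕ} (i : Fin (m + 1)) {b : ℝ} (hb : |b| ≤ 1) {α : Fin (m + 1) → ℝ} (hα : ∀ j, α j ∈ Set.Icc (0:ℝ) 1)
    (j : Fin (m + 2)) : |sn i b α j| ≤ 1 := by
  induction j using Fin.lastCases with
  | last => simp [sn_last]
  | cast j =>
    rw [sn_cast]
    by_cases h : j = i
    · subst h; simpa using hb
    · rw [Function.update_of_ne h, abs_of_nonneg (hα j).1]; exact (hα j).2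

set_option maxHeartbeats 1000000 in
lemma avg_bd {m : ℕ} (i : Fin (m + 1)) (g : Fin (m + 2) → 𝓢(ℝ, ℂ)) {r : ℝ} (hr : 0 < r) (hg : ∀ j x, g j x ≠ 0 → |x| ≤ r)
    (p : ℕ → ℝ≥0∞) {B : ℝ}
    (HB : ∀ (β : Fin (m + 2) → ℝ) (S : Finset ℤ) (F : ℕ → 𝓢(Fin (m + 2) → ℝ, ℂ)), (∀ j, |β j| ≤ 1) →
      ‖formM (m + 2) (fun ξ => ∑ k ∈ S, Hb (fun j => ⇑(g j)) β (fun j => (2:ℝ) ^ (-k) * ξ j)) (fun j => ⇑(F j))‖ ≤ B * NF p F)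
    (S : Finset ℤ) (F : ℕ → 𝓢(Fin (m + 2) → ℝ, ℂ)) :
    ‖formM (m + 2) (fun ξ => ∑ k ∈ S, (((((2:ℝ) ^ (-k) * ξ i.castSucc) * muSymbol (m + 1) (fun j => (2:ℝ) ^ (-k) * ξ j) : ℝ) : ℂ)
      * ∏ j, g j ((2:ℝ) ^ (-k) * ξ j))) (fun j => ⇑(F j))‖ ≤ 2 * B * NF p F := by
  obtain ⟨M, hM0, hM⟩ := g_bdd g
  set gg : Fin (m + 2) → ℝ → ℂ := fun j => ⇑(g j) with hgg
  have hc : ∀ b, Continuous (fun z : (Fin (m + 1) → ℝ) × (Fin (m + 2) → ℝ) => Hb gg (sn i b z.1) z.2) := fun b =>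
    (Hb_cont g).comp (((sn_cont i b).comp continuous_fst).prodMk continuous_snd)
  have hcS : ∀ b, Continuous (fun z : (Fin (m + 1) → ℝ) × (Fin (m + 2) → ℝ) => ∑ k ∈ S, Hb gg (sn i b z.1) (fun j => (2:ℝ) ^ (-k) * z.2 j)) := fun b =>
    continuous_finsetSum S fun (k : ℤ) _ => (hc b).comp (by fun_prop : Continuous fun z : (Fin (m + 1) → ℝ) × (Fin (m + 2) → ℝ) => (z.1, fun j => (2:ℝ) ^ (-k) * z.2 j))
  have h1 : |(1:ℝ)| ≤ 1 := by simp
  have h0 : |(0:ℝ)| ≤ 1 := by simp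
  have hb : ∀ b : ℝ, |b| ≤ 1 → ∀ᵐ α ∂(nu (m + 1)), ∀ ξ, ‖Hb gg (sn i b α) ξ‖ ≤ ((m + 2 : ℕ) : ℝ) * r * M := by
    intro b hb
    filter_upwards [nu_ae (m + 1)] with α hα ξ
    exact Hb_le gg hr.le (sn_le i hb hα) hg hM
  have hI : ∀ b : ℝ, |b| ≤ 1 → ∀ ξ, Integrable (fun α => Hb gg (sn i b α) ξ) (nu (m + 1)) := by
    intro b hb' ξ
    refine Integrable.of_bound (C := ((m + 2 : ℕ) : ℝ) * r * M) ?_ ?_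
    · exact ((hc b).comp (by fun_prop : Continuous fun α : Fin (m + 1) → ℝ => (α, ξ))).aestronglyMeasurable
    · filter_upwards [hb b hb'] with α hα using hα ξ
  have e : ∀ ξ : Fin (m + 2) → ℝ, ∫ α, (Hb gg (sn i 1 α) ξ - Hb gg (sn i 0 α) ξ) ∂(nu (m + 1)) =
      ((ξ i.castSucc * muSymbol (m + 1) ξ : ℝ) : ℂ) * ∏ j, g j (ξ j) := by
    intro ξ
    rw [mu_rep, ← integral_complex_ofReal, ← integral_mul_const]
    congr 1; ext α
    unfold Hb
    rw [sn_lin, sn_lin]; push_cast; ring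
  have e2 : (fun ξ : Fin (m + 2) → ℝ => ∑ k ∈ S, (((((2:ℝ) ^ (-k) * ξ i.castSucc) * muSymbol (m + 1) (fun j => (2:ℝ) ^ (-k) * ξ j) : ℝ) : ℂ)
      * ∏ j, g j ((2:ℝ) ^ (-k) * ξ j))) = fun ξ => ∫ α, ((∑ k ∈ S, Hb gg (sn i 1 α) (fun j => (2:ℝ) ^ (-k) * ξ j)) + (-1) * ∑ k ∈ S, Hb gg (sn i 0 α) (fun j => (2:ℝ) ^ (-k) * ξ j)) ∂(nu (m + 1)) := by
    ext ξ
    simp only [neg_one_mul, ← sub_eq_add_neg, ← Finset.sum_sub_distrib]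
    rw [integral_finsetSum]
    · refine Finset.sum_congr rfl fun k _ => ?_
      rw [e]
    · exact fun k _ => (hI 1 h1 _).sub (hI 0 h0 _)
  have hbS : ∀ b : ℝ, |b| ≤ 1 → ∀ᵐ α ∂(nu (m + 1)), ∀ ξ : Fin (m + 2) → ℝ, ‖∑ k ∈ S, Hb gg (sn i b α) (fun j => (2:ℝ) ^ (-k) * ξ j)‖ ≤ S.card * (((m + 2 : ℕ) : ℝ) * r * M) := by
    intro b hb'
    filter_upwards [hb b hb'] with α hα ξ
    refine (norm_sum_le _ _).trans ?_
    rw [← nsmul_eq_mul]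
    exact Finset.sum_le_card_nsmul _ _ _ fun k _ => hα _
  rw [e2]
  have hm : ∀ b α, Measurable fun ξ : Fin (m + 2) → ℝ => ∑ k ∈ S, Hb gg (sn i b α) (fun j => (2:ℝ) ^ (-k) * ξ j) := fun b α =>
    ((hcS b).comp (by fun_prop : Continuous fun ξ : Fin (m + 2) → ℝ => (α, ξ))).measurable
  refine formM_avg F (nu (m + 1)) (fun α ξ => (∑ k ∈ S, Hb gg (sn i 1 α) (fun j => (2:ℝ) ^ (-k) * ξ j)) + (-1) * ∑ k ∈ S, Hb gg (sn i 0 α) (fun j => (2:ℝ) ^ (-k) * ξ j))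
    ((hcS 1).add ((hcS 0).const_mul _)).measurable (K := S.card * (((m + 2 : ℕ) : ℝ) * r * M) + S.card * (((m + 2 : ℕ) : ℝ) * r * M)) ?_ ?_
  · filter_upwards [hbS 1 h1, hbS 0 h0] with α a1 a0 ξ
    refine (norm_add_le _ _).trans (add_le_add (a1 ξ) ?_)
    rw [neg_one_mul, norm_neg]; exact a0 ξ
  · filter_upwards [nu_ae (m + 1), hbS 1 h1, hbS 0 h0] with α hα a1 a0
    rw [formM_add F (m := fun ξ => ∑ k ∈ S, Hb gg (sn i 1 α) (fun j => (2:ℝ) ^ (-k) * ξ j)) (m' := fun ξ => (-1) * ∑ k ∈ S, Hb gg (sn i 0 α) (fun j => (2:ℝ) ^ (-k) * ξ j))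
      (hm 1 α) ((hm 0 α).const_mul _) a1 (fun ξ => by rw [neg_one_mul, norm_neg]; exact a0 ξ), formM_smul]
    refine (norm_add_le _ _).trans ?_
    rw [neg_one_mul, norm_neg]
    linarith [HB (sn i 1 α) S F (sn_le i h1 hα), HB (sn i 0 α) S F (sn_le i h0 hα)]

lemma toS {f : ℝ → ℝ} (hf : ContDiff ℝ ∞ f) (hs : HasCompactSupport f) :
    ∃ G : 𝓢(ℝ, ℂ), ∀ x, G x = (f x : ℂ) := by
  have h1 : HasCompactSupport (fun x => (f x : ℂ)) := hs.comp_left (g := fun x : ℝ => (x : ℂ)) (by simp)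
  have h2 : ContDiff ℝ ∞ (fun x => (f x : ℂ)) := Complex.ofRealCLM.contDiff.comp hf
  exact ⟨h1.toSchwartzMap h2, fun x => rfl⟩

lemma supp_of {f : ℝ → ℝ} {G : ℝ → ℂ} (h : ∀ x, G x ≠ 0 → f x ≠ 0) : tsupport G ⊆ tsupport f :=
  closure_mono fun x hx => h x hx

lemma div_smooth {f : ℝ → ℝ} (hf : ContDiff ℝ ∞ f) (h0 : (0:ℝ) ∉ tsupport f) : ContDiff ℝ ∞ (fun x => f x / x) := by
  rw [contDiff_iff_contDiffAt]
  intro x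
  by_cases hx : x = 0
  · subst hx
    have : (fun x => f x / x) =ᶠ[nhds 0] fun _ => 0 := by
      filter_upwards [notMem_tsupport_iff_eventuallyEq.1 h0] with x hx
      simp [hx]
    exact contDiffAt_const.congr_of_eventuallyEq this
  · exact hf.contDiffAt.div contDiffAt_id hx

end PP
end

/-- **Proposition (the `ψ`-`ψ` case).** Let `n = d + 2 ≥ 2` and let `j₀ < j₁` be two of the
`n` frequency coordinates (0-indexed; they correspond to `1 ≤ j₀ < j₁ ≤ n`). Let `ψ¹, ψ²`
be smooth functions compactly supported away from `0`, and for `j ∉ {j₀,j₁}` let `φ^j` be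
smooth and compactly supported. Consider the symbol
`m(ξ) = ∑_{k ∈ ℤ} μ_n(ξ) ψ¹(2^{-k}ξ_{j₀}) ψ²(2^{-k}ξ_{j₁}) ∏_{j ∉ {j₀,j₁}} φ^j(2^{-k}ξ_j)`.
Then for all exponents with `∑_{j=0}^n 1/p_j = 1`, `p₀, p_{j₀}, p_{j₁} ∈ (1,∞)` and
`p_j ∈ (1,∞]` otherwise, there is a constant `c` such that
`|Λ_m(F₀,…,F_n)| ≤ c ∏_{j=0}^n ‖F_j‖_{p_j}` for all Schwartz functions `F_j` on `ℝⁿ`. -/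
theorem psi_psi_case_bound
    (d : ℕ) (j₀ j₁ : Fin (d + 2)) (hjj : j₀ < j₁)
    (ψ₁ ψ₂ : ℝ → ℝ) (φ : Fin (d + 2) → ℝ → ℝ)
    (hψ₁ : ContDiff ℝ (⊤ : ℕ∞) ψ₁) (hψ₁supp : HasCompactSupport ψ₁)
    (hψ₁0 : (0 : ℝ) ∉ tsupport ψ₁)
    (hψ₂ : ContDiff ℝ (⊤ : ℕ∞) ψ₂) (hψ₂supp : HasCompactSupport ψ₂)
    (hψ₂0 : (0 : ℝ) ∉ tsupport ψ₂)
    (hφ : ∀ j : Fin (d + 2), j ≠ j₀ → j ≠ j₁ →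
      ContDiff ℝ (⊤ : ℕ∞) (φ j) ∧ HasCompactSupport (φ j))
    (p : ℕ → ENNReal)
    (hsum : ∑ j ∈ Finset.range (d + 3), (p j)⁻¹ = 1)
    (hp0 : 1 < p 0) (hp0' : p 0 < ⊤)
    (hpj₀ : 1 < p ((j₀ : ℕ) + 1)) (hpj₀' : p ((j₀ : ℕ) + 1) < ⊤)
    (hpj₁ : 1 < p ((j₁ : ℕ) + 1)) (hpj₁' : p ((j₁ : ℕ) + 1) < ⊤)
    (hpother : ∀ j : ℕ, 1 ≤ j → j ≤ d + 2 → j ≠ (j₀ : ℕ) + 1 → j ≠ (j₁ : ℕ) + 1 →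
      1 < p j) :
    ∃ c : ℝ, 0 < c ∧
      ∀ F : ℕ → SchwartzMap (Fin (d + 2) → ℝ) ℂ,
        ‖formM (d + 2)
            (fun ξ => ((∑' k : ℤ, muSymbol (d + 1) ξ *
              ψ₁ ((2:ℝ) ^ (-k) * ξ j₀) * ψ₂ ((2:ℝ) ^ (-k) * ξ j₁) *
              ∏ j ∈ Finset.univ \ {j₀, j₁}, φ j ((2:ℝ) ^ (-k) * ξ j) : ℝ) : ℂ))
            (fun j => ⇑(F j))‖ ≤
          c * ∏ j ∈ Finset.range (d + 3), (eLpNorm (⇑(F j)) (p j) volume).toReal := by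
  have hne : j₀ ≠ j₁ := hjj.ne
  have hG : ∀ j, ∃ G : SchwartzMap ℝ ℂ, HasCompactSupport G ∧ (j = j₀ → (∀ x : ℝ, (ψ₁ x : ℂ) = x * G x) ∧ (0:ℝ) ∉ tsupport G) ∧
      (j = j₁ → (∀ x : ℝ, (ψ₂ x : ℂ) = G x) ∧ (0:ℝ) ∉ tsupport G) ∧ (j ≠ j₀ → j ≠ j₁ → ∀ x : ℝ, (φ j x : ℂ) = G x) := by
    intro j
    by_cases h0 : j = j₀
    · have hs : HasCompactSupport (fun x => ψ₁ x / x) :=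
        hψ₁supp.mono fun x hx => by
          intro h; apply hx; simp [h]
      obtain ⟨G, hG⟩ := PP.toS (PP.div_smooth hψ₁ hψ₁0) hs
      have hsub : tsupport G ⊆ tsupport ψ₁ := PP.supp_of fun x hx h => hx (by rw [hG, h]; simp)
      refine ⟨G, hψ₁supp.isCompact.of_isClosed_subset (isClosed_tsupport _) hsub, fun _ => ⟨fun x => ?_, fun h => hψ₁0 (hsub h)⟩,
        fun h => absurd (h0.symm.trans h) hne, fun h => absurd h0 h⟩
      rw [hG]
      by_cases hx : x = 0
      · subst hx
        have : ψ₁ 0 = 0 := image_eq_zero_of_notMem_tsupport hψ₁0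
        simp [this]
      · have hxc : (x:ℂ) ≠ 0 := by exact_mod_cast hx
        push_cast; field_simp
    · by_cases h1 : j = j₁
      · obtain ⟨G, hG⟩ := PP.toS hψ₂ hψ₂supp
        have hsub : tsupport G ⊆ tsupport ψ₂ := PP.supp_of fun x hx h => hx (by rw [hG, h]; simp)
        exact ⟨G, hψ₂supp.isCompact.of_isClosed_subset (isClosed_tsupport _) hsub, fun h => absurd h h0,
          fun _ => ⟨fun x => (hG x).symm, fun h => hψ₂0 (hsub h)⟩, fun _ h => absurd h1 h⟩
      · obtain ⟨G, hG⟩ := PP.toS (hφ j h0 h1).1 (hφ j h0 h1).2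
        have hsub : tsupport G ⊆ tsupport (φ j) := PP.supp_of fun x hx h => hx (by rw [hG, h]; simp)
        exact ⟨G, (hφ j h0 h1).2.isCompact.of_isClosed_subset (isClosed_tsupport _) hsub, fun h => absurd h h0,
          fun h => absurd h h1, fun _ _ x => (hG x).symm⟩
  choose g hgs hg0 hg1 hgo using hG
  -- a common radius
  have hrad : ∃ r : ℝ, 0 < r ∧ ∀ j x, g j x ≠ 0 → |x| ≤ r := by
    choose r hr using fun j => (hgs j).isCompact.isBounded.subset_closedBall 0
    refine ⟨∑ j, |r j| + 1, by positivity, fun j x hx => ?_⟩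
    have h1 : |x| ≤ r j := by simpa using hr j (subset_tsupport _ hx)
    have h2 : |r j| ≤ ∑ j, |r j| := Finset.single_le_sum (f := fun j => |r j|) (fun _ _ => abs_nonneg _) (Finset.mem_univ j)
    linarith [le_abs_self (r j)]
  obtain ⟨r, hr, hgr⟩ := hrad
  have hp : ∀ i ≤ d + 2, 1 < p i := by
    intro i hi
    rcases Nat.eq_zero_or_pos i with h | h
    · rw [h]; exact hp0
    by_cases h0 : i = (j₀ : ℕ) + 1
    · rw [h0]; exact hpj₀
    by_cases h1 : i = (j₁ : ℕ) + 1
    · rw [h1]; exact hpj₁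
    exact hpother i h hi h0 h1
  obtain ⟨C, hC, HM⟩ := PP.modelg hne g (hgs j₀) (hg0 j₀ rfl).2 (hgs j₁) (hg1 j₁ rfl).2 (1 / (2 * ((d + 2 : ℕ) : ℝ)))
    (by positivity) (by
      rw [div_le_one (by positivity)]; push_cast
      have : (0:ℝ) ≤ d := by positivity
      linarith) p hp hpj₀'.ne hpj₁'.ne hsum
  obtain ⟨B, hB0, HB⟩ := PP.abs_bd (by omega) g hr hgr p hC (ε := 1 / (2 * ((d + 2 : ℕ) : ℝ))) (by positivity) (by
    have : ((d + 2 : ℕ) : ℝ) ≠ 0 := by positivity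
    field_simp) HM
  obtain ⟨i, hi⟩ : ∃ i : Fin (d + 1), i.castSucc = j₀ := Fin.exists_castSucc_eq.2 (by
    intro h; rw [h] at hjj; exact absurd hjj (not_lt.2 (Fin.le_last _)))
  refine ⟨2 * B + 1, by positivity, fun F => ?_⟩
  have hNF := PP.NF_nonneg p F
  obtain ⟨D, hD0, hD⟩ := PP.dyad (g := fun x => (ψ₁ x : ℂ)) (Complex.continuous_ofReal.comp hψ₁.continuous)
    (hψ₁supp.comp_left (g := fun x : ℝ => (x : ℂ)) (by simp))
    (fun h => hψ₁0 ((PP.supp_of (f := ψ₁) (G := fun x => (ψ₁ x : ℂ)) fun x hx h => hx (by simp [h])) h))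
  choose M hM0 hM using fun j => PP.sch_bdd1 (g j)
  have hterm : ∀ (k : ℤ) (ξ : Fin (d + 2) → ℝ), ((muSymbol (d + 1) ξ *
              ψ₁ ((2:ℝ) ^ (-k) * ξ j₀) * ψ₂ ((2:ℝ) ^ (-k) * ξ j₁) *
              ∏ j ∈ Finset.univ \ {j₀, j₁}, φ j ((2:ℝ) ^ (-k) * ξ j) : ℝ) : ℂ) =
      (muSymbol (d + 1) ξ : ℂ) * (ψ₁ ((2:ℝ) ^ (-k) * ξ j₀) : ℂ) * (g j₁ ((2:ℝ) ^ (-k) * ξ j₁) *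
        ∏ j ∈ Finset.univ \ {j₀, j₁}, g j ((2:ℝ) ^ (-k) * ξ j)) := by
    intro k ξ
    rw [← (hg1 j₁ rfl).1, Complex.ofReal_mul, Complex.ofReal_mul, Complex.ofReal_mul, Complex.ofReal_prod, mul_assoc]
    congr 2
    refine Finset.prod_congr rfl fun j hj => ?_
    simp only [Finset.mem_sdiff, Finset.mem_univ, Finset.mem_insert, Finset.mem_singleton, true_and, not_or] at hj
    rw [hgo j hj.1 hj.2]
  have hle : ∀ (k : ℤ) (ξ : Fin (d + 2) → ℝ), ‖((muSymbol (d + 1) ξ *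
              ψ₁ ((2:ℝ) ^ (-k) * ξ j₀) * ψ₂ ((2:ℝ) ^ (-k) * ξ j₁) *
              ∏ j ∈ Finset.univ \ {j₀, j₁}, φ j ((2:ℝ) ^ (-k) * ξ j) : ℝ) : ℂ)‖ ≤
      ‖(ψ₁ ((2:ℝ) ^ (-k) * ξ j₀) : ℂ)‖ * (M j₁ * ∏ j ∈ Finset.univ \ {j₀, j₁}, M j) := by
    intro k ξ
    rw [hterm, norm_mul, norm_mul, norm_mul, norm_prod]
    have h1 : ‖(muSymbol (d + 1) ξ : ℂ)‖ ≤ 1 := by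
      rw [Complex.norm_real]; exact PP.mu_le _ _
    have h2 := hM0 j₁
    gcongr
    · exact mul_le_of_le_one_left (norm_nonneg _) h1
    · exact hM _ _
    · exact hM _ _
  have hDsum : ∀ (S : Finset ℤ) (ξ : Fin (d + 2) → ℝ), ∑ k ∈ S, ‖((muSymbol (d + 1) ξ *
              ψ₁ ((2:ℝ) ^ (-k) * ξ j₀) * ψ₂ ((2:ℝ) ^ (-k) * ξ j₁) *
              ∏ j ∈ Finset.univ \ {j₀, j₁}, φ j ((2:ℝ) ^ (-k) * ξ j) : ℝ) : ℂ)‖ ≤ D * (M j₁ * ∏ j ∈ Finset.univ \ {j₀, j₁}, M j) := by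
    intro S ξ
    refine (Finset.sum_le_sum fun k _ => hle k ξ).trans ?_
    rw [← Finset.sum_mul]
    have : 0 ≤ M j₁ * ∏ j ∈ Finset.univ \ {j₀, j₁}, M j := mul_nonneg (hM0 _) (Finset.prod_nonneg fun j _ => hM0 j)
    gcongr
    exact hD S _
  have hfin : ‖formM (d + 2)
            (fun ξ => ((∑' k : ℤ, muSymbol (d + 1) ξ *
              ψ₁ ((2:ℝ) ^ (-k) * ξ j₀) * ψ₂ ((2:ℝ) ^ (-k) * ξ j₁) *
              ∏ j ∈ Finset.univ \ {j₀, j₁}, φ j ((2:ℝ) ^ (-k) * ξ j) : ℝ) : ℂ))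
            (fun j => ⇑(F j))‖ ≤ 2 * B * PP.NF p F := by
    refine PP.formM_lim F (fun (k : ℤ) ξ => ((muSymbol (d + 1) ξ *
              ψ₁ ((2:ℝ) ^ (-k) * ξ j₀) * ψ₂ ((2:ℝ) ^ (-k) * ξ j₁) *
              ∏ j ∈ Finset.univ \ {j₀, j₁}, φ j ((2:ℝ) ^ (-k) * ξ j) : ℝ) : ℂ)) _ ?_ hDsum ?_ ?_
    · intro k
      simp only [hterm]
      have h1 := PP.mu_meas (d + 1)
      have h2 := hψ₁.continuous.measurable
      have h3 := fun j => (g j).continuous.measurable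
      fun_prop
    · intro ξ
      have hs : Summable (fun k : ℤ => ((muSymbol (d + 1) ξ *
              ψ₁ ((2:ℝ) ^ (-k) * ξ j₀) * ψ₂ ((2:ℝ) ^ (-k) * ξ j₁) *
              ∏ j ∈ Finset.univ \ {j₀, j₁}, φ j ((2:ℝ) ^ (-k) * ξ j) : ℝ) : ℂ)) :=
        Summable.of_norm (summable_of_sum_le (fun _ => norm_nonneg _) fun S => hDsum S ξ)
      exact Complex.hasSum_ofReal.2 (Complex.summable_ofReal.1 hs).hasSum
    · intro S
      refine le_trans (le_of_eq ?_) (PP.avg_bd i g hr hgr p HB S F)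
      congr 2; ext ξ
      refine Finset.sum_congr rfl fun k _ => ?_
      rw [hterm, PP.mu_scale _ _ (by positivity), (hg0 j₀ rfl).1, hi, PP.prod_two hne]
      push_cast
      ring
  refine hfin.trans ?_
  change 2 * B * PP.NF p F ≤ (2 * B + 1) * PP.NF p F
  gcongr
  linarith
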